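/- There exist a bounded ℤ²-periodic velocity field u : ℝ² → ℝ² which is α-Hölder continuous and divergence-free in the distributional sense, a smooth ℤ²-periodic function θ_in : ℝ² → ℝ, a constant c > 0 and a sequence κ_q ∈ (0,1) with κ_q → 0, such that for every q and every classical solution θ : [0,1]×ℝ² → ℝ of the advection–diffusion equation with velocity u, diffusivity κ_q and initial datum θ_in, one has κ_q ∫₀¹ ∫_{[0,1]²} |∇θ(s,x)|² dx ds ≥ c (anomalous dissipation). -/

import Mathlib

open MeasureTheory

noncomputable section

/-- The plane `ℝ²` as a Euclidean space. -/
abbrev E2 := EuclideanSpace ℝ (Fin 2)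

/-- `ℤ²`-periodicity of a function on `ℝ²`. -/
def Per {F : Type*} [AddCommGroup F] (f : E2 → F) : Prop :=
  ∀ (x : E2) (k : Fin 2 → ℤ),
    f (x + (WithLp.equiv 2 (Fin 2 → ℝ)).symm (fun i => (k i : ℝ))) = f x

/-- The periodicity cell `[0,1]²`, identified with the torus `𝕋²`. -/
def cube : Set E2 := {x | ∀ i, x i ∈ Set.Icc (0:ℝ) 1}

/-- The Laplacian of a function on `ℝ²`: sum of second partial derivatives. -/
def lap (f : E2 → ℝ) (x : E2) : ℝ :=
  ∑ i : Fin 2, fderiv ℝ (fun y => fderiv ℝ f y (EuclideanSpace.single i 1)) x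
    (EuclideanSpace.single i 1)

/-- A classical solution of the advection–diffusion equation
`∂ₜθ + u·∇θ = κ Δθ`, `θ(0,·) = θin` on `[0,T] × ℝ²`:  bounded, `ℤ²`-periodic in space,
continuous on `[0,T] × ℝ²`, continuously differentiable in `t` and twice continuously
differentiable in `x` on `(0,T] × ℝ²`, satisfying the equation pointwise there. -/
def IsClassicalSolution (T κ : ℝ) (u : E2 → E2) (θin : E2 → ℝ) (θ : ℝ → E2 → ℝ) : Prop :=
  (∃ C, ∀ t x, |θ t x| ≤ C) ∧
  (∀ t, Per (θ t)) ∧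
  ContinuousOn (fun p : ℝ × E2 => θ p.1 p.2) (Set.Icc 0 T ×ˢ (Set.univ : Set E2)) ∧
  (∀ x : E2, ∀ t ∈ Set.Ioc 0 T, DifferentiableAt ℝ (fun s => θ s x) t) ∧
  ContinuousOn (fun p : ℝ × E2 => deriv (fun s => θ s p.2) p.1)
    (Set.Ioc 0 T ×ˢ (Set.univ : Set E2)) ∧
  (∀ t ∈ Set.Ioc 0 T, ContDiff ℝ 2 (θ t)) ∧
  (∀ t ∈ Set.Ioc 0 T, ∀ x, deriv (fun s => θ s x) t + fderiv ℝ (θ t) x (u x) = κ * lap (θ t) x) ∧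
  (∀ x, θ 0 x = θin x)

namespace AnomalousDissipation

/-- The number of cells into which a cell of generation `i` is divided. -/
def rad (i : ℕ) : ℕ := 2 ^ (24 * i ^ 2 + 24 * i + 8)

/-- The number of cells of generation `i + 1` which are kept in a cell of generation `i`. -/
def num (i : ℕ) : ℕ := rad i - 2 ^ (24 * i ^ 2 + 22 * i)

/-- The side length of a cell of generation `i`. -/
def scale (i : ℕ) : ℝ := (1 / 2) ^ (8 * i ^ 3)

/-- The proportion of a cell of generation `i` which is removed. -/
def ratio (i : ℕ) : ℝ := (1 / 2) ^ (8 + 2 * i)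

/-- The length of the removed part of a cell of generation `i`. -/
def gapLen (i : ℕ) : ℝ := scale i * ratio i

/-- The length of the kept part of a cell of generation `i`. -/
def len (i : ℕ) : ℝ := scale i * (1 - ratio i)

lemma scale_pos (i : ℕ) : 0 < scale i := by unfold scale; positivity
lemma ratio_pos (i : ℕ) : 0 < ratio i := by unfold ratio; positivity
lemma rad_pos (i : ℕ) : 0 < rad i := by unfold rad; positivity
lemma gapLen_pos (i : ℕ) : 0 < gapLen i := mul_pos (scale_pos i) (ratio_pos i)
lemma scale_zero : scale 0 = 1 := by simp [scale]

lemma ratio_eq (i : ℕ) : ratio i = (1 / 4) ^ i / 256 := by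
  unfold ratio; rw [pow_add, pow_mul]; norm_num; ring

lemma ratio_le (i : ℕ) : ratio i ≤ 1 / 256 := by
  rw [ratio_eq]
  have : ((1 : ℝ) / 4) ^ i ≤ 1 := pow_le_one₀ (by norm_num) (by norm_num)
  linarith

lemma len_pos (i : ℕ) : 0 < len i :=
  mul_pos (scale_pos i) (by have := ratio_le i; linarith)

lemma len_add_gapLen (i : ℕ) : len i + gapLen i = scale i := by unfold len gapLen; ring

lemma scale_eq (i : ℕ) : scale i = rad i * scale (i + 1) := by
  unfold scale rad
  rw [show 8 * (i + 1) ^ 3 = 8 * i ^ 3 + (24 * i ^ 2 + 24 * i + 8) by ring, pow_add (1 / 2 : ℝ) (8 * i ^ 3)]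
  have h : (2 : ℝ) ^ (24 * i ^ 2 + 24 * i + 8) * (1 / 2) ^ (24 * i ^ 2 + 24 * i + 8) = 1 := by
    rw [← mul_pow]; norm_num
  rw [Nat.cast_pow, Nat.cast_ofNat, mul_left_comm, h, mul_one]

lemma num_le_rad (i : ℕ) : num i ≤ rad i := Nat.sub_le _ _

lemma num_cast (i : ℕ) : (num i : ℝ) = rad i * (1 - ratio i) := by
  have h : 2 ^ (24 * i ^ 2 + 22 * i) ≤ rad i := by
    unfold rad; exact Nat.pow_le_pow_right (by norm_num) (by omega)
  unfold num
  rw [Nat.cast_sub h]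
  unfold rad ratio
  rw [show 24 * i ^ 2 + 24 * i + 8 = (24 * i ^ 2 + 22 * i) + (8 + 2 * i) by ring]
  push_cast
  rw [pow_add, mul_sub, mul_one, mul_assoc, ← mul_pow]
  norm_num

lemma len_eq (i : ℕ) : len i = num i * scale (i + 1) := by
  unfold len; rw [num_cast, scale_eq i]; ring

lemma rad_ge (i : ℕ) : (256 : ℝ) * 16 ^ i ≤ rad i := by
  unfold rad; push_cast
  rw [pow_add, show (16 : ℝ) = 2 ^ 4 by norm_num, ← pow_mul, mul_comm]
  have : (2 : ℝ) ^ (4 * i) ≤ 2 ^ (24 * i ^ 2 + 24 * i) :=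
    pow_le_pow_right₀ (by norm_num) (by nlinarith)
  norm_num; linarith

lemma rad_ge' (i : ℕ) : (256 : ℝ) ≤ rad i := by
  have := rad_ge i
  have h : (1 : ℝ) ≤ 16 ^ i := one_le_pow₀ (by norm_num)
  linarith

lemma num_ge (i : ℕ) : (128 : ℝ) ≤ num i := by
  rw [num_cast]; have := rad_ge' i; have := ratio_le i; nlinarith

lemma num_pos (i : ℕ) : 0 < num i := by
  have := num_ge i; by_contra h
  have h0 : num i = 0 := by omega
  rw [h0] at this; norm_num at this

lemma scale_succ_le (i : ℕ) : 256 * scale (i + 1) ≤ scale i := by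
  rw [scale_eq i]; have := rad_ge' i; have := scale_pos (i + 1); nlinarith

lemma scale_succ_le_pow (i : ℕ) : 256 * 16 ^ i * scale (i + 1) ≤ scale i := by
  rw [scale_eq i]
  exact mul_le_mul_of_nonneg_right (rad_ge i) (scale_pos _).le

lemma scale_le_pow (i : ℕ) : scale i ≤ (1 / 256) ^ i := by
  induction i with
  | zero => simp [scale]
  | succ i ih => have := scale_succ_le i; rw [pow_succ]; linarith

lemma scale_le_one (i : ℕ) : scale i ≤ 1 :=
  (scale_le_pow i).trans (pow_le_one₀ (by norm_num) (by norm_num))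

lemma rad_succ_ge (i : ℕ) : (256 : ℝ) ^ i * 2 ^ 48 * rad i ≤ rad (i + 1) := by
  unfold rad; push_cast
  rw [show (256 : ℝ) = 2 ^ 8 by norm_num, ← pow_mul, ← pow_add, ← pow_add]
  exact pow_le_pow_right₀ (by norm_num) (by nlinarith)

/-- The smooth bump `6 z (1 - z)` on `[0,1]`. -/
def bump (z : ℝ) : ℝ := 6 * max 0 (min z 1) * (1 - max 0 (min z 1))

lemma bump_nonneg (z : ℝ) : 0 ≤ bump z := by
  unfold bump
  have h1 : 0 ≤ max 0 (min z 1) := le_max_left _ _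
  have h2 : max 0 (min z 1) ≤ 1 := max_le (by norm_num) (min_le_right _ _)
  exact mul_nonneg (by linarith) (by linarith)

lemma bump_le (z : ℝ) : bump z ≤ 3 / 2 := by
  unfold bump; nlinarith [sq_nonneg (2 * max 0 (min z 1) - 1)]

lemma bump_of_le {z : ℝ} (h : z ≤ 0) : bump z = 0 := by
  unfold bump
  rw [min_eq_left (by linarith), max_eq_left h]; ring

lemma bump_of_ge {z : ℝ} (h : 1 ≤ z) : bump z = 0 := by
  unfold bump
  rw [min_eq_right h, max_eq_right (by norm_num)]; ring

lemma bump_pos {z : ℝ} (h0 : 0 < z) (h1 : z < 1) : 0 < bump z := by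
  unfold bump
  rw [min_eq_left h1.le, max_eq_right h0.le]
  exact mul_pos (by linarith) (by linarith)

lemma bump_ne_zero {z : ℝ} (h : bump z ≠ 0) : 0 < z ∧ z < 1 := by
  constructor
  · by_contra h'; exact h (bump_of_le (not_lt.1 h'))
  · by_contra h'; exact h (bump_of_ge (not_lt.1 h'))

@[fun_prop]
lemma continuous_bump : Continuous bump := by unfold bump; fun_prop

lemma bump_lip (y z : ℝ) : |bump y - bump z| ≤ 6 * |y - z| := by
  have key : |max 0 (min y 1) - max 0 (min z 1)| ≤ |y - z| :=
    (abs_max_sub_max_le_max _ _ _ _).trans (by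
      simp only [sub_self, abs_zero]
      refine max_le (abs_nonneg _) ((abs_min_sub_min_le_max _ _ _ _).trans ?_)
      simp)
  unfold bump
  set c := max 0 (min y 1)
  set d := max 0 (min z 1)
  have hc : 0 ≤ c ∧ c ≤ 1 := ⟨le_max_left _ _, max_le (by norm_num) (min_le_right _ _)⟩
  have hd : 0 ≤ d ∧ d ≤ 1 := ⟨le_max_left _ _, max_le (by norm_num) (min_le_right _ _)⟩
  rw [show 6 * c * (1 - c) - 6 * d * (1 - d) = 6 * ((c - d) * (1 - c - d)) by ring, abs_mul,
    abs_mul]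
  have h1 : |1 - c - d| ≤ 1 := abs_le.2 ⟨by linarith, by linarith⟩
  have := mul_le_mul key h1 (abs_nonneg _) (abs_nonneg _)
  rw [abs_of_pos (by norm_num : (0 : ℝ) < 6)]; linarith

/-- A `C¹` step function, equal to `0` on `(-∞,0]` and to `1` on `[1,∞)`. -/
def step (z : ℝ) : ℝ := ∫ s in (0 : ℝ)..z, bump s

lemma hasDerivAt_step (z : ℝ) : HasDerivAt step (bump z) z :=
  intervalIntegral.integral_hasDerivAt_right (continuous_bump.intervalIntegrable _ _)
    continuous_bump.aestronglyMeasurable.stronglyMeasurableAtFilter continuous_bump.continuousAt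

lemma deriv_step : deriv step = bump := funext fun z => (hasDerivAt_step z).deriv

@[fun_prop]
lemma contDiff_step : ContDiff ℝ 1 step :=
  contDiff_one_iff_deriv.2 ⟨fun z => (hasDerivAt_step z).differentiableAt, by
    rw [deriv_step]; exact continuous_bump⟩

lemma step_mono : Monotone step :=
  monotone_of_deriv_nonneg (fun z => (hasDerivAt_step z).differentiableAt)
    (fun z => by rw [deriv_step]; exact bump_nonneg z)

lemma step_of_le {z : ℝ} (h : z ≤ 0) : step z = 0 := by
  unfold step
  rw [intervalIntegral.integral_congr (g := fun _ => (0 : ℝ)), intervalIntegral.integral_zero]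
  intro s hs
  rw [Set.uIcc_of_ge h] at hs
  exact bump_of_le hs.2

lemma step_one : step 1 = 1 := by
  unfold step
  rw [intervalIntegral.integral_congr (g := fun s => 6 * s - 6 * s ^ 2)]
  · rw [intervalIntegral.integral_sub (by apply Continuous.intervalIntegrable; fun_prop)
      (by apply Continuous.intervalIntegrable; fun_prop), intervalIntegral.integral_const_mul,
      intervalIntegral.integral_const_mul, integral_id, integral_pow]
    norm_num
  · intro s hs
    rw [Set.uIcc_of_le zero_le_one] at hs
    simp only [bump]
    rw [min_eq_left hs.2, max_eq_right hs.1]; ring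

lemma step_of_ge {z : ℝ} (h : 1 ≤ z) : step z = 1 := by
  have h1 : step z = step 1 + ∫ s in (1 : ℝ)..z, bump s := by
    unfold step
    rw [intervalIntegral.integral_add_adjacent_intervals] <;>
      exact continuous_bump.intervalIntegrable _ _
  rw [h1, step_one, intervalIntegral.integral_congr (g := fun _ => (0 : ℝ)),
    intervalIntegral.integral_zero, add_zero]
  intro s hs
  rw [Set.uIcc_of_le h] at hs
  exact bump_of_ge hs.1

lemma step_nonneg (z : ℝ) : 0 ≤ step z := by
  rcases le_total z 0 with h | h
  · rw [step_of_le h]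
  · rw [← step_of_le (le_refl 0)]; exact step_mono h

lemma step_le_one (z : ℝ) : step z ≤ 1 := by
  rcases le_total z 1 with h | h
  · rw [← step_one]; exact step_mono h
  · rw [step_of_ge h]

/-- The indices of the cells of generation `i` which are kept. -/
def cells : ℕ → Finset ℕ
  | 0 => {0}
  | i + 1 => (cells i ×ˢ Finset.range (num i)).image (fun p => p.1 * rad i + p.2)

lemma mem_cells_succ {i k : ℕ} :
    k ∈ cells (i + 1) ↔ ∃ j ∈ cells i, ∃ d < num i, k = j * rad i + d := by
  simp only [cells, Finset.mem_image, Finset.mem_product, Finset.mem_range, Prod.exists]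
  constructor
  · rintro ⟨a, b, ⟨ha, hb⟩, rfl⟩; exact ⟨a, ha, b, hb, rfl⟩
  · rintro ⟨a, ha, b, hb, rfl⟩; exact ⟨a, b, ⟨ha, hb⟩, rfl⟩

lemma sum_cells_succ (i : ℕ) (φ : ℕ → ℝ) :
    ∑ k ∈ cells (i + 1), φ k = ∑ j ∈ cells i, ∑ d ∈ Finset.range (num i), φ (j * rad i + d) := by
  rw [cells, Finset.sum_image, Finset.sum_product]
  rintro ⟨a, b⟩ hab ⟨c, d⟩ hcd h
  simp only [Finset.coe_product, Set.mem_prod, Finset.mem_coe, Finset.mem_range] at hab hcd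
  have hb : b < rad i := hab.2.trans_le (num_le_rad i)
  have hd : d < rad i := hcd.2.trans_le (num_le_rad i)
  simp only at h
  have h1 : a = c := by
    have := congrArg (· / rad i) h
    simpa [Nat.add_div_of_dvd_right, Nat.mul_add_div, mul_comm _ (rad i), Nat.div_eq_of_lt hb,
      Nat.div_eq_of_lt hd, rad_pos i, Nat.mul_add_div (rad_pos i)] using this
  subst h1
  ext <;> simp_all

lemma sum_le_of_unique {ι : Type*} {s : Finset ι} {φ : ι → ℝ} {M : ℝ} (h0 : 0 ≤ M)
    (hM : ∀ i ∈ s, φ i ≤ M) (hu : ∀ i ∈ s, ∀ j ∈ s, φ i ≠ 0 → φ j ≠ 0 → i = j) :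
    ∑ i ∈ s, φ i ≤ M := by
  by_cases h : ∃ i ∈ s, φ i ≠ 0
  · obtain ⟨i, hi, hne⟩ := h
    rw [Finset.sum_eq_single_of_mem i hi]
    · exact hM i hi
    · intro j hj hji
      by_contra hj0
      exact hji (hu j hj i hi hj0 hne)
  · push Not at h
    rw [Finset.sum_eq_zero h]; exact h0

lemma abs_sum_le_of_unique {ι : Type*} {s : Finset ι} {φ : ι → ℝ} {M : ℝ} (h0 : 0 ≤ M)
    (hM : ∀ i ∈ s, |φ i| ≤ M) (hu : ∀ i ∈ s, ∀ j ∈ s, φ i ≠ 0 → φ j ≠ 0 → i = j) :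
    |∑ i ∈ s, φ i| ≤ M :=
  (Finset.abs_sum_le_sum_abs _ _).trans (sum_le_of_unique h0 hM (fun i hi j hj h1 h2 =>
    hu i hi j hj (abs_ne_zero.1 h1) (abs_ne_zero.1 h2)))

lemma cell_unique {t y : ℝ} (ht : 0 < t) {j k : ℕ} (h1 : j * t < y) (h2 : y < (j + 1) * t)
    (h3 : k * t < y) (h4 : y < (k + 1) * t) : j = k := by
  have a : (j : ℝ) < k + 1 := lt_of_mul_lt_mul_right (h1.trans h4) ht.le
  have b : (k : ℝ) < j + 1 := lt_of_mul_lt_mul_right (h3.trans h2) ht.le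
  have a' : j < k + 1 := by exact_mod_cast a
  have b' : k < j + 1 := by exact_mod_cast b
  omega

lemma sub_cell_scale (i j d : ℕ) :
    ((j * rad i + d : ℕ) : ℝ) * scale (i + 1) = j * scale i + d * scale (i + 1) := by
  push_cast; rw [scale_eq i]; ring

section

/-- Admissible increments of a generalised Cantor function: `A i` is the increment over a kept cell
of generation `i`. -/
structure Incr (A : ℕ → ℝ) : Prop where
  pos : ∀ i, 0 < A i
  gap : ∀ i, num i * A (i + 1) < A i
  le : ∀ i, A i ≤ 3 * scale (i - 1) * scale i

/-- The size of the density of a Cantor function in the gaps of generation `i`. -/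
def gapAmp (A : ℕ → ℝ) (i : ℕ) : ℝ := (A i - num i * A (i + 1)) / gapLen i

/-- The profile in the gap of the `k`-th cell of generation `i`. -/
def gapBump (i k : ℕ) (y : ℝ) : ℝ := bump ((y - (k * scale i + len i)) / gapLen i)

/-- The part of the density of a Cantor function living in the gaps of generation `i`. -/
def layer (A : ℕ → ℝ) (i : ℕ) (y : ℝ) : ℝ := gapAmp A i * ∑ k ∈ cells i, gapBump i k y

/-- The density of the Cantor function with increments `A`. -/
def dens (A : ℕ → ℝ) (y : ℝ) : ℝ := ∑' i, layer A i y

/-- The Cantor function with increments `A`. -/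
def cdf (A : ℕ → ℝ) (y : ℝ) : ℝ := ∫ s in (0 : ℝ)..y, dens A s

/-- The union of the kept cells of generation `i`. -/
def kept (i : ℕ) : Set ℝ := {y | ∃ k ∈ cells i, k * scale i ≤ y ∧ y ≤ (k + 1) * scale i}

lemma mem_kept_succ_of {i k : ℕ} (hk : k ∈ cells i) {y : ℝ} (h1 : k * scale i ≤ y)
    (h2 : y ≤ k * scale i + len i) : y ∈ kept (i + 1) := by
  have ht := scale_pos (i + 1)
  set z := (y - k * scale i) / scale (i + 1) with hz
  have hz0 : 0 ≤ z := div_nonneg (by linarith) ht.le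
  have hzN : z ≤ num i := by rw [hz, div_le_iff₀ ht, ← len_eq]; linarith
  have hy : y = k * scale i + z * scale (i + 1) := by
    rw [hz, div_mul_cancel₀ _ ht.ne']; ring
  have hN := num_pos i
  rcases lt_or_ge ⌊z⌋₊ (num i) with h | h
  · refine ⟨k * rad i + ⌊z⌋₊, mem_cells_succ.2 ⟨k, hk, _, h, rfl⟩, ?_, ?_⟩
    · rw [sub_cell_scale, hy]
      have := mul_le_mul_of_nonneg_right (Nat.floor_le hz0) ht.le
      linarith
    · rw [add_mul, sub_cell_scale, hy]
      have := mul_le_mul_of_nonneg_right (Nat.lt_floor_add_one z).le ht.le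
      linarith
  · have hzN' : z = num i := le_antisymm hzN (by
      have := Nat.floor_le hz0
      have h' : (num i : ℝ) ≤ ⌊z⌋₊ := by exact_mod_cast h
      linarith)
    have hc : ((num i - 1 : ℕ) : ℝ) = num i - 1 := by
      rw [Nat.cast_sub hN]; simp
    refine ⟨k * rad i + (num i - 1), mem_cells_succ.2 ⟨k, hk, _, by omega, rfl⟩, ?_, ?_⟩
    · rw [sub_cell_scale, hy, hc, hzN']
      nlinarith
    · rw [add_mul, sub_cell_scale, hy, hc, hzN']
      nlinarith

lemma exists_of_mem_kept_succ {i : ℕ} {y : ℝ} (h : y ∈ kept (i + 1)) :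
    ∃ k ∈ cells i, k * scale i ≤ y ∧ y ≤ k * scale i + len i := by
  obtain ⟨k, hk, h1, h2⟩ := h
  obtain ⟨j, hj, d, hd, rfl⟩ := mem_cells_succ.1 hk
  have ht := scale_pos (i + 1)
  rw [sub_cell_scale] at h1
  rw [add_mul, sub_cell_scale] at h2
  refine ⟨j, hj, ?_, ?_⟩
  · have : 0 ≤ d * scale (i + 1) := by positivity
    linarith
  · have hd' : (d : ℝ) + 1 ≤ num i := by exact_mod_cast hd
    rw [len_eq]
    nlinarith

lemma len_le_scale (i : ℕ) : len i ≤ scale i := by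
  have := len_add_gapLen i; have := gapLen_pos i; linarith

lemma kept_succ_subset (i : ℕ) : kept (i + 1) ⊆ kept i := by
  intro y hy
  obtain ⟨k, hk, h1, h2⟩ := exists_of_mem_kept_succ hy
  exact ⟨k, hk, h1, by have := len_le_scale i; linarith⟩

lemma kept_antitone : Antitone kept := antitone_nat_of_succ_le kept_succ_subset

lemma kept_zero : kept 0 = Set.Icc 0 1 := by
  ext y; simp [kept, cells, scale_zero]

lemma kept_subset_Icc (i : ℕ) : kept i ⊆ Set.Icc 0 1 := by
  rw [← kept_zero]; exact kept_antitone (Nat.zero_le i)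

lemma cells_le_one {i k : ℕ} (hk : k ∈ cells i) : (k + 1) * scale i ≤ 1 :=
  (kept_subset_Icc i (⟨k, hk, by have := scale_pos i; nlinarith, le_rfl⟩ :
    ((k : ℝ) + 1) * scale i ∈ kept i)).2

lemma gapBump_nonneg (i k : ℕ) (y : ℝ) : 0 ≤ gapBump i k y := bump_nonneg _

lemma gapBump_ne_zero {i k : ℕ} {y : ℝ} (h : gapBump i k y ≠ 0) :
    k * scale i + len i < y ∧ y < (k + 1) * scale i := by
  obtain ⟨h1, h2⟩ := bump_ne_zero h
  have hg := gapLen_pos i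
  rw [lt_div_iff₀ hg] at h1
  rw [div_lt_iff₀ hg] at h2
  have := len_add_gapLen i
  constructor <;> linarith

lemma gapBump_unique {i j k : ℕ} {y : ℝ} (hj : gapBump i j y ≠ 0) (hk : gapBump i k y ≠ 0) :
    j = k := by
  have h1 := gapBump_ne_zero hj
  have h2 := gapBump_ne_zero hk
  have := len_pos i
  exact cell_unique (scale_pos i) (by linarith [h1.1]) h1.2 (by linarith [h2.1]) h2.2

lemma sum_gapBump_nonneg (i : ℕ) (y : ℝ) : 0 ≤ ∑ k ∈ cells i, gapBump i k y :=
  Finset.sum_nonneg fun k _ => gapBump_nonneg i k y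

lemma sum_gapBump_le (i : ℕ) (y : ℝ) : ∑ k ∈ cells i, gapBump i k y ≤ 3 / 2 :=
  sum_le_of_unique (by norm_num) (fun _ _ => bump_le _) (fun _ _ _ _ h1 h2 => gapBump_unique h1 h2)

lemma sum_gapBump_eq {i k : ℕ} (hk : k ∈ cells i) {y : ℝ} (h : k * scale i + len i ≤ y)
    (h' : y ≤ (k + 1) * scale i) : ∑ k ∈ cells i, gapBump i k y = gapBump i k y := by
  refine Finset.sum_eq_single_of_mem k hk fun j _ hjk => ?_
  by_contra hj
  have h1 := gapBump_ne_zero hj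
  have := len_pos i
  have hy : y < (k + 1) * scale i := by
    refine lt_of_le_of_ne h' fun he => ?_
    have h2 := h1.2
    have h3 := h1.1
    rw [he] at h2 h3
    have h4 : (k : ℝ) + 1 < j + 1 := lt_of_mul_lt_mul_right h2 (scale_pos i).le
    have h5 : (j : ℝ) < k + 1 := lt_of_mul_lt_mul_right (by linarith) (scale_pos i).le
    have h4' : k + 1 < j + 1 := by exact_mod_cast h4
    have h5' : j < k + 1 := by exact_mod_cast h5
    omega
  exact hjk (cell_unique (scale_pos i) (by linarith [h1.1]) h1.2 (by linarith) hy)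

lemma sum_gapBump_lip (i : ℕ) (y z : ℝ) :
    |∑ k ∈ cells i, gapBump i k y - ∑ k ∈ cells i, gapBump i k z| ≤ 6 * (|y - z| / gapLen i) := by
  have key : ∀ y z, ∑ k ∈ cells i, gapBump i k y - ∑ k ∈ cells i, gapBump i k z
      ≤ 6 * (|y - z| / gapLen i) := by
    intro y z
    by_cases h : ∃ k ∈ cells i, gapBump i k y ≠ 0
    · obtain ⟨k, hk, hne⟩ := h
      rw [Finset.sum_eq_single_of_mem k hk (f := fun k => gapBump i k y)
        (fun j _ hj => by by_contra h0; exact hj (gapBump_unique h0 hne))]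
      have h1 := Finset.single_le_sum (f := fun k => gapBump i k z)
        (fun k _ => gapBump_nonneg i k z) hk
      have h2 := bump_lip ((y - (k * scale i + len i)) / gapLen i)
        ((z - (k * scale i + len i)) / gapLen i)
      rw [← sub_div, sub_sub_sub_cancel_right, abs_div, abs_of_pos (gapLen_pos i)] at h2
      have h3 := le_abs_self (gapBump i k y - gapBump i k z)
      simp only [gapBump] at *
      linarith
    · push Not at h
      rw [Finset.sum_eq_zero h]
      have := sum_gapBump_nonneg i z
      have : 0 ≤ 6 * (|y - z| / gapLen i) := by have := gapLen_pos i; positivity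
      linarith
  refine abs_sub_le_iff.2 ⟨key y z, ?_⟩
  rw [abs_sub_comm]; exact key z y

variable {A : ℕ → ℝ}

lemma Incr.gapAmp_pos (hA : Incr A) (i : ℕ) : 0 < gapAmp A i :=
  div_pos (by have := hA.gap i; linarith) (gapLen_pos i)

lemma Incr.gapAmp_le (hA : Incr A) (i : ℕ) : gapAmp A i ≤ 768 * 4 ^ i * scale (i - 1) := by
  rw [gapAmp, div_le_iff₀ (gapLen_pos i), gapLen, ratio_eq, one_div_pow]
  have h1 := hA.le i
  have h2 : 0 < num i * A (i + 1) := mul_pos (by exact_mod_cast num_pos i) (hA.pos _)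
  have h4 : (4 : ℝ) ^ i ≠ 0 := by positivity
  have : 768 * 4 ^ i * scale (i - 1) * (scale i * (1 / 4 ^ i / 256))
      = 3 * scale (i - 1) * scale i := by field_simp; ring
  linarith

lemma scale_add_le (i m : ℕ) : scale (i + m) ≤ scale i * (1 / 256) ^ m := by
  induction m with
  | zero => simp
  | succ m ih => have := scale_succ_le (i + m); rw [pow_succ, ← add_assoc]; linarith

lemma scale_pred_add_le (i m : ℕ) : scale (i + m - 1) ≤ 256 * scale (i - 1) * (1 / 256) ^ m := by
  rcases i with _ | i
  · rcases m with _ | m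
    · simp; have := scale_pos 0; linarith
    · have := scale_le_pow m
      simp only [Nat.zero_add, Nat.add_sub_cancel, Nat.zero_sub, scale_zero]
      rw [pow_succ]; linarith
  · have := scale_add_le i m
    rw [show i + 1 + m - 1 = i + m by omega, Nat.add_sub_cancel]
    have h2 : 0 ≤ scale i * (1 / 256) ^ m := mul_nonneg (scale_pos i).le (by positivity)
    linarith

lemma Incr.gapAmp_add_le (hA : Incr A) (i m : ℕ) :
    gapAmp A (i + m) ≤ 196608 * 4 ^ i * scale (i - 1) * (1 / 64) ^ m := by
  have h1 := hA.gapAmp_le (i + m)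
  have h2 := mul_le_mul_of_nonneg_left (scale_pred_add_le i m)
    (by positivity : (0 : ℝ) ≤ 768 * 4 ^ (i + m))
  have h3 : (4 : ℝ) ^ m * (1 / 256) ^ m = (1 / 64) ^ m := by rw [← mul_pow]; norm_num
  calc gapAmp A (i + m) ≤ _ := h1
    _ ≤ _ := h2
    _ = _ := by rw [pow_add, ← h3]; ring

lemma Incr.layer_nonneg (hA : Incr A) (i : ℕ) (y : ℝ) : 0 ≤ layer A i y :=
  mul_nonneg (hA.gapAmp_pos i).le (sum_gapBump_nonneg i y)

lemma Incr.layer_le (hA : Incr A) (i : ℕ) (y : ℝ) : layer A i y ≤ 3 / 2 * gapAmp A i := by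
  have := mul_le_mul_of_nonneg_left (sum_gapBump_le i y) (hA.gapAmp_pos i).le
  unfold layer; linarith

lemma Incr.layer_add_le (hA : Incr A) (i m : ℕ) (y : ℝ) :
    layer A (i + m) y ≤ 294912 * 4 ^ i * scale (i - 1) * (1 / 64) ^ m := by
  have := hA.layer_le (i + m) y
  have := hA.gapAmp_add_le i m
  linarith

lemma continuous_layer (i : ℕ) : Continuous (layer A i) := by
  unfold layer gapBump; fun_prop

lemma summable_majorant (c : ℝ) : Summable fun m : ℕ => c * (1 / 64 : ℝ) ^ m :=
  (summable_geometric_of_lt_one (by norm_num) (by norm_num)).mul_left c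

lemma Incr.layer_bound (hA : Incr A) (i : ℕ) (y : ℝ) :
    ‖layer A i y‖ ≤ 294912 * (1 / 64) ^ i := by
  rw [Real.norm_of_nonneg (hA.layer_nonneg i y)]
  have := hA.layer_add_le 0 i y
  simpa [scale_zero] using this

lemma Incr.summable_layer (hA : Incr A) (y : ℝ) : Summable fun i => layer A i y :=
  Summable.of_norm_bounded (summable_majorant 294912) (fun i => hA.layer_bound i y)

lemma Incr.continuous_dens (hA : Incr A) : Continuous (dens A) :=
  continuous_tsum continuous_layer (summable_majorant 294912) hA.layer_bound

lemma Incr.dens_nonneg (hA : Incr A) (y : ℝ) : 0 ≤ dens A y :=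
  tsum_nonneg fun i => hA.layer_nonneg i y

lemma Incr.hasDerivAt_cdf (hA : Incr A) (y : ℝ) : HasDerivAt (cdf A) (dens A y) y :=
  intervalIntegral.integral_hasDerivAt_right (hA.continuous_dens.intervalIntegrable _ _)
    hA.continuous_dens.aestronglyMeasurable.stronglyMeasurableAtFilter
    hA.continuous_dens.continuousAt

lemma Incr.deriv_cdf (hA : Incr A) : deriv (cdf A) = dens A :=
  funext fun y => (hA.hasDerivAt_cdf y).deriv

lemma Incr.contDiff_cdf (hA : Incr A) : ContDiff ℝ 1 (cdf A) :=
  contDiff_one_iff_deriv.2 ⟨fun z => (hA.hasDerivAt_cdf z).differentiableAt, by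
    rw [hA.deriv_cdf]; exact hA.continuous_dens⟩

lemma Incr.monotone_cdf (hA : Incr A) : Monotone (cdf A) :=
  monotone_of_deriv_nonneg (fun z => (hA.hasDerivAt_cdf z).differentiableAt)
    (fun z => by rw [hA.deriv_cdf]; exact hA.dens_nonneg z)

lemma cdf_zero : cdf A 0 = 0 := by simp [cdf]

lemma mem_kept_of_layer_ne_zero {i : ℕ} {y : ℝ} (h : layer A i y ≠ 0) :
    ∃ k ∈ cells i, k * scale i + len i < y ∧ y < (k + 1) * scale i := by
  by_contra h'
  refine h ?_
  unfold layer
  rw [Finset.sum_eq_zero, mul_zero]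
  intro k hk
  by_contra hne
  exact h' ⟨k, hk, gapBump_ne_zero hne⟩

lemma layer_eq_zero_of_mem_kept {i j : ℕ} (hij : j < i) {y : ℝ} (hy : y ∈ kept i) :
    layer A j y = 0 := by
  by_contra h
  obtain ⟨k, hk, h1, h2⟩ := mem_kept_of_layer_ne_zero h
  obtain ⟨l, hl, h3, h4⟩ := exists_of_mem_kept_succ (kept_antitone (Nat.succ_le_of_lt hij) hy)
  have hg := gapLen_pos j
  have hl' := len_pos j
  have he := len_add_gapLen j
  have ht := scale_pos j
  have a : (l : ℝ) < k + 1 := lt_of_mul_lt_mul_right (h3.trans_lt h2) ht.le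
  have b : (k : ℝ) < l + 1 := lt_of_mul_lt_mul_right (by linarith) ht.le
  have a' : l < k + 1 := by exact_mod_cast a
  have b' : k < l + 1 := by exact_mod_cast b
  have : k = l := by omega
  subst this
  linarith

lemma layer_eq_zero_of_gap {i j k : ℕ} (hij : i < j) {y : ℝ}
    (h1 : k * scale i + len i < y) (h2 : y < (k + 1) * scale i) :
    layer A j y = 0 := by
  by_contra h
  obtain ⟨l, hl, h3, h4⟩ := mem_kept_of_layer_ne_zero h
  have hl' := len_pos j
  have hy : y ∈ kept (i + 1) := kept_antitone (Nat.succ_le_of_lt hij) ⟨l, hl, by linarith, h4.le⟩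
  obtain ⟨m, hm, h5, h6⟩ := exists_of_mem_kept_succ hy
  have hg := gapLen_pos i
  have hl' := len_pos i
  have he := len_add_gapLen i
  have ht := scale_pos i
  have a : (m : ℝ) < k + 1 := lt_of_mul_lt_mul_right (h5.trans_lt h2) ht.le
  have b : (k : ℝ) < m + 1 := lt_of_mul_lt_mul_right (by linarith) ht.le
  have a' : m < k + 1 := by exact_mod_cast a
  have b' : k < m + 1 := by exact_mod_cast b
  have : k = m := by omega
  subst this
  linarith

lemma dens_eq_zero_of_notMem {y : ℝ} (hy : y ∉ Set.Ioo (0 : ℝ) 1) : dens A y = 0 := by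
  unfold dens
  rw [tsum_congr (g := fun _ => (0 : ℝ)), tsum_zero]
  intro i
  by_contra h
  obtain ⟨k, hk, h1, h2⟩ := mem_kept_of_layer_ne_zero h
  have hl := len_pos i
  have h3 : 0 ≤ k * scale i := by have := scale_pos i; positivity
  exact hy ⟨by linarith, h2.trans_le (cells_le_one hk)⟩

lemma Incr.dens_le_of_mem_kept (hA : Incr A) {i : ℕ} {y : ℝ} (hy : y ∈ kept i) :
    dens A y ≤ 300000 * 4 ^ i * scale (i - 1) := by
  have h0 : dens A y = ∑' m, layer A (m + i) y := by
    unfold dens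
    rw [← (hA.summable_layer y).sum_add_tsum_nat_add i, Finset.sum_eq_zero, zero_add]
    intro j hj
    exact layer_eq_zero_of_mem_kept (Finset.mem_range.1 hj) hy
  have h1 : ∑' m, layer A (m + i) y
      ≤ ∑' m, 294912 * 4 ^ i * scale (i - 1) * (1 / 64) ^ m := by
    have h2 : ∀ m, layer A (m + i) y ≤ 294912 * 4 ^ i * scale (i - 1) * (1 / 64) ^ m :=
      fun m => by rw [add_comm m i]; exact hA.layer_add_le i m y
    exact ((summable_nat_add_iff i).2 (hA.summable_layer y)).tsum_le_tsum h2
      (summable_majorant (294912 * 4 ^ i * scale (i - 1)))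
  rw [tsum_mul_left, tsum_geometric_of_lt_one (by norm_num) (by norm_num)] at h1
  rw [h0]
  refine h1.trans ?_
  have : 0 ≤ 4 ^ i * scale (i - 1) := mul_nonneg (by positivity) (scale_pos _).le
  norm_num
  linarith

lemma Incr.dens_le (hA : Incr A) (y : ℝ) : dens A y ≤ 300000 := by
  by_cases hy : y ∈ Set.Ioo (0 : ℝ) 1
  · have := hA.dens_le_of_mem_kept (i := 0) (y := y) (by rw [kept_zero]; exact ⟨hy.1.le, hy.2.le⟩)
    simpa [scale_zero] using this
  · rw [dens_eq_zero_of_notMem hy]; norm_num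

lemma dens_eq_of_gap {i k : ℕ} (hk : k ∈ cells i) {y : ℝ}
    (h1 : k * scale i + len i < y) (h2 : y < (k + 1) * scale i) :
    dens A y = gapAmp A i * gapBump i k y := by
  unfold dens
  rw [tsum_eq_single i]
  · rw [layer, sum_gapBump_eq hk h1.le h2.le]
  · intro j hj
    have := len_pos i
    rcases lt_or_gt_of_ne hj with h | h
    · exact layer_eq_zero_of_mem_kept h ⟨k, hk, by linarith, h2.le⟩
    · exact layer_eq_zero_of_gap h h1 h2

lemma Incr.dens_pos_of_gap (hA : Incr A) {i k : ℕ} (hk : k ∈ cells i) {y : ℝ}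
    (h1 : k * scale i + len i < y) (h2 : y < (k + 1) * scale i) : 0 < dens A y := by
  rw [dens_eq_of_gap hk h1 h2]
  have hg := gapLen_pos i
  have := len_add_gapLen i
  exact mul_pos (hA.gapAmp_pos i) (bump_pos (div_pos (by linarith) hg)
    (by rw [div_lt_one hg]; linarith))

lemma Incr.mem_kept_of_dens_eq_zero (hA : Incr A) {y : ℝ} (hy : y ∈ Set.Icc (0 : ℝ) 1)
    (h0 : dens A y = 0) (hn : ∀ i j : ℕ, y ≠ j * scale i) (n : ℕ) : y ∈ kept n := by
  induction n with
  | zero => rwa [kept_zero]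
  | succ n ih =>
    obtain ⟨k, hk, h1, h2⟩ := ih
    refine mem_kept_succ_of hk h1 ?_
    by_contra h
    have h3 : y ≠ (k + 1) * scale n := by exact_mod_cast hn n (k + 1)
    exact (hA.dens_pos_of_gap hk (not_le.1 h) (lt_of_le_of_ne h2 h3)).ne' h0

lemma Incr.cdf_sub (hA : Incr A) (y z : ℝ) : cdf A z - cdf A y = ∫ s in y..z, dens A s := by
  unfold cdf
  rw [intervalIntegral.integral_interval_sub_left] <;>
    exact hA.continuous_dens.intervalIntegrable _ _

lemma Incr.integral_gap (hA : Incr A) {i k : ℕ} (hk : k ∈ cells i) :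
    cdf A ((k + 1) * scale i) - cdf A (k * scale i + len i) = A i - num i * A (i + 1) := by
  have hg := gapLen_pos i
  have he := len_add_gapLen i
  have key : ∀ y, HasDerivAt (fun y => (A i - num i * A (i + 1)) *
      step ((y - (k * scale i + len i)) / gapLen i)) (gapAmp A i * gapBump i k y) y := by
    intro y
    have h1 : HasDerivAt (fun y => (y - (k * scale i + len i)) / gapLen i) (1 / gapLen i) y :=
      ((hasDerivAt_id y).sub_const _).div_const _
    have := ((hasDerivAt_step _).comp y h1).const_mul (A i - num i * A (i + 1))
    refine this.congr_deriv ?_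
    unfold gapAmp gapBump; ring
  rw [hA.cdf_sub, intervalIntegral.integral_congr_ae (g := fun y => gapAmp A i * gapBump i k y)]
  · rw [intervalIntegral.integral_eq_sub_of_hasDerivAt (fun y _ => key y)
      (by apply Continuous.intervalIntegrable; unfold gapBump; fun_prop)]
    rw [step_of_ge, step_of_le]
    · ring
    · simp
    · rw [le_div_iff₀ hg]; linarith
  · have hle : k * scale i + len i ≤ (k + 1) * scale i := by linarith
    rw [Set.uIoc_of_le hle]
    have hne : ∀ᵐ y : ℝ, y ≠ (k + 1) * scale i := by
      simp [ae_iff, measure_singleton]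
    filter_upwards [hne] with y hy hmem
    exact dens_eq_of_gap hk hmem.1 (lt_of_le_of_ne hmem.2 hy)

lemma Incr.cdf_cell_aux (hA : Incr A) (n : ℕ) : ∀ i, ∀ k ∈ cells i,
    |cdf A ((k + 1) * scale i) - cdf A (k * scale i) - A i|
      ≤ scale i * (300003 * 4 ^ (i + n) * scale (i + n - 1)) := by
  induction n with
  | zero =>
    intro i k hk
    have ht := scale_pos i
    have h1 : cdf A ((k + 1) * scale i) - cdf A (k * scale i)
        ≤ (300000 * 4 ^ i * scale (i - 1)) * ((k + 1) * scale i - k * scale i) := by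
      rw [hA.cdf_sub]
      have hle : k * scale i ≤ (k + 1) * scale i := by linarith
      have := intervalIntegral.integral_mono_on (μ := volume) hle
        (hA.continuous_dens.intervalIntegrable _ _)
        ((continuous_const (y := (300000 * 4 ^ i * scale (i - 1)))).intervalIntegrable _ _)
        (fun y hy => hA.dens_le_of_mem_kept (i := i) ⟨k, hk, hy.1, hy.2⟩)
      rw [intervalIntegral.integral_const, smul_eq_mul] at this
      linarith
    have h2 := hA.le i
    have h3 := hA.pos i
    have h4 := hA.monotone_cdf (show k * scale i ≤ (k + 1) * scale i by linarith)
    have h5 : (1 : ℝ) ≤ 4 ^ i := one_le_pow₀ (by norm_num)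
    have h6 : 0 ≤ scale (i - 1) * scale i := mul_nonneg (scale_pos _).le ht.le
    have h7 : scale (i - 1) * scale i ≤ 4 ^ i * (scale (i - 1) * scale i) :=
      le_mul_of_one_le_left h6 h5
    simp only [add_zero]
    rw [abs_le]
    constructor <;> nlinarith
  | succ n ih =>
    intro i k hk
    have ht := scale_pos i
    have hstep : ∀ d : ℕ, cdf A (k * scale i + d * scale (i + 1)) - cdf A (k * scale i)
        = ∑ e ∈ Finset.range d, (cdf A ((((k * rad i + e : ℕ) : ℝ) + 1) * scale (i + 1))
          - cdf A (((k * rad i + e : ℕ) : ℝ) * scale (i + 1))) := by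
      intro d
      induction d with
      | zero => simp
      | succ d ihd =>
        rw [Finset.sum_range_succ, ← ihd, add_mul, sub_cell_scale]
        push_cast
        rw [add_mul]
        ring_nf
    have h1 := hstep (num i)
    rw [← len_eq] at h1
    have h2 := hA.integral_gap hk
    have h3 : cdf A ((k + 1) * scale i) - cdf A (k * scale i) - A i
        = ∑ e ∈ Finset.range (num i), (cdf A ((((k * rad i + e : ℕ) : ℝ) + 1) * scale (i + 1))
          - cdf A (((k * rad i + e : ℕ) : ℝ) * scale (i + 1)) - A (i + 1)) := by
      rw [Finset.sum_sub_distrib, ← h1]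
      simp only [Finset.sum_const, Finset.card_range, nsmul_eq_mul]
      linarith
    rw [h3]
    refine (Finset.abs_sum_le_sum_abs _ _).trans ((Finset.sum_le_sum fun e he =>
      ih (i + 1) _ (mem_cells_succ.2 ⟨k, hk, e, Finset.mem_range.1 he, rfl⟩)).trans ?_)
    rw [Finset.sum_const, Finset.card_range, nsmul_eq_mul, ← mul_assoc, ← len_eq,
      show i + 1 + n = i + (n + 1) by ring]
    exact mul_le_mul_of_nonneg_right (len_le_scale i)
      (mul_nonneg (by positivity) (scale_pos _).le)

lemma Incr.cdf_cell (hA : Incr A) {i k : ℕ} (hk : k ∈ cells i) :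
    cdf A ((k + 1) * scale i) = cdf A (k * scale i) + A i := by
  have h : ∀ n, |cdf A ((k + 1) * scale i) - cdf A (k * scale i) - A i|
      ≤ (300003 * 256 * 4 ^ i) * (1 / 64) ^ n := by
    intro n
    refine (hA.cdf_cell_aux n i k hk).trans ?_
    have h1 := scale_pred_add_le i n
    have h2 := scale_le_one i
    have h2' := scale_pos i
    have h3 := scale_le_one (i - 1)
    have h3' := scale_pos (i - 1)
    have h4 : (4 : ℝ) ^ n * (1 / 256) ^ n = (1 / 64) ^ n := by rw [← mul_pow]; norm_num
    have h5 : scale (i + n - 1) ≤ 256 * (1 / 256) ^ n := by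
      refine h1.trans ?_
      have : (0 : ℝ) ≤ (1 / 256) ^ n := by positivity
      nlinarith
    have h6 : 300003 * 4 ^ (i + n) * scale (i + n - 1)
        ≤ 300003 * 4 ^ (i + n) * (256 * (1 / 256) ^ n) :=
      mul_le_mul_of_nonneg_left h5 (by positivity)
    have h7 : 0 ≤ 300003 * 4 ^ (i + n) * scale (i + n - 1) :=
      mul_nonneg (by positivity) (scale_pos _).le
    calc _ ≤ 1 * (300003 * 4 ^ (i + n) * scale (i + n - 1)) :=
          mul_le_mul_of_nonneg_right h2 h7
      _ ≤ 300003 * 4 ^ (i + n) * (256 * (1 / 256) ^ n) := by linarith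
      _ = _ := by rw [← h4, pow_add]; ring
  have hlim : Filter.Tendsto (fun n : ℕ => (300003 * 256 * 4 ^ i : ℝ) * (1 / 64) ^ n)
      Filter.atTop (nhds 0) := by
    have := (tendsto_pow_atTop_nhds_zero_of_lt_one (r := (1 / 64 : ℝ)) (by norm_num)
      (by norm_num)).const_mul (300003 * 256 * 4 ^ i : ℝ)
    simpa using this
  have h0 := ge_of_tendsto' hlim h
  have := abs_nonpos_iff.1 h0
  linarith

lemma Incr.cdf_sub_node (hA : Incr A) {i k : ℕ} (hk : k ∈ cells i) {d : ℕ} (hd : d ≤ num i) :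
    cdf A (k * scale i + d * scale (i + 1)) = cdf A (k * scale i) + d * A (i + 1) := by
  induction d with
  | zero => simp
  | succ d ih =>
    have h1 := hA.cdf_cell (mem_cells_succ.2 ⟨k, hk, d, by omega, rfl⟩)
    rw [add_mul, sub_cell_scale, ih (by omega)] at h1
    push_cast
    rw [add_mul, ← add_assoc, add_mul, h1]; ring

lemma Incr.cdf_len (hA : Incr A) {i k : ℕ} (hk : k ∈ cells i) :
    cdf A (k * scale i + len i) = cdf A (k * scale i) + num i * A (i + 1) := by
  rw [len_eq]; exact hA.cdf_sub_node hk le_rfl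

lemma Incr.cdf_one (hA : Incr A) : cdf A 1 = A 0 := by
  have := hA.cdf_cell (i := 0) (k := 0) (by simp [cells])
  simpa [scale_zero, cdf_zero] using this

end

section

variable {A : ℕ → ℝ}

/-- The periodic extension of the density of a Cantor function. -/
def perDens (A : ℕ → ℝ) (y : ℝ) : ℝ := dens A (Int.fract y)

lemma perDens_of_mem {y : ℝ} (hy : y ∈ Set.Icc (0 : ℝ) 1) : perDens A y = dens A y := by
  unfold perDens
  rcases eq_or_lt_of_le hy.2 with h | h
  · rw [h, Int.fract_one, dens_eq_zero_of_notMem (by simp), dens_eq_zero_of_notMem (by simp)]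
  · rw [Int.fract_eq_self.2 ⟨hy.1, h⟩]

lemma perDens_add_int (y : ℝ) (k : ℤ) : perDens A (y + k) = perDens A y := by
  unfold perDens; rw [Int.fract_add_intCast]

lemma Incr.layer_holder (hA : Incr A) {α : ℝ} (h0 : 0 < α) (h1 : α < 1) (i : ℕ) (y z : ℝ) :
    |layer A i y - layer A i z| ≤ 6 * gapAmp A i * (gapLen i) ^ (-α) * |y - z| ^ α := by
  have hg := gapLen_pos i
  have ha := hA.gapAmp_pos i
  set r := |y - z| / gapLen i with hr
  have hr0 : 0 ≤ r := by positivity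
  have key : |∑ k ∈ cells i, gapBump i k y - ∑ k ∈ cells i, gapBump i k z| ≤ 6 * r ^ α := by
    rcases le_total r 1 with h | h
    · refine (sum_gapBump_lip i y z).trans ?_
      have : r ^ (1 : ℝ) ≤ r ^ α := by
        rcases eq_or_lt_of_le hr0 with h' | h'
        · rw [← h', Real.zero_rpow one_ne_zero, Real.zero_rpow h0.ne']
        · exact Real.rpow_le_rpow_of_exponent_ge h' h h1.le
      rw [Real.rpow_one] at this
      linarith
    · have h2 := sum_gapBump_nonneg i y
      have h3 := sum_gapBump_nonneg i z
      have h4 := sum_gapBump_le i y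
      have h5 := sum_gapBump_le i z
      have := Real.one_le_rpow h h0.le
      rw [abs_le]; constructor <;> linarith
  have h6 : r ^ α = (gapLen i) ^ (-α) * |y - z| ^ α := by
    rw [hr, Real.div_rpow (abs_nonneg _) hg.le, Real.rpow_neg hg.le]; ring
  unfold layer
  rw [← mul_sub, abs_mul, abs_of_pos ha]
  refine (mul_le_mul_of_nonneg_left key ha.le).trans (le_of_eq ?_)
  rw [h6]; ring

lemma Incr.holder_coeff_le (hA : Incr A) {α : ℝ} (h0 : 0 < α) (h1 : α < 1) {i : ℕ}
    (hi : 4 / (1 - α) + 1 ≤ i) :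
    gapAmp A i * (gapLen i) ^ (-α) ≤ 768 * 256 * 2 ^ 8 * (1 / 16) ^ i := by
  have hβ : 0 < 1 - α := by linarith
  have hi4 : 4 ≤ (1 - α) * i := by
    have := mul_le_mul_of_nonneg_left hi hβ.le
    have h2 : (1 - α) * (4 / (1 - α) + 1) = 4 + (1 - α) := by field_simp
    linarith
  have hi1 : (1 : ℝ) ≤ i := by
    have : 0 ≤ 4 / (1 - α) := by positivity
    linarith
  obtain ⟨j, rfl⟩ : ∃ j, i = j + 1 := ⟨i - 1, by have : 1 ≤ i := by exact_mod_cast hi1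
                                                 omega⟩
  have hamp := hA.gapAmp_le (j + 1)
  rw [Nat.add_sub_cancel] at hamp
  have hlen : (gapLen (j + 1)) ^ (-α)
      = (scale (j + 1)) ^ (-α) * (ratio (j + 1)) ^ (-α) := by
    unfold gapLen
    exact Real.mul_rpow (scale_pos _).le (ratio_pos _).le
  have hr : (ratio (j + 1)) ^ (-α) ≤ 256 * 4 ^ (j + 1) := by
    have h3 : (ratio (j + 1)) ^ (-α) ≤ (ratio (j + 1)) ^ (-1 : ℝ) :=
      Real.rpow_le_rpow_of_exponent_ge (ratio_pos _) (by have := ratio_le (j + 1); linarith)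
        (by linarith)
    refine h3.trans (le_of_eq ?_)
    rw [Real.rpow_neg_one, ratio_eq, one_div_pow]
    field_simp
  have hs : scale j * (scale (j + 1)) ^ (-α) ≤ 2 ^ 8 * (1 / 256) ^ (j + 1) := by
    have e1 : scale j = (2 : ℝ) ^ (-(8 * (j : ℝ) ^ 3)) := by
      unfold scale
      rw [Real.rpow_neg (by norm_num), one_div, inv_pow]
      congr 1
      rw [← Real.rpow_natCast]; push_cast; rfl
    have e2 : (scale (j + 1)) ^ (-α) = (2 : ℝ) ^ (8 * α * ((j : ℝ) + 1) ^ 3) := by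
      unfold scale
      rw [one_div, inv_pow, Real.inv_rpow (by positivity), Real.rpow_neg (by positivity),
        inv_inv, ← Real.rpow_natCast, ← Real.rpow_mul (by norm_num)]
      congr 1
      push_cast; ring
    have e3 : (2 : ℝ) ^ 8 * (1 / 256) ^ (j + 1) = (2 : ℝ) ^ (8 - 8 * ((j : ℝ) + 1)) := by
      rw [Real.rpow_sub (by norm_num), Real.rpow_mul (by norm_num)]
      rw [one_div, inv_pow, div_eq_mul_inv]
      congr 1
      · norm_num
      · rw [show ((2 : ℝ) ^ (8 : ℝ)) = 256 by norm_num, ← Real.rpow_natCast]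
        push_cast; rfl
    rw [e1, e2, e3, ← Real.rpow_add (by norm_num)]
    refine Real.rpow_le_rpow_of_exponent_le (by norm_num) ?_
    push_cast at hi4 hi1
    have hj : (0 : ℝ) ≤ j := Nat.cast_nonneg j
    have h5 : 4 * ((j : ℝ) + 1) ^ 2 ≤ (1 - α) * ((j : ℝ) + 1) ^ 3 := by
      have := mul_le_mul_of_nonneg_right hi4 (by positivity : (0 : ℝ) ≤ ((j : ℝ) + 1) ^ 2)
      nlinarith
    nlinarith
  have h4 : (4 : ℝ) ^ (j + 1) * 4 ^ (j + 1) * (1 / 256) ^ (j + 1) = (1 / 16) ^ (j + 1) := by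
    rw [← mul_pow, ← mul_pow]; norm_num
  have hsp := Real.rpow_pos_of_pos (scale_pos (j + 1)) (-α)
  have hrp := Real.rpow_pos_of_pos (ratio_pos (j + 1)) (-α)
  have hsj := scale_pos j
  rw [hlen]
  calc gapAmp A (j + 1) * ((scale (j + 1)) ^ (-α) * (ratio (j + 1)) ^ (-α))
      ≤ (768 * 4 ^ (j + 1) * scale j) * ((scale (j + 1)) ^ (-α) * (256 * 4 ^ (j + 1))) := by
        gcongr
    _ = 768 * 256 * (4 ^ (j + 1) * 4 ^ (j + 1)) * (scale j * (scale (j + 1)) ^ (-α)) := by ring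
    _ ≤ 768 * 256 * (4 ^ (j + 1) * 4 ^ (j + 1)) * (2 ^ 8 * (1 / 256) ^ (j + 1)) := by gcongr
    _ = _ := by rw [← h4]; ring

lemma Incr.dens_holder (hA : Incr A) {α : ℝ} (h0 : 0 < α) (h1 : α < 1) :
    ∃ M, 0 ≤ M ∧ ∀ y z, |dens A y - dens A z| ≤ M * |y - z| ^ α := by
  set m : ℕ → ℝ := fun i => 6 * gapAmp A i * (gapLen i) ^ (-α) with hm
  have hpos : ∀ i, 0 ≤ m i := fun i =>
    mul_nonneg (mul_nonneg (by norm_num) (hA.gapAmp_pos i).le)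
      (Real.rpow_nonneg (gapLen_pos i).le _)
  have hsum : Summable m := by
    have hg : Summable fun i : ℕ => 6 * (768 * 256 * 2 ^ 8) * (1 / 16 : ℝ) ^ i :=
      (summable_geometric_of_lt_one (by norm_num) (by norm_num)).mul_left _
    refine Summable.of_norm_bounded_eventually_nat hg ?_
    filter_upwards [Filter.eventually_ge_atTop ⌈4 / (1 - α) + 1⌉₊] with i hi
    rw [Real.norm_of_nonneg (hpos i)]
    have := hA.holder_coeff_le h0 h1 ((Nat.le_ceil _).trans (Nat.cast_le.2 hi))
    simp only [hm]
    linarith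
  refine ⟨∑' i, m i, tsum_nonneg hpos, fun y z => ?_⟩
  have hs : Summable fun i => m i * |y - z| ^ α := hsum.mul_right _
  unfold dens
  rw [← (hA.summable_layer y).tsum_sub (hA.summable_layer z), ← tsum_mul_right, ← Real.norm_eq_abs]
  refine tsum_of_norm_bounded hs.hasSum fun i => ?_
  rw [Real.norm_eq_abs]
  exact hA.layer_holder h0 h1 i y z

lemma Incr.perDens_holder (hA : Incr A) {α : ℝ} (h0 : 0 < α) (h1 : α < 1) :
    ∃ M, 0 ≤ M ∧ ∀ y z, |perDens A y - perDens A z| ≤ M * |y - z| ^ α := by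
  obtain ⟨M, hM, h⟩ := hA.dens_holder h0 h1
  have key : ∀ y z, y ≤ z → |perDens A y - perDens A z| ≤ 2 * M * |y - z| ^ α := by
    intro y z hyz
    have hp : 0 ≤ |y - z| ^ α := Real.rpow_nonneg (abs_nonneg _) _
    unfold perDens
    rcases eq_or_lt_of_le (Int.floor_mono hyz) with he | hl
    · have : Int.fract y - Int.fract z = y - z := by unfold Int.fract; rw [he]; ring
      have h2 := h (Int.fract y) (Int.fract z)
      rw [this] at h2
      nlinarith
    · have hz : dens A 0 = 0 := dens_eq_zero_of_notMem (by simp)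
      have ho : dens A 1 = 0 := dens_eq_zero_of_notMem (by simp)
      have hl' : (⌊y⌋ : ℝ) + 1 ≤ ⌊z⌋ := by exact_mod_cast hl
      have hzf := Int.floor_le z
      have hyf := Int.lt_floor_add_one y
      have a1 : |Int.fract y - 1| ^ α ≤ |y - z| ^ α := by
        refine Real.rpow_le_rpow (abs_nonneg _) ?_ h0.le
        rw [abs_of_nonpos (by linarith [Int.fract_lt_one y]), abs_of_nonpos (by linarith)]
        unfold Int.fract; linarith
      have a2 : |Int.fract z - 0| ^ α ≤ |y - z| ^ α := by
        refine Real.rpow_le_rpow (abs_nonneg _) ?_ h0.le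
        rw [abs_of_nonneg (by linarith [Int.fract_nonneg z]), abs_of_nonpos (by linarith)]
        unfold Int.fract; linarith
      have b1 := (h (Int.fract y) 1).trans (mul_le_mul_of_nonneg_left a1 hM)
      have b2 := (h (Int.fract z) 0).trans (mul_le_mul_of_nonneg_left a2 hM)
      rw [ho] at b1
      rw [hz] at b2
      have := abs_sub (dens A (Int.fract y) - 0) (dens A (Int.fract z) - 0)
      rw [sub_sub_sub_cancel_right] at this
      linarith
  refine ⟨2 * M, by linarith, fun y z => ?_⟩
  rcases le_total y z with hyz | hyz
  · exact key y z hyz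
  · rw [abs_sub_comm, abs_sub_comm y z]; exact key z y hyz

end

/-- The total increment of the horizontal Cantor function over a kept interval. -/
def riseX (i : ℕ) : ℝ := scale i ^ 2 * (2 - (1 / 4) ^ i)

/-- The total increment of the vertical Cantor function over a kept interval. -/
def riseY (i : ℕ) : ℝ := scale i * scale (i + 1) * (2 - (1 / 4) ^ i / 2)

/-- The increments of the horizontal Cantor function. -/
def incX : ℕ → ℝ
  | 0 => 2
  | i + 1 => riseX i / num i

/-- The increments of the vertical Cantor function. -/
def incY : ℕ → ℝ
  | 0 => 1 / 2
  | i + 1 => riseY i / num i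

/-- The width of the horizontal transition layers (indexed by the parent generation). -/
def slackX (i : ℕ) : ℝ := scale i * scale (i + 1) * (1 / 4) ^ i / 4

/-- The width of the vertical transition layers. -/
def slackY : ℕ → ℝ
  | 0 => 1 / 8
  | i + 1 => scale (i + 1) ^ 2 * (1 / 4) ^ i / 8

lemma num_mul_incX (i : ℕ) : num i * incX (i + 1) = riseX i := by
  have := num_ge i
  rw [incX]; field_simp

lemma num_mul_incY (i : ℕ) : num i * incY (i + 1) = riseY i := by
  have := num_ge i
  rw [incY]; field_simp

lemma quarter_pos (i : ℕ) : (0 : ℝ) < (1 / 4) ^ i := by positivity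
lemma quarter_le (i : ℕ) : ((1 : ℝ) / 4) ^ i ≤ 1 := pow_le_one₀ (by norm_num) (by norm_num)

lemma scale_div_num (i : ℕ) : scale i / num i * (1 - (1 / 4) ^ i / 256) = scale (i + 1) := by
  have h := num_ge i
  have h2 := num_cast i
  rw [ratio_eq] at h2
  have h3 : (0 : ℝ) < rad i := by exact_mod_cast rad_pos i
  have h4 : (1 - (1 / 4 : ℝ) ^ i / 256) ≠ 0 := by have := quarter_le i; linarith
  have h5 : (rad i * (1 - (1 / 4 : ℝ) ^ i / 256)) ≠ 0 := mul_ne_zero h3.ne' h4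
  rw [scale_eq i, h2, div_mul_eq_mul_div, div_eq_iff h5]; ring

lemma incX_succ (i : ℕ) : incX (i + 1) * (1 - (1 / 4) ^ i / 256)
    = scale i * scale (i + 1) * (2 - (1 / 4) ^ i) := by
  rw [incX, riseX, ← scale_div_num i]; ring

lemma incY_succ (i : ℕ) : incY (i + 1) * (1 - (1 / 4) ^ i / 256)
    = scale (i + 1) ^ 2 * (2 - (1 / 4) ^ i / 2) := by
  rw [incY, riseY, sq]; nth_rw 3 [← scale_div_num i]; ring

lemma div_one_sub_le {a p e : ℝ} (hp : 0 ≤ p) (he0 : 0 < e) (he : e ≤ 1) {c : ℝ} (hc0 : 0 ≤ c)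
    (hc : c ≤ 2) (h : a * (1 - e / 256) = p * c) :
    p * c ≤ a ∧ a ≤ p * (c + e / 100) := by
  have h1 : 0 < 1 - e / 256 := by linarith
  have hpc : 0 ≤ p * c := mul_nonneg hp hc0
  have ha : a = p * c / (1 - e / 256) := by rw [← h, mul_div_cancel_right₀ _ h1.ne']
  constructor
  · rw [ha, le_div_iff₀ h1]; nlinarith
  · rw [ha, div_le_iff₀ h1]
    have : c ≤ (c + e / 100) * (1 - e / 256) := by nlinarith
    nlinarith [mul_le_mul_of_nonneg_left this hp]

lemma incX_bounds (i : ℕ) : scale i * scale (i + 1) * (2 - (1 / 4) ^ i) ≤ incX (i + 1) ∧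
    incX (i + 1) ≤ scale i * scale (i + 1) * (2 - (1 / 4) ^ i + (1 / 4) ^ i / 100) :=
  div_one_sub_le (mul_pos (scale_pos i) (scale_pos _)).le (quarter_pos i) (quarter_le i)
    (by linarith [quarter_le i]) (by linarith [quarter_pos i]) (incX_succ i)

lemma incY_bounds (i : ℕ) : scale (i + 1) ^ 2 * (2 - (1 / 4) ^ i / 2) ≤ incY (i + 1) ∧
    incY (i + 1) ≤ scale (i + 1) ^ 2 * (2 - (1 / 4) ^ i / 2 + (1 / 4) ^ i / 100) :=
  div_one_sub_le (pow_pos (scale_pos _) 2).le (quarter_pos i) (quarter_le i)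
    (by linarith [quarter_le i]) (by linarith [quarter_pos i]) (incY_succ i)

lemma scale_succ_le_quarter (i : ℕ) : 256 * scale (i + 1) ≤ scale i * (1 / 4) ^ i := by
  have h := scale_succ_le_pow i
  have h2 : (16 : ℝ) ^ i * (1 / 4) ^ i = 4 ^ i := by rw [← mul_pow]; norm_num
  have h3 : (1 : ℝ) ≤ 4 ^ i := one_le_pow₀ (by norm_num)
  have h4 := mul_le_mul_of_nonneg_right h (quarter_pos i).le
  have h5 : 256 * 16 ^ i * scale (i + 1) * (1 / 4) ^ i = 256 * 4 ^ i * scale (i + 1) := by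
    rw [← h2]; ring
  have h6 := scale_pos (i + 1)
  nlinarith

lemma riseX_pos (i : ℕ) : 0 < riseX i :=
  mul_pos (pow_pos (scale_pos i) 2) (by linarith [quarter_le i])

lemma riseY_pos (i : ℕ) : 0 < riseY i :=
  mul_pos (mul_pos (scale_pos i) (scale_pos _)) (by linarith [quarter_le i])

lemma riseX_le (i : ℕ) : riseX i ≤ 2 * scale i ^ 2 := by
  unfold riseX; have := pow_pos (scale_pos i) 2; nlinarith [quarter_pos i]

lemma riseY_le (i : ℕ) : riseY i ≤ 2 * (scale i * scale (i + 1)) := by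
  unfold riseY; have := mul_pos (scale_pos i) (scale_pos (i + 1)); nlinarith [quarter_pos i]

lemma slackX_pos (i : ℕ) : 0 < slackX i := by
  unfold slackX; have := scale_pos i; have := scale_pos (i + 1); positivity

lemma slackY_pos (i : ℕ) : 0 < slackY i := by
  rcases i with _ | i
  · norm_num [slackY]
  · unfold slackY; have := scale_pos (i + 1); positivity

lemma incX_pos (i : ℕ) : 0 < incX i := by
  rcases i with _ | i
  · norm_num [incX]
  · exact div_pos (riseX_pos i) (by exact_mod_cast num_pos i)

lemma incY_pos (i : ℕ) : 0 < incY i := by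
  rcases i with _ | i
  · norm_num [incY]
  · exact div_pos (riseY_pos i) (by exact_mod_cast num_pos i)

lemma incX_add_slackX (i : ℕ) : incX (i + 1) + slackX i ≤ riseY i - riseX (i + 1) := by
  have h1 := (incX_bounds i).2
  have h2 := riseX_le (i + 1)
  have h3 := scale_succ_le_quarter i
  have h4 := mul_le_mul_of_nonneg_right h3 (scale_pos (i + 1)).le
  have h5 := mul_pos (mul_pos (scale_pos i) (scale_pos (i + 1))) (quarter_pos i)
  unfold slackX riseY
  nlinarith

lemma scale_succ_succ_le (i : ℕ) : 1024 * scale (i + 2) ≤ scale (i + 1) * (1 / 4) ^ i := by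
  have := scale_succ_le_quarter (i + 1)
  rw [pow_succ] at this
  linarith

lemma incY_add_slackY (i : ℕ) : incY i + slackY i ≤ riseX i - riseY i := by
  rcases i with _ | i
  · have h := scale_succ_le 0
    norm_num [incY, slackY, riseX, riseY, scale_zero] at h ⊢
    linarith
  · have h1 := (incY_bounds i).2
    have h2 := riseY_le (i + 1)
    have h3 := scale_succ_succ_le i
    have h4 := mul_le_mul_of_nonneg_left h3 (scale_pos (i + 1)).le
    have h5 := mul_pos (pow_pos (scale_pos (i + 1)) 2) (quarter_pos i)
    unfold slackY
    unfold riseX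
    rw [pow_succ (1 / 4 : ℝ)]
    nlinarith

lemma slackX_le_incX (i : ℕ) : slackX i ≤ incX (i + 1) := by
  have h1 := (incX_bounds i).1
  have h5 := mul_pos (scale_pos i) (scale_pos (i + 1))
  unfold slackX
  nlinarith [quarter_le i, quarter_pos i]

lemma slackY_le_incY (i : ℕ) : slackY i ≤ incY i := by
  rcases i with _ | i
  · norm_num [slackY, incY]
  have h1 := (incY_bounds i).1
  have h5 := pow_pos (scale_pos (i + 1)) 2
  unfold slackY
  nlinarith [quarter_le i, quarter_pos i]

lemma riseX_lt_incX (i : ℕ) : riseX i < incX i := by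
  rcases i with _ | i
  · norm_num [riseX, incX, scale_zero]
  · have h1 := (incX_bounds i).1
    have h2 := riseX_le (i + 1)
    have h3 := scale_succ_le i
    have h4 := scale_pos (i + 1)
    have h5 := scale_pos i
    nlinarith [quarter_le i, quarter_pos i, mul_pos h4 h5]

lemma riseY_lt_incY (i : ℕ) : riseY i < incY i := by
  rcases i with _ | i
  · have h := scale_succ_le 0
    norm_num [riseY, incY, scale_zero] at h ⊢
    linarith
  · have h1 := (incY_bounds i).1
    have h2 := riseY_le (i + 1)
    have h3 := scale_succ_le (i + 1)
    have h4 := scale_pos (i + 1)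
    nlinarith [quarter_le i, quarter_pos i, mul_pos h4 h4]

lemma incr_incX : Incr incX where
  pos := incX_pos
  gap i := by rw [num_mul_incX]; exact riseX_lt_incX i
  le i := by
    rcases i with _ | i
    · norm_num [incX, scale_zero]
    · have h1 := (incX_bounds i).2
      have h5 := mul_pos (scale_pos i) (scale_pos (i + 1))
      rw [Nat.add_sub_cancel]
      nlinarith [quarter_le i, quarter_pos i]

lemma incr_incY : Incr incY where
  pos := incY_pos
  gap i := by rw [num_mul_incY]; exact riseY_lt_incY i
  le i := by
    rcases i with _ | i
    · norm_num [incY, scale_zero]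
    · have h1 := (incY_bounds i).2
      have h3 := scale_succ_le i
      have h4 := scale_pos (i + 1)
      rw [Nat.add_sub_cancel]
      nlinarith [quarter_le i, quarter_pos i, mul_pos h4 h4]

section

/-- A `C¹` approximation of the indicator of `[0,a]`, with transition layers of width `w`. -/
def pulse (w a b : ℝ) : ℝ := step (b / w) - step ((b - a) / w)

/-- The derivative of `pulse w a`. -/
def dpulse (w a b : ℝ) : ℝ := (bump (b / w) - bump ((b - a) / w)) / w

section pulse
variable {w a : ℝ}

lemma hasDerivAt_pulse (w a b : ℝ) : HasDerivAt (pulse w a) (dpulse w a b) b := by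
  have h1 : HasDerivAt (fun b : ℝ => b / w) (1 / w) b := (hasDerivAt_id b).div_const _
  have h2 : HasDerivAt (fun b : ℝ => (b - a) / w) (1 / w) b :=
    ((hasDerivAt_id b).sub_const _).div_const _
  refine (((hasDerivAt_step _).comp b h1).sub ((hasDerivAt_step _).comp b h2)).congr_deriv ?_
  unfold dpulse; ring

@[fun_prop]
lemma continuous_dpulse (w a : ℝ) : Continuous (dpulse w a) := by unfold dpulse; fun_prop

lemma pulse_nonneg (hw : 0 < w) (ha : 0 < a) (b : ℝ) : 0 ≤ pulse w a b :=
  sub_nonneg.2 (step_mono (by gcongr; linarith))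

lemma pulse_le_one (w a b : ℝ) : pulse w a b ≤ 1 := by
  have := step_le_one (b / w); have := step_nonneg ((b - a) / w); unfold pulse; linarith

lemma pulse_of_le (hw : 0 < w) (ha : 0 < a) {b : ℝ} (hb : b ≤ 0) :
    pulse w a b = 0 ∧ dpulse w a b = 0 := by
  have h1 : b / w ≤ 0 := div_nonpos_of_nonpos_of_nonneg hb hw.le
  have h2 : (b - a) / w ≤ 0 := div_nonpos_of_nonpos_of_nonneg (by linarith) hw.le
  simp [pulse, dpulse, step_of_le h1, step_of_le h2, bump_of_le h1, bump_of_le h2]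

lemma pulse_of_ge (hw : 0 < w) (ha : 0 < a) {b : ℝ} (hb : a + w ≤ b) :
    pulse w a b = 0 ∧ dpulse w a b = 0 := by
  have h1 : 1 ≤ b / w := by rw [le_div_iff₀ hw]; linarith
  have h2 : 1 ≤ (b - a) / w := by rw [le_div_iff₀ hw]; linarith
  simp [pulse, dpulse, step_of_ge h1, step_of_ge h2, bump_of_ge h1, bump_of_ge h2]

lemma pulse_supp (hw : 0 < w) (ha : 0 < a) {b : ℝ} (h : pulse w a b ≠ 0 ∨ dpulse w a b ≠ 0) :
    0 < b ∧ b < a + w := by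
  constructor
  · by_contra hb
    have := pulse_of_le hw ha (not_lt.1 hb)
    tauto
  · by_contra hb
    have := pulse_of_ge hw ha (not_lt.1 hb)
    tauto

lemma sum_pulse (w a b : ℝ) (N : ℕ) : ∑ d ∈ Finset.range N, pulse w a (b + d * a)
    = step ((b + (N - 1) * a) / w) - step ((b - a) / w) := by
  induction N with
  | zero => simp; ring_nf
  | succ N ih =>
    rw [Finset.sum_range_succ, ih, pulse]
    push_cast
    rw [show b + (N : ℝ) * a - a = b + (N - 1) * a by ring,
      show b + ((N : ℝ) + 1 - 1) * a = b + N * a by ring]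
    ring

lemma sum_pulse_le_one (w a b : ℝ) (N : ℕ) :
    ∑ d ∈ Finset.range N, pulse w a (b + d * a) ≤ 1 := by
  rw [sum_pulse]
  have := step_le_one ((b + (N - 1) * a) / w); have := step_nonneg ((b - a) / w); linarith

lemma sum_bump_le (hw : 0 < w) (ha : w ≤ a) (b : ℝ) (N : ℕ) :
    ∑ d ∈ Finset.range N, bump ((b + d * a) / w) ≤ 3 / 2 := by
  refine sum_le_of_unique (by norm_num) (fun _ _ => bump_le _) fun i _ j _ hi hj => ?_
  obtain ⟨h1, h2⟩ := bump_ne_zero hi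
  obtain ⟨h3, h4⟩ := bump_ne_zero hj
  rw [lt_div_iff₀ hw] at h1 h3
  rw [div_lt_iff₀ hw] at h2 h4
  exact cell_unique (y := w - b) (hw.trans_le ha) (by linarith) (by nlinarith) (by linarith)
    (by nlinarith)

lemma sum_abs_dpulse_le (hw : 0 < w) (ha : w ≤ a) (b : ℝ) (N : ℕ) :
    ∑ d ∈ Finset.range N, |dpulse w a (b + d * a)| ≤ 3 / w := by
  have h1 := sum_bump_le hw ha b N
  have h2 := sum_bump_le hw ha (b - a) N
  have h3 : ∀ d ∈ Finset.range N, |dpulse w a (b + d * a)|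
      ≤ (bump ((b + d * a) / w) + bump ((b - a + d * a) / w)) / w := by
    intro d _
    rw [dpulse, abs_div, abs_of_pos hw]
    gcongr
    rw [show b + d * a - a = b - a + d * a by ring]
    have := bump_nonneg ((b + d * a) / w)
    have := bump_nonneg ((b - a + d * a) / w)
    rw [abs_le]; constructor <;> linarith
  refine (Finset.sum_le_sum h3).trans ?_
  rw [← Finset.sum_div, Finset.sum_add_distrib]
  gcongr; linarith

end pulse

/-- The weight of the cell `(k, l)` of generation `i`, as a function of the stream function. -/
def weight : ℕ → ℕ → ℕ → ℝ → ℝ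
  | 0, _, _, h => pulse (slackY 0) (incY 0) (-h)
  | i + 1, k, l, h => weight i (k / rad i) (l / rad i) h
      * pulse (slackX i) (incX (i + 1))
        (h - cdf incY ((l / rad i : ℕ) * scale i) + cdf incX (k * scale (i + 1)))
      * pulse (slackY (i + 1)) (incY (i + 1))
        (cdf incY (l * scale (i + 1)) - cdf incX (k * scale (i + 1)) - h)

/-- The derivative of `weight i k l`. -/
def dweight : ℕ → ℕ → ℕ → ℝ → ℝ
  | 0, _, _, h => -dpulse (slackY 0) (incY 0) (-h)
  | i + 1, k, l, h =>
      (dweight i (k / rad i) (l / rad i) h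
      * pulse (slackX i) (incX (i + 1))
        (h - cdf incY ((l / rad i : ℕ) * scale i) + cdf incX (k * scale (i + 1)))
      + weight i (k / rad i) (l / rad i) h
      * dpulse (slackX i) (incX (i + 1))
        (h - cdf incY ((l / rad i : ℕ) * scale i) + cdf incX (k * scale (i + 1))))
      * pulse (slackY (i + 1)) (incY (i + 1))
        (cdf incY (l * scale (i + 1)) - cdf incX (k * scale (i + 1)) - h)
      + weight i (k / rad i) (l / rad i) h
      * pulse (slackX i) (incX (i + 1))
        (h - cdf incY ((l / rad i : ℕ) * scale i) + cdf incX (k * scale (i + 1)))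
      * -dpulse (slackY (i + 1)) (incY (i + 1))
        (cdf incY (l * scale (i + 1)) - cdf incX (k * scale (i + 1)) - h)

lemma hasDerivAt_weight (i : ℕ) : ∀ k l h, HasDerivAt (weight i k l) (dweight i k l h) h := by
  induction i with
  | zero =>
    intro k l h
    have := (hasDerivAt_pulse (slackY 0) (incY 0) (-h)).comp h (hasDerivAt_neg h)
    exact this.congr_deriv (by simp [dweight])
  | succ i ih =>
    intro k l h
    have h1 : HasDerivAt (fun h => h - cdf incY ((l / rad i : ℕ) * scale i)
        + cdf incX (k * scale (i + 1))) 1 h := ((hasDerivAt_id h).sub_const _).add_const _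
    have h2 : HasDerivAt (fun h => cdf incY (l * scale (i + 1)) - cdf incX (k * scale (i + 1)) - h)
        (-1) h := (hasDerivAt_id h).const_sub _
    have := ((ih (k / rad i) (l / rad i) h).mul
      ((hasDerivAt_pulse (slackX i) (incX (i + 1)) _).comp h h1)).mul
      ((hasDerivAt_pulse (slackY (i + 1)) (incY (i + 1)) _).comp h h2)
    exact this.congr_deriv (by simp [dweight])

@[fun_prop]
lemma continuous_weight (i k l : ℕ) : Continuous (weight i k l) :=
  continuous_iff_continuousAt.2 fun h => (hasDerivAt_weight i k l h).continuousAt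

lemma continuous_pulse (w a : ℝ) : Continuous (pulse w a) :=
  continuous_iff_continuousAt.2 fun h => (hasDerivAt_pulse w a h).continuousAt

@[fun_prop]
lemma continuous_dweight (i : ℕ) : ∀ k l, Continuous (dweight i k l) := by
  induction i with
  | zero => intro k l; simp only [dweight]; fun_prop
  | succ i ih =>
    intro k l
    have h1 := ih (k / rad i) (l / rad i)
    have h2 := continuous_pulse (slackX i) (incX (i + 1))
    have h3 := continuous_pulse (slackY (i + 1)) (incY (i + 1))
    simp only [dweight]
    fun_prop

lemma weight_nonneg (i : ℕ) : ∀ k l h, 0 ≤ weight i k l h := by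
  induction i with
  | zero => intro k l h; exact pulse_nonneg (slackY_pos 0) (incY_pos 0) _
  | succ i ih =>
    intro k l h
    exact mul_nonneg (mul_nonneg (ih _ _ _) (pulse_nonneg (slackX_pos i) (incX_pos _) _))
      (pulse_nonneg (slackY_pos _) (incY_pos _) _)

lemma weight_le_one (i : ℕ) : ∀ k l h, weight i k l h ≤ 1 := by
  induction i with
  | zero => intro k l h; exact pulse_le_one _ _ _
  | succ i ih =>
    intro k l h
    exact mul_le_one₀ (mul_le_one₀ (ih _ _ _) (pulse_nonneg (slackX_pos i) (incX_pos _) _)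
      (pulse_le_one _ _ _)) (pulse_nonneg (slackY_pos _) (incY_pos _) _) (pulse_le_one _ _ _)

/-- The stream function relative to the lower left corner of the cell `(k, l)`. -/
def rel (i k l : ℕ) (h : ℝ) : ℝ := h - cdf incY (l * scale i) + cdf incX (k * scale i)

lemma child_div {i k d : ℕ} (hd : d < num i) : (k * rad i + d) / rad i = k := by
  rw [mul_comm, Nat.mul_add_div (rad_pos i), Nat.div_eq_of_lt (hd.trans_le (num_le_rad i)),
    add_zero]

lemma cdf_child {A : ℕ → ℝ} (hA : Incr A) {i k d : ℕ} (hk : k ∈ cells i) (hd : d < num i) :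
    cdf A ((k * rad i + d : ℕ) * scale (i + 1)) = cdf A (k * scale i) + d * A (i + 1) := by
  rw [sub_cell_scale, hA.cdf_sub_node hk hd.le]

section child
variable {i k l d e : ℕ}

lemma weight_child (hk : k ∈ cells i) (hl : l ∈ cells i) (hd : d < num i) (he : e < num i)
    (h : ℝ) : weight (i + 1) (k * rad i + d) (l * rad i + e) h = weight i k l h
      * pulse (slackX i) (incX (i + 1)) (rel i k l h + d * incX (i + 1))
      * pulse (slackY (i + 1)) (incY (i + 1))
        (-(rel i k l h + d * incX (i + 1)) + e * incY (i + 1)) := by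
  rw [weight, child_div hd, child_div he, cdf_child incr_incX hk hd, cdf_child incr_incY hl he]
  unfold rel
  congr 2 <;> ring_nf

lemma dweight_child (hk : k ∈ cells i) (hl : l ∈ cells i) (hd : d < num i) (he : e < num i)
    (h : ℝ) : dweight (i + 1) (k * rad i + d) (l * rad i + e) h = (dweight i k l h
      * pulse (slackX i) (incX (i + 1)) (rel i k l h + d * incX (i + 1))
      + weight i k l h * dpulse (slackX i) (incX (i + 1)) (rel i k l h + d * incX (i + 1)))
      * pulse (slackY (i + 1)) (incY (i + 1))
        (-(rel i k l h + d * incX (i + 1)) + e * incY (i + 1))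
      + weight i k l h * pulse (slackX i) (incX (i + 1)) (rel i k l h + d * incX (i + 1))
      * -dpulse (slackY (i + 1)) (incY (i + 1))
        (-(rel i k l h + d * incX (i + 1)) + e * incY (i + 1)) := by
  rw [dweight, child_div hd, child_div he, cdf_child incr_incX hk hd, cdf_child incr_incY hl he]
  have e1 : h - cdf incY (l * scale i) + (cdf incX (k * scale i) + d * incX (i + 1))
      = rel i k l h + d * incX (i + 1) := by unfold rel; ring
  have e2 : cdf incY (l * scale i) + e * incY (i + 1) -
      (cdf incX (k * scale i) + d * incX (i + 1)) - h
      = -(rel i k l h + d * incX (i + 1)) + e * incY (i + 1) := by unfold rel; ring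
  rw [e1, e2]

end child

lemma weight_supp {i k l : ℕ} (hk : k ∈ cells i) (hl : l ∈ cells i) {h : ℝ}
    (hne : weight i k l h ≠ 0 ∨ dweight i k l h ≠ 0) :
    riseY i - riseX i < rel i k l h ∧ rel i k l h < 0 := by
  have hs := incY_add_slackY i
  rcases i with _ | i
  · have hk0 : k = 0 := by simpa [cells] using hk
    have hl0 : l = 0 := by simpa [cells] using hl
    subst hk0; subst hl0
    have := pulse_supp (slackY_pos 0) (incY_pos 0) (b := -h) (by
      rcases hne with h1 | h1
      · exact Or.inl h1
      · exact Or.inr (by simpa [dweight] using h1))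
    simp only [rel, Nat.cast_zero, zero_mul, cdf_zero]
    constructor <;> linarith [this.1, this.2]
  · have hne' : pulse (slackY (i + 1)) (incY (i + 1))
        (cdf incY (l * scale (i + 1)) - cdf incX (k * scale (i + 1)) - h) ≠ 0 ∨
        dpulse (slackY (i + 1)) (incY (i + 1))
        (cdf incY (l * scale (i + 1)) - cdf incX (k * scale (i + 1)) - h) ≠ 0 := by
      by_contra hc
      push Not at hc
      rw [weight, dweight, hc.1, hc.2] at hne
      simp at hne
    have := pulse_supp (slackY_pos _) (incY_pos _) hne'
    unfold rel
    constructor <;> linarith [this.1, this.2]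

lemma sum_weight_child {i k l : ℕ} (hk : k ∈ cells i) (hl : l ∈ cells i) (h : ℝ) :
    ∑ d ∈ Finset.range (num i), ∑ e ∈ Finset.range (num i),
      weight (i + 1) (k * rad i + d) (l * rad i + e) h = weight i k l h := by
  have hwx := slackX_pos i
  have hwy := slackY_pos (i + 1)
  have hax := incX_pos (i + 1)
  have hay := incY_pos (i + 1)
  have hnx := num_mul_incX i
  have hny := num_mul_incY i
  have hsx := incX_add_slackX i
  have hsy := incY_add_slackY (i + 1)
  have hrx := riseX_pos (i + 1)
  have hry := riseY_pos (i + 1)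
  rw [Finset.sum_congr rfl fun d hd => Finset.sum_congr rfl fun e he =>
    weight_child hk hl (Finset.mem_range.1 hd) (Finset.mem_range.1 he) h]
  by_cases h0 : weight i k l h = 0
  · simp [h0]
  obtain ⟨hr1, hr2⟩ := weight_supp hk hl (Or.inl h0)
  have hin : ∀ d : ℕ, ∑ e ∈ Finset.range (num i), weight i k l h
      * pulse (slackX i) (incX (i + 1)) (rel i k l h + d * incX (i + 1))
      * pulse (slackY (i + 1)) (incY (i + 1))
        (-(rel i k l h + d * incX (i + 1)) + e * incY (i + 1))
      = weight i k l h * pulse (slackX i) (incX (i + 1)) (rel i k l h + d * incX (i + 1)) := by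
    intro d
    rw [← Finset.mul_sum]
    by_cases hp : pulse (slackX i) (incX (i + 1)) (rel i k l h + d * incX (i + 1)) = 0
    · simp [hp]
    obtain ⟨hp1, hp2⟩ := pulse_supp hwx hax (Or.inl hp)
    rw [sum_pulse, step_of_ge, step_of_le]
    · ring
    · exact div_nonpos_of_nonpos_of_nonneg (by linarith) hwy.le
    · rw [le_div_iff₀ hwy]; linarith
  rw [Finset.sum_congr rfl fun d _ => hin d, ← Finset.mul_sum, sum_pulse, step_of_ge, step_of_le]
  · ring
  · exact div_nonpos_of_nonpos_of_nonneg (by linarith) hwx.le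
  · rw [le_div_iff₀ hwx]; linarith

lemma sum_dweight_child {i k l : ℕ} (hk : k ∈ cells i) (hl : l ∈ cells i) (h : ℝ) :
    ∑ d ∈ Finset.range (num i), ∑ e ∈ Finset.range (num i),
      dweight (i + 1) (k * rad i + d) (l * rad i + e) h = dweight i k l h := by
  have h1 : HasDerivAt (fun h => ∑ d ∈ Finset.range (num i), ∑ e ∈ Finset.range (num i),
      weight (i + 1) (k * rad i + d) (l * rad i + e) h) (∑ d ∈ Finset.range (num i),
      ∑ e ∈ Finset.range (num i), dweight (i + 1) (k * rad i + d) (l * rad i + e) h) h :=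
    HasDerivAt.fun_sum fun d _ => HasDerivAt.fun_sum fun e _ => hasDerivAt_weight _ _ _ _
  have h2 : (fun h => ∑ d ∈ Finset.range (num i), ∑ e ∈ Finset.range (num i),
      weight (i + 1) (k * rad i + d) (l * rad i + e) h) = weight i k l :=
    funext fun h => sum_weight_child hk hl h
  rw [h2] at h1
  exact h1.unique (hasDerivAt_weight i k l h)

lemma sum_cells_prod_succ (i : ℕ) (φ : ℕ → ℕ → ℝ) :
    ∑ k ∈ cells (i + 1), ∑ l ∈ cells (i + 1), φ k l = ∑ k ∈ cells i, ∑ l ∈ cells i,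
      ∑ d ∈ Finset.range (num i), ∑ e ∈ Finset.range (num i),
        φ (k * rad i + d) (l * rad i + e) := by
  rw [sum_cells_succ]
  refine Finset.sum_congr rfl fun k _ => ?_
  exact (Finset.sum_congr rfl fun d _ => sum_cells_succ _ _).trans Finset.sum_comm

lemma sum_weight (i : ℕ) (h : ℝ) :
    ∑ k ∈ cells i, ∑ l ∈ cells i, weight i k l h = weight 0 0 0 h := by
  induction i with
  | zero => simp [cells]
  | succ i ih =>
    exact (sum_cells_prod_succ i fun k l => weight (i + 1) k l h).trans
      ((Finset.sum_congr rfl fun k hk => Finset.sum_congr rfl fun l hl =>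
        sum_weight_child hk hl h).trans ih)

lemma sum_abs_dweight_child {i k l : ℕ} (hk : k ∈ cells i) (hl : l ∈ cells i) (h : ℝ) :
    ∑ d ∈ Finset.range (num i), ∑ e ∈ Finset.range (num i),
      |dweight (i + 1) (k * rad i + d) (l * rad i + e) h|
      ≤ |dweight i k l h| + 3 / slackX i + 3 / slackY (i + 1) := by
  have hwx := slackX_pos i
  have hwy := slackY_pos (i + 1)
  have hax := incX_pos (i + 1)
  have hay := incY_pos (i + 1)
  set D := |dweight i k l h|
  have hD : 0 ≤ D := abs_nonneg _
  set r := rel i k l h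
  have hin : ∀ d ∈ Finset.range (num i), ∑ e ∈ Finset.range (num i),
      |dweight (i + 1) (k * rad i + d) (l * rad i + e) h|
      ≤ (D + 3 / slackY (i + 1)) * pulse (slackX i) (incX (i + 1)) (r + d * incX (i + 1))
        + |dpulse (slackX i) (incX (i + 1)) (r + d * incX (i + 1))| := by
    intro d hd
    set P := pulse (slackX i) (incX (i + 1)) (r + d * incX (i + 1)) with hP
    set P' := dpulse (slackX i) (incX (i + 1)) (r + d * incX (i + 1)) with hP'
    have hP0 : 0 ≤ P := pulse_nonneg hwx hax _
    have h1 : ∀ e ∈ Finset.range (num i),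
        |dweight (i + 1) (k * rad i + d) (l * rad i + e) h|
        ≤ (D * P + |P'|) * pulse (slackY (i + 1)) (incY (i + 1))
          (-(r + d * incX (i + 1)) + e * incY (i + 1))
          + P * |dpulse (slackY (i + 1)) (incY (i + 1))
          (-(r + d * incX (i + 1)) + e * incY (i + 1))| := by
      intro e he
      rw [dweight_child hk hl (Finset.mem_range.1 hd) (Finset.mem_range.1 he)]
      have hQ0 := pulse_nonneg hwy hay (-(r + d * incX (i + 1)) + e * incY (i + 1))
      have hp0 := weight_nonneg i k l h
      have hp1 := weight_le_one i k l h
      refine (abs_add_le _ _).trans (add_le_add ?_ ?_)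
      · rw [abs_mul, abs_of_nonneg hQ0]
        refine mul_le_mul_of_nonneg_right ((abs_add_le _ _).trans (add_le_add ?_ ?_)) hQ0
        · rw [abs_mul, abs_of_nonneg hP0]
        · rw [abs_mul, abs_of_nonneg hp0]
          exact mul_le_of_le_one_left (abs_nonneg _) hp1
      · rw [abs_mul, abs_mul, abs_neg, abs_of_nonneg hp0, abs_of_nonneg hP0]
        exact mul_le_mul_of_nonneg_right (mul_le_of_le_one_left hP0 hp1) (abs_nonneg _)
    refine (Finset.sum_le_sum h1).trans ?_
    rw [Finset.sum_add_distrib, ← Finset.mul_sum, ← Finset.mul_sum]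
    have h2 := sum_pulse_le_one (slackY (i + 1)) (incY (i + 1)) (-(r + d * incX (i + 1))) (num i)
    have h3 := sum_abs_dpulse_le hwy (slackY_le_incY (i + 1)) (-(r + d * incX (i + 1))) (num i)
    have h4 := mul_le_mul_of_nonneg_left h2
      (add_nonneg (mul_nonneg hD hP0) (abs_nonneg P'))
    have h5 := mul_le_mul_of_nonneg_left h3 hP0
    linarith
  refine (Finset.sum_le_sum hin).trans ?_
  rw [Finset.sum_add_distrib, ← Finset.mul_sum]
  have h2 := sum_pulse_le_one (slackX i) (incX (i + 1)) r (num i)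
  have h3 := sum_abs_dpulse_le hwx (slackX_le_incX i) r (num i)
  have h4 := mul_le_mul_of_nonneg_left h2 (by positivity : 0 ≤ D + 3 / slackY (i + 1))
  linarith

lemma weight_lip_step (i : ℕ) : 100 * 4 ^ i / scale i ^ 2 + 3 / slackX i + 3 / slackY (i + 1)
    ≤ 100 * 4 ^ (i + 1) / scale (i + 1) ^ 2 := by
  have ht := scale_pos i
  have ht' := scale_pos (i + 1)
  have h1 := scale_succ_le i
  have h4 : (0 : ℝ) < 4 ^ i := by positivity
  have e1 : 3 / slackX i = 12 * 4 ^ i / (scale i * scale (i + 1)) := by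
    unfold slackX; rw [one_div_pow]; field_simp; norm_num
  have e2 : 3 / slackY (i + 1) = 24 * 4 ^ i / scale (i + 1) ^ 2 := by
    rw [slackY, one_div_pow]; field_simp; norm_num
  have h5 : 100 * 4 ^ i / scale i ^ 2 ≤ 100 * 4 ^ i / scale (i + 1) ^ 2 := by
    gcongr; linarith
  have h6 : 12 * 4 ^ i / (scale i * scale (i + 1)) ≤ 12 * 4 ^ i / scale (i + 1) ^ 2 := by
    gcongr; rw [sq]; gcongr; linarith
  rw [e1, e2, pow_succ (4 : ℝ) i]
  have h7 : 100 * (4 ^ i * 4) / scale (i + 1) ^ 2 = 100 * 4 ^ i / scale (i + 1) ^ 2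
      + 12 * 4 ^ i / scale (i + 1) ^ 2 + 24 * 4 ^ i / scale (i + 1) ^ 2
      + 264 * 4 ^ i / scale (i + 1) ^ 2 := by ring
  have h8 : 0 ≤ 264 * 4 ^ i / scale (i + 1) ^ 2 := by positivity
  linarith

lemma abs_dweight_le (i : ℕ) : ∀ k ∈ cells i, ∀ l ∈ cells i, ∀ h,
    |dweight i k l h| ≤ 100 * 4 ^ i / scale i ^ 2 := by
  induction i with
  | zero =>
    intro k _ l _ h
    have := sum_abs_dpulse_le (slackY_pos 0) (slackY_le_incY 0) (-h) 1
    simp only [Finset.range_one, Finset.sum_singleton, Nat.cast_zero, zero_mul, add_zero] at this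
    norm_num [dweight, scale_zero, slackY] at this ⊢
    linarith
  | succ i ih =>
    intro k hk l hl h
    obtain ⟨k', hk', d, hd, rfl⟩ := mem_cells_succ.1 hk
    obtain ⟨l', hl', e, he, rfl⟩ := mem_cells_succ.1 hl
    have h1 := sum_abs_dweight_child hk' hl' h
    have h2 := Finset.single_le_sum (f := fun d => ∑ e ∈ Finset.range (num i),
      |dweight (i + 1) (k' * rad i + d) (l' * rad i + e) h|)
      (fun _ _ => Finset.sum_nonneg fun _ _ => abs_nonneg _) (Finset.mem_range.2 hd)
    have h3 := Finset.single_le_sum (f := fun e =>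
      |dweight (i + 1) (k' * rad i + d) (l' * rad i + e) h|)
      (fun _ _ => abs_nonneg _) (Finset.mem_range.2 he)
    have h4 := ih k' hk' l' hl' h
    have h5 := weight_lip_step i
    linarith

end

/-- A smooth step in the `l`-th cell of generation `i`. -/
def cellStep (i l : ℕ) (y : ℝ) : ℝ := step (2 * (y / scale i - l) - 1 / 2)

/-- The derivative of `cellStep i l`. -/
def dcellStep (i l : ℕ) (y : ℝ) : ℝ := bump (2 * (y / scale i - l) - 1 / 2) * (2 / scale i)

lemma hasDerivAt_cellStep (i l : ℕ) (y : ℝ) : HasDerivAt (cellStep i l) (dcellStep i l y) y := by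
  have h : HasDerivAt (fun y : ℝ => 2 * (y / scale i - l) - 1 / 2) (2 / scale i) y := by
    refine (((((hasDerivAt_id y).div_const _).sub_const _).const_mul 2).sub_const _).congr_deriv ?_
    ring
  exact (hasDerivAt_step _).comp y h

lemma cellStep_nonneg (i l : ℕ) (y : ℝ) : 0 ≤ cellStep i l y := step_nonneg _

lemma cellStep_le_one (i l : ℕ) (y : ℝ) : cellStep i l y ≤ 1 := step_le_one _

lemma cellStep_of_le {i l : ℕ} {y : ℝ} (h : y ≤ l * scale i) : cellStep i l y = 0 := by
  have : y / scale i ≤ l := (div_le_iff₀ (scale_pos i)).2 h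
  exact step_of_le (by linarith)

lemma three_quarters_le_len (i : ℕ) : 3 / 4 * scale i ≤ len i := by
  have := ratio_le i
  have := scale_pos i
  unfold len
  nlinarith

lemma cellStep_of_ge {i l : ℕ} {y : ℝ} (h : l * scale i + len i ≤ y) : cellStep i l y = 1 := by
  have : l + 3 / 4 ≤ y / scale i :=
    (le_div_iff₀ (scale_pos i)).2 (by have := three_quarters_le_len i; linarith)
  exact step_of_ge (by linarith)

lemma dcellStep_nonneg (i l : ℕ) (y : ℝ) : 0 ≤ dcellStep i l y :=
  mul_nonneg (bump_nonneg _) (by have := scale_pos i; positivity)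

lemma dcellStep_le (i l : ℕ) (y : ℝ) : dcellStep i l y ≤ 3 / scale i := by
  have := scale_pos i
  calc dcellStep i l y ≤ 3 / 2 * (2 / scale i) := by unfold dcellStep; gcongr; exact bump_le _
    _ = 3 / scale i := by ring

lemma dcellStep_ne_zero {i l : ℕ} {y : ℝ} (h : dcellStep i l y ≠ 0) :
    l * scale i < y ∧ y < l * scale i + len i := by
  obtain ⟨h1, h2⟩ := bump_ne_zero (left_ne_zero_of_mul h)
  have h3 : (l : ℝ) < y / scale i := by linarith
  have h4 : y / scale i < l + 3 / 4 := by linarith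
  rw [lt_div_iff₀ (scale_pos i)] at h3
  rw [div_lt_iff₀ (scale_pos i)] at h4
  have := three_quarters_le_len i
  exact ⟨h3, by linarith⟩

/-- The stream function with velocity `(dens incY y, dens incX x)`. -/
def stream (x y : ℝ) : ℝ := cdf incY y - cdf incX x

@[fun_prop]
lemma continuous_cdf_incX : Continuous (cdf incX) := incr_incX.contDiff_cdf.continuous

@[fun_prop]
lemma continuous_cdf_incY : Continuous (cdf incY) := incr_incY.contDiff_cdf.continuous

@[fun_prop]
lemma continuous_dens_incX : Continuous (dens incX) := incr_incX.continuous_dens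

@[fun_prop]
lemma continuous_dens_incY : Continuous (dens incY) := incr_incY.continuous_dens

lemma rel_stream (i k l : ℕ) (x y : ℝ) : rel i k l (stream x y)
    = (cdf incY y - cdf incY (l * scale i)) - (cdf incX x - cdf incX (k * scale i)) := by
  unfold rel stream; ring

lemma lt_of_cdf_lt {A : ℕ → ℝ} (hA : Incr A) {y z : ℝ} (h : cdf A y < cdf A z) : y < z :=
  hA.monotone_cdf.reflect_lt h

/-- A nonzero weight at a point to the left of the cell only occurs below the cell. -/
lemma lt_of_weight_left {i k l : ℕ} (hk : k ∈ cells i) (hl : l ∈ cells i) {x y : ℝ}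
    (hx : x ≤ k * scale i) (hne : weight i k l (stream x y) ≠ 0 ∨ dweight i k l (stream x y) ≠ 0) :
    y < l * scale i := by
  have h := (weight_supp hk hl hne).2
  rw [rel_stream] at h
  have := incr_incX.monotone_cdf hx
  exact lt_of_cdf_lt incr_incY (by linarith)

/-- A nonzero weight at a point where the horizontal cell has been crossed only occurs above
the cell. -/
lemma lt_of_weight_right {i k l : ℕ} (hk : k ∈ cells i) (hl : l ∈ cells i) {x y : ℝ}
    (hx : cdf incX (k * scale i) + riseX i ≤ cdf incX x)
    (hne : weight i k l (stream x y) ≠ 0 ∨ dweight i k l (stream x y) ≠ 0) :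
    l * scale i + len i < y := by
  have h := (weight_supp hk hl hne).1
  rw [rel_stream] at h
  refine lt_of_cdf_lt incr_incY ?_
  rw [incr_incY.cdf_len hl, num_mul_incY]
  linarith

lemma cdf_incX_ge {i k : ℕ} (hk : k ∈ cells i) {x : ℝ} (hx : k * scale i + len i ≤ x) :
    cdf incX (k * scale i) + riseX i ≤ cdf incX x := by
  have := incr_incX.monotone_cdf hx
  rwa [incr_incX.cdf_len hk, num_mul_incX] at this

/-- The contribution of the cell `(k,l)` of generation `i` to the change of generation. -/
def refinement (i k l : ℕ) (x y : ℝ) : ℝ :=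
  ∑ d ∈ Finset.range (num i), ∑ e ∈ Finset.range (num i),
    dweight (i + 1) (k * rad i + d) (l * rad i + e) (stream x y)
      * cellStep (i + 1) (l * rad i + e) y
  - dweight i k l (stream x y) * cellStep i l y

lemma refinement_ne_zero {i k l : ℕ} (hk : k ∈ cells i) (hl : l ∈ cells i) {x y : ℝ}
    (hne : refinement i k l x y ≠ 0) :
    (k * scale i < x ∧ x < k * scale i + len i) ∧ (l * scale i < y ∧ y < l * scale i + len i) := by
  have ht := scale_pos (i + 1)
  have hc : ∀ {k d}, k ∈ cells i → d ∈ Finset.range (num i) → k * rad i + d ∈ cells (i + 1) :=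
    fun {k d} hk hd => mem_cells_succ.2 ⟨k, hk, d, Finset.mem_range.1 hd, rfl⟩
  have full : (∀ d ∈ Finset.range (num i), ∀ e ∈ Finset.range (num i),
      dweight (i + 1) (k * rad i + d) (l * rad i + e) (stream x y)
      * cellStep (i + 1) (l * rad i + e) y
      = dweight (i + 1) (k * rad i + d) (l * rad i + e) (stream x y)) →
      refinement i k l x y = dweight i k l (stream x y) - dweight i k l (stream x y)
        * cellStep i l y := fun h => by
    rw [refinement, Finset.sum_congr rfl fun d hd => Finset.sum_congr rfl fun e he => h d hd e he,
      sum_dweight_child hk hl]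
  have none : (∀ d ∈ Finset.range (num i), ∀ e ∈ Finset.range (num i),
      dweight (i + 1) (k * rad i + d) (l * rad i + e) (stream x y)
      * cellStep (i + 1) (l * rad i + e) y = 0) → dweight i k l (stream x y)
        * cellStep i l y = 0 → refinement i k l x y = 0 := fun h h' => by
    rw [refinement, Finset.sum_congr rfl fun d hd => Finset.sum_congr rfl fun e he => h d hd e he,
      h']
    simp
  have hy1 : l * scale i < y := by
    by_contra! hy
    refine hne (none (fun d _ e _ => ?_) (by rw [cellStep_of_le hy, mul_zero]))
    rw [cellStep_of_le, mul_zero]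
    rw [sub_cell_scale]
    have : 0 ≤ (e : ℝ) * scale (i + 1) := by positivity
    linarith
  have hy2 : y < l * scale i + len i := by
    by_contra! hy
    refine hne ((full fun d _ e he => ?_).trans (by rw [cellStep_of_ge hy, mul_one, sub_self]))
    rw [cellStep_of_ge, mul_one]
    rw [sub_cell_scale]
    have h1 := len_le_scale (i + 1)
    have h2 : ((e : ℝ) + 1) * scale (i + 1) ≤ len i := by
      rw [len_eq]
      gcongr
      exact_mod_cast Finset.mem_range.1 he
    linarith
  refine ⟨⟨?_, ?_⟩, hy1, hy2⟩
  · by_contra! hx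
    refine hne (none (fun d hd e he => ?_) ?_)
    · by_contra h
      have := lt_of_weight_left (hc hk hd) (hc hl he) (x := x) (y := y) (hx.trans (by
        rw [sub_cell_scale]
        have : 0 ≤ (d : ℝ) * scale (i + 1) := by positivity
        linarith)) (.inr (left_ne_zero_of_mul h))
      exact right_ne_zero_of_mul h (cellStep_of_le this.le)
    · by_contra h
      exact (lt_of_weight_left hk hl hx (.inr (left_ne_zero_of_mul h))).not_gt hy1
  · by_contra! hx
    have hG := cdf_incX_ge hk hx
    have h0 : dweight i k l (stream x y) = 0 := by
      by_contra h
      exact (lt_of_weight_right hk hl hG (.inr h)).not_gt hy2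
    refine hne ((full fun d hd e he => ?_).trans (by rw [h0]; ring))
    by_cases h : dweight (i + 1) (k * rad i + d) (l * rad i + e) (stream x y) = 0
    · rw [h, zero_mul]
    · have := lt_of_weight_right (hc hk hd) (hc hl he) (x := x) (y := y) (by
        rw [cdf_child incr_incX hk (Finset.mem_range.1 hd)]
        have h1 := riseX_lt_incX (i + 1)
        have h2 : ((d : ℝ) + 1) * incX (i + 1) ≤ riseX i := by
          rw [← num_mul_incX]
          have := (incX_pos (i + 1)).le
          gcongr
          exact_mod_cast Finset.mem_range.1 hd
        linarith) (.inr h)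
      rw [cellStep_of_ge this.le, mul_one]

lemma abs_refinement_le {i k l : ℕ} (hk : k ∈ cells i) (hl : l ∈ cells i) (x y : ℝ) :
    |refinement i k l x y| ≤ 200 * 4 ^ (i + 1) / scale (i + 1) ^ 2 := by
  have hle : ∀ (a : ℝ) (j p : ℕ), |a * cellStep j p y| ≤ |a| := fun a j p => by
    rw [abs_mul, abs_of_nonneg (cellStep_nonneg j p y)]
    exact mul_le_of_le_one_right (abs_nonneg a) (cellStep_le_one j p y)
  have h1 : |∑ d ∈ Finset.range (num i), ∑ e ∈ Finset.range (num i),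
      dweight (i + 1) (k * rad i + d) (l * rad i + e) (stream x y)
      * cellStep (i + 1) (l * rad i + e) y| ≤ ∑ d ∈ Finset.range (num i),
      ∑ e ∈ Finset.range (num i),
        |dweight (i + 1) (k * rad i + d) (l * rad i + e) (stream x y)| :=
    (Finset.abs_sum_le_sum_abs _ _).trans (Finset.sum_le_sum fun d _ =>
      (Finset.abs_sum_le_sum_abs _ _).trans (Finset.sum_le_sum fun e _ => hle _ _ _))
  have h2 := sum_abs_dweight_child hk hl (stream x y)
  have h3 := hle (dweight i k l (stream x y)) i l
  have h4 := abs_dweight_le i k hk l hl (stream x y)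
  have h5 := weight_lip_step i
  have h6 := abs_sub (∑ d ∈ Finset.range (num i), ∑ e ∈ Finset.range (num i),
      dweight (i + 1) (k * rad i + d) (l * rad i + e) (stream x y)
      * cellStep (i + 1) (l * rad i + e) y) (dweight i k l (stream x y) * cellStep i l y)
  have h7 : 0 ≤ 3 / slackX i := by have := slackX_pos i; positivity
  have h8 : 0 ≤ 3 / slackY (i + 1) := by have := slackY_pos (i + 1); positivity
  have h9 : 200 * 4 ^ (i + 1) / scale (i + 1) ^ 2
      = 100 * 4 ^ (i + 1) / scale (i + 1) ^ 2 + 100 * 4 ^ (i + 1) / scale (i + 1) ^ 2 := by ring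
  unfold refinement
  linarith

/-- An approximate crossing time, as a function of the value `h` of the stream function. -/
def crossing (m : ℕ) (h y : ℝ) : ℝ :=
  step ((-h - incY 0) / slackY 0) + ∑ k ∈ cells m, ∑ l ∈ cells m, weight m k l h * cellStep m l y

/-- The derivative of `crossing m h y` in `h`. -/
def dcrossing (m : ℕ) (h y : ℝ) : ℝ :=
  -(bump ((-h - incY 0) / slackY 0) / slackY 0)
    + ∑ k ∈ cells m, ∑ l ∈ cells m, dweight m k l h * cellStep m l y

/-- The derivative of `crossing m h y` in `y`. -/
def source (m : ℕ) (h y : ℝ) : ℝ :=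
  ∑ k ∈ cells m, ∑ l ∈ cells m, weight m k l h * dcellStep m l y

@[fun_prop]
lemma continuous_cellStep (i l : ℕ) : Continuous (cellStep i l) :=
  continuous_iff_continuousAt.2 fun y => (hasDerivAt_cellStep i l y).continuousAt

@[fun_prop]
lemma continuous_dcellStep (i l : ℕ) : Continuous (dcellStep i l) := by
  have := continuous_bump
  unfold dcellStep
  fun_prop

lemma continuous_dcrossing (m : ℕ) :
    Continuous fun p : ℝ × ℝ => dcrossing m (stream p.1 p.2) p.2 := by
  have := continuous_bump
  have := continuous_dweight m
  unfold dcrossing stream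
  fun_prop

lemma continuous_source (m : ℕ) :
    Continuous fun p : ℝ × ℝ => source m (stream p.1 p.2) p.2 := by
  have := continuous_weight m
  unfold source stream
  fun_prop

lemma hasDerivAt_base (h : ℝ) : HasDerivAt (fun h => step ((-h - incY 0) / slackY 0))
    (-(bump ((-h - incY 0) / slackY 0) / slackY 0)) h := by
  have h1 : HasDerivAt (fun h : ℝ => (-h - incY 0) / slackY 0) (-1 / slackY 0) h :=
    ((hasDerivAt_neg h).sub_const _).div_const _
  exact ((hasDerivAt_step _).comp h h1).congr_deriv (by ring)

lemma hasDerivAt_stream_left (x y : ℝ) : HasDerivAt (fun x => stream x y) (-dens incX x) x :=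
  ((incr_incX.hasDerivAt_cdf x).const_sub _)

lemma hasDerivAt_stream_right (x y : ℝ) : HasDerivAt (fun y => stream x y) (dens incY y) y :=
  ((incr_incY.hasDerivAt_cdf y).sub_const _)

lemma hasDerivAt_crossing_left (m : ℕ) (x y : ℝ) :
    HasDerivAt (fun x => crossing m (stream x y) y)
      (dcrossing m (stream x y) y * -dens incX x) x := by
  have h : HasDerivAt (fun h => crossing m h y) (dcrossing m (stream x y) y) (stream x y) :=
    (hasDerivAt_base _).add (HasDerivAt.fun_sum fun k _ => HasDerivAt.fun_sum fun l _ =>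
      (hasDerivAt_weight m k l _).mul_const _)
  exact h.comp x (hasDerivAt_stream_left x y)

lemma hasDerivAt_crossing_right (m : ℕ) (x y : ℝ) :
    HasDerivAt (fun y => crossing m (stream x y) y)
      (dcrossing m (stream x y) y * dens incY y + source m (stream x y) y) y := by
  have hs := hasDerivAt_stream_right x y
  have h : HasDerivAt (fun y => crossing m (stream x y) y) _ y :=
    ((hasDerivAt_base (stream x y)).comp y hs).add (HasDerivAt.fun_sum fun k _ =>
      HasDerivAt.fun_sum fun l _ => ((hasDerivAt_weight m k l (stream x y)).comp y hs).mul
        (hasDerivAt_cellStep m l y))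
  refine h.congr_deriv ?_
  unfold dcrossing source
  simp only [Function.comp, Finset.sum_add_distrib, add_mul, Finset.sum_mul]
  rw [add_assoc]
  congr 2
  exact Finset.sum_congr rfl fun k _ => Finset.sum_congr rfl fun l _ => by ring

lemma sum_weight_mul_nonneg (m : ℕ) (h : ℝ) {φ : ℕ → ℝ} (h0 : ∀ l, 0 ≤ φ l) :
    0 ≤ ∑ k ∈ cells m, ∑ l ∈ cells m, weight m k l h * φ l :=
  Finset.sum_nonneg fun k _ => Finset.sum_nonneg fun l _ =>
    mul_nonneg (weight_nonneg m k l h) (h0 l)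

lemma sum_weight_mul_le (m : ℕ) (h : ℝ) {φ : ℕ → ℝ} {M : ℝ} (hM : ∀ l, φ l ≤ M) :
    ∑ k ∈ cells m, ∑ l ∈ cells m, weight m k l h * φ l ≤ weight 0 0 0 h * M := by
  rw [← sum_weight m h, Finset.sum_mul]
  refine Finset.sum_le_sum fun k _ => ?_
  rw [Finset.sum_mul]
  exact Finset.sum_le_sum fun l _ => mul_le_mul_of_nonneg_left (hM l) (weight_nonneg m k l h)

lemma crossing_nonneg (m : ℕ) (h y : ℝ) : 0 ≤ crossing m h y :=
  add_nonneg (step_nonneg _) (sum_weight_mul_nonneg m h fun l => cellStep_nonneg m l y)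

lemma crossing_le (m : ℕ) (h y : ℝ) : crossing m h y ≤ 2 := by
  have h1 := sum_weight_mul_le m h fun l => cellStep_le_one m l y
  have h2 := weight_le_one 0 0 0 h
  have h3 := step_le_one ((-h - incY 0) / slackY 0)
  unfold crossing
  linarith

lemma crossing_eq_of_weight (m : ℕ) {h : ℝ} (y : ℝ) (h0 : weight 0 0 0 h = 0) :
    crossing m h y = step ((-h - incY 0) / slackY 0) := by
  have h1 := sum_weight_mul_le m h fun l => cellStep_le_one m l y
  have h2 := sum_weight_mul_nonneg m h fun l => cellStep_nonneg m l y
  rw [h0, zero_mul] at h1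
  rw [crossing, le_antisymm h1 h2, add_zero]

lemma cdf_incX_zero : cdf incX 0 = 0 := cdf_zero
lemma cdf_incX_one : cdf incX 1 = 2 := incr_incX.cdf_one
lemma cdf_incY_one : cdf incY 1 = 1 / 2 := incr_incY.cdf_one

lemma cdf_incY_mem {y : ℝ} (hy : y ∈ Set.Icc (0 : ℝ) 1) :
    0 ≤ cdf incY y ∧ cdf incY y ≤ 1 / 2 := by
  have h1 := incr_incY.monotone_cdf hy.1
  have h2 := incr_incY.monotone_cdf hy.2
  rw [cdf_zero] at h1
  rw [cdf_incY_one] at h2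
  exact ⟨h1, h2⟩

lemma crossing_left (m : ℕ) {y : ℝ} (hy : y ∈ Set.Icc (0 : ℝ) 1) :
    crossing m (stream 0 y) y = 0 := by
  have h := (cdf_incY_mem hy).1
  have hs : -stream 0 y ≤ 0 := by rw [stream, cdf_incX_zero]; linarith
  rw [crossing_eq_of_weight m y (pulse_of_le (slackY_pos 0) (incY_pos 0) hs).1]
  refine step_of_le (div_nonpos_of_nonpos_of_nonneg ?_ (slackY_pos 0).le)
  have := incY_pos 0
  linarith

lemma crossing_right (m : ℕ) {y : ℝ} (hy : y ∈ Set.Icc (0 : ℝ) 1) :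
    crossing m (stream 1 y) y = 1 := by
  have h := (cdf_incY_mem hy).2
  have hs : incY 0 + slackY 0 ≤ -stream 1 y := by
    rw [stream, cdf_incX_one, incY, slackY]; linarith
  rw [crossing_eq_of_weight m y (pulse_of_ge (slackY_pos 0) (incY_pos 0) hs).1]
  exact step_of_ge ((one_le_div (slackY_pos 0)).2 (by linarith))

lemma crossing_bottom_top (m : ℕ) (x : ℝ) :
    crossing m (stream x 0) 0 = crossing m (stream x 1) 1 := by
  have h0 : ∀ l, cellStep m l 0 = 0 := fun l =>
    cellStep_of_le (by have := scale_pos m; positivity)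
  have h1 : ∀ l ∈ cells m, cellStep m l 1 = 1 := fun l hl =>
    cellStep_of_ge (by have := cells_le_one hl; have := len_le_scale m; linarith)
  have e1 : crossing m (stream x 1) 1
      = step ((-stream x 1 - incY 0) / slackY 0) + weight 0 0 0 (stream x 1) := by
    rw [crossing, ← sum_weight m]
    congr 1
    exact Finset.sum_congr rfl fun k _ => Finset.sum_congr rfl fun l hl => by
      rw [h1 l hl, mul_one]
  rw [e1, crossing]
  simp only [h0, mul_zero, Finset.sum_const_zero, add_zero, weight, pulse]
  rw [add_sub_cancel, stream, stream, cdf_zero, cdf_incY_one, incY]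
  congr 2
  ring

lemma source_nonneg (m : ℕ) (h y : ℝ) : 0 ≤ source m h y :=
  sum_weight_mul_nonneg m h fun l => dcellStep_nonneg m l y

lemma source_le (m : ℕ) (h y : ℝ) : source m h y ≤ 3 / scale m := by
  have h1 := sum_weight_mul_le m h fun l => dcellStep_le m l y
  have := scale_pos m
  exact h1.trans (mul_le_of_le_one_left (by positivity) (weight_le_one 0 0 0 h))

lemma source_eq_zero {m : ℕ} {x y : ℝ} (h : ¬(x ∈ kept (m + 1) ∧ y ∈ kept (m + 1))) :
    source m (stream x y) y = 0 := by
  refine Finset.sum_eq_zero fun k hk => Finset.sum_eq_zero fun l hl => ?_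
  by_contra hne
  have hw := left_ne_zero_of_mul hne
  obtain ⟨hy1, hy2⟩ := dcellStep_ne_zero (right_ne_zero_of_mul hne)
  refine h ⟨mem_kept_succ_of hk ?_ ?_, mem_kept_succ_of hl hy1.le hy2.le⟩
  · by_contra! hx
    exact (lt_of_weight_left hk hl hx.le (.inl hw)).not_gt hy1
  · by_contra! hx
    exact (lt_of_weight_right hk hl (cdf_incX_ge hk hx.le) (.inl hw)).not_gt hy2

lemma dcrossing_succ (m : ℕ) (x y : ℝ) : dcrossing (m + 1) (stream x y) y
    = dcrossing m (stream x y) y + ∑ k ∈ cells m, ∑ l ∈ cells m, refinement m k l x y := by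
  unfold dcrossing refinement
  rw [sum_cells_prod_succ m fun k l => dweight (m + 1) k l (stream x y) * cellStep (m + 1) l y]
  simp only [Finset.sum_sub_distrib]
  ring

lemma refinement_sum (m : ℕ) (x y : ℝ) {q : ℝ}
    (hq : x ∈ kept (m + 1) → y ∈ kept (m + 1) → q ≤ 300000 * 4 ^ (m + 1) * scale m) :
    q * |∑ k ∈ cells m, ∑ l ∈ cells m, refinement m k l x y|
      ≤ 60000000 * 16 ^ (m + 1) * (scale m / scale (m + 1) ^ 2) := by
  have ht := scale_pos m
  have ht' := scale_pos (m + 1)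
  by_cases hK : x ∈ kept (m + 1) ∧ y ∈ kept (m + 1)
  · have h1 : |∑ k ∈ cells m, ∑ l ∈ cells m, refinement m k l x y|
        ≤ 200 * 4 ^ (m + 1) / scale (m + 1) ^ 2 := by
      have hb : ∀ {k l : ℕ} {x : ℝ}, k * scale m < x ∧ x < k * scale m + len m →
          l * scale m < x ∧ x < l * scale m + len m → k = l := fun {k l x} h h' => by
        have := len_le_scale m
        exact cell_unique ht h.1 (by linarith [h.2]) h'.1 (by linarith [h'.2])
      rw [← Finset.sum_product']
      refine abs_sum_le_of_unique (by positivity) ?_ ?_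
      · rintro ⟨k, l⟩ hkl
        rw [Finset.mem_product] at hkl
        exact abs_refinement_le hkl.1 hkl.2 x y
      · rintro ⟨k, l⟩ hkl ⟨k', l'⟩ hkl' h h'
        rw [Finset.mem_product] at hkl hkl'
        have hh := refinement_ne_zero hkl.1 hkl.2 h
        have hh' := refinement_ne_zero hkl'.1 hkl'.2 h'
        exact Prod.ext (hb hh.1 hh'.1) (hb hh.2 hh'.2)
    calc _ ≤ 300000 * 4 ^ (m + 1) * scale m * (200 * 4 ^ (m + 1) / scale (m + 1) ^ 2) :=
          mul_le_mul (hq hK.1 hK.2) h1 (abs_nonneg _) (by positivity)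
      _ = _ := by
        rw [show (16 : ℝ) = 4 * 4 by norm_num, mul_pow]; ring
  · have : ∑ k ∈ cells m, ∑ l ∈ cells m, refinement m k l x y = 0 := by
      refine Finset.sum_eq_zero fun k hk => Finset.sum_eq_zero fun l hl => ?_
      by_contra hne
      have hh := refinement_ne_zero hk hl hne
      exact hK ⟨mem_kept_succ_of hk hh.1.1.le hh.1.2.le, mem_kept_succ_of hl hh.2.1.le hh.2.2.le⟩
    rw [this, abs_zero, mul_zero]
    positivity

lemma mul_abs_dcrossing_le (x y : ℝ) {q : ℝ} (hq0 : 0 ≤ q) (hq1 : q ≤ 300000)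
    (hq : ∀ m, x ∈ kept (m + 1) → y ∈ kept (m + 1) → q ≤ 300000 * 4 ^ (m + 1) * scale m)
    (m : ℕ) : q * |dcrossing m (stream x y) y| ≤ 100000000 / scale (m + 1) := by
  have ht := fun i => scale_pos i
  induction m with
  | zero =>
    have h1 : |dcrossing 0 (stream x y) y| ≤ 112 := by
      have hb := bump_le ((-stream x y - incY 0) / slackY 0)
      have hb' := bump_nonneg ((-stream x y - incY 0) / slackY 0)
      have hw := abs_dweight_le 0 0 (by simp [cells]) 0 (by simp [cells]) (stream x y)
      have hc := cellStep_le_one 0 0 y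
      have hc' := cellStep_nonneg 0 0 y
      have h2 : |dweight 0 0 0 (stream x y) * cellStep 0 0 y| ≤ 100 := by
        rw [abs_mul, abs_of_nonneg hc']
        calc _ ≤ |dweight 0 0 0 (stream x y)| * 1 := by gcongr
          _ ≤ 100 := by rw [scale_zero] at hw; linarith
      rw [abs_le] at h2
      simp only [dcrossing, cells, Finset.sum_singleton, slackY] at *
      rw [abs_le]
      constructor <;> linarith
    have h2 : (1 : ℝ) ≤ 1 / scale 1 := (one_le_div (ht 1)).2 (scale_le_one 1)
    calc q * |dcrossing 0 (stream x y) y| ≤ 300000 * 112 := by gcongr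
      _ ≤ 100000000 * (1 / scale 1) := by linarith
      _ = _ := by ring
  | succ m ih =>
    have h1 := refinement_sum m x y (hq m)
    have h2 : 60000000 * 16 ^ (m + 1) * (scale m / scale (m + 1) ^ 2) ≤ 1 / scale (m + 2) := by
      rw [le_div_iff₀ (ht _), mul_assoc, div_mul_eq_mul_div, scale_eq m, scale_eq (m + 1)]
      have hR := rad_succ_ge m
      have hR0 : (0 : ℝ) < rad (m + 1) := by exact_mod_cast rad_pos _
      have hR1 : (0 : ℝ) < rad m := by exact_mod_cast rad_pos _
      have e : (rad m : ℝ) * (rad (m + 1) * scale (m + 1 + 1)) * scale (m + 2)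
          / (rad (m + 1) * scale (m + 1 + 1)) ^ 2 = rad m / rad (m + 1) := by
        have := ht (m + 2)
        field_simp
      rw [e, ← mul_div_assoc, div_le_one hR0]
      have h16 : (16 : ℝ) ^ m ≤ 256 ^ m := pow_le_pow_left₀ (by norm_num) (by norm_num) m
      have hc : (960000000 : ℝ) ≤ 2 ^ 48 := by norm_num
      have h1 : 60000000 * (16 : ℝ) ^ (m + 1) ≤ 256 ^ m * 2 ^ 48 :=
        (show 60000000 * (16 : ℝ) ^ (m + 1) = 16 ^ m * 960000000 by rw [pow_succ]; ring).le.trans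
          (mul_le_mul h16 hc (by norm_num) (by positivity))
      exact (mul_le_mul_of_nonneg_right h1 hR1.le).trans hR
    have h3 : 100000000 / scale (m + 1) + 1 / scale (m + 2) ≤ 100000000 / scale (m + 2) := by
      have := scale_succ_le (m + 1)
      have e : 1 / scale (m + 1) ≤ 1 / (256 * scale (m + 2)) :=
        one_div_le_one_div_of_le (by have := ht (m + 2); positivity) this
      have e2 : 1 / (256 * scale (m + 2)) = 1 / scale (m + 2) / 256 := by
        rw [mul_comm, ← div_div]
      have e3 : 0 < 1 / scale (m + 2) := by have := ht (m + 2); positivity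
      calc _ = 100000000 * (1 / scale (m + 1)) + 1 / scale (m + 2) := by ring
        _ ≤ 100000000 * (1 / scale (m + 2)) := by rw [e2] at e; linarith
        _ = _ := by ring
    rw [dcrossing_succ]
    calc _ ≤ q * (|dcrossing m (stream x y) y|
          + |∑ k ∈ cells m, ∑ l ∈ cells m, refinement m k l x y|) := by
          gcongr; exact abs_add_le _ _
      _ ≤ _ := by rw [mul_add]; linarith

lemma dens_incX_mul_dcrossing_le (m : ℕ) (x y : ℝ) :
    dens incX x * |dcrossing m (stream x y) y| ≤ 100000000 / scale (m + 1) :=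
  mul_abs_dcrossing_le x y (incr_incX.dens_nonneg x) (incr_incX.dens_le x)
    (fun _ hx _ => incr_incX.dens_le_of_mem_kept hx) m

lemma dens_incY_mul_dcrossing_le (m : ℕ) (x y : ℝ) :
    dens incY y * |dcrossing m (stream x y) y| ≤ 100000000 / scale (m + 1) :=
  mul_abs_dcrossing_le x y (incr_incY.dens_nonneg y) (incr_incY.dens_le y)
    (fun _ _ hy => incr_incY.dens_le_of_mem_kept hy) m

section

/-- A `C¹` function on the unit square with matching values on opposite sides. -/
structure TestFun where
  φ : ℝ → ℝ → ℝ
  φx : ℝ → ℝ → ℝ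
  φy : ℝ → ℝ → ℝ
  hasDerivAt_left : ∀ x y, HasDerivAt (fun x => φ x y) (φx x y) x
  hasDerivAt_right : ∀ x y, HasDerivAt (fun y => φ x y) (φy x y) y
  cont : Continuous fun p : ℝ × ℝ => φ p.1 p.2
  cont_left : Continuous fun p : ℝ × ℝ => φx p.1 p.2
  cont_right : Continuous fun p : ℝ × ℝ => φy p.1 p.2
  per_left : ∀ y ∈ Set.Icc (0 : ℝ) 1, φ 0 y = φ 1 y
  per_right : ∀ x ∈ Set.Icc (0 : ℝ) 1, φ x 0 = φ x 1

/-- The test function which gains along the flow away from the cells of generation `m + 1`. -/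
def potential (m : ℕ) : TestFun where
  φ x y := 600001 * (crossing m (stream x y) y - x) - (y - 2 * cdf incY y)
  φx x y := 600001 * (dcrossing m (stream x y) y * -dens incX x - 1)
  φy x y := 600001 * (dcrossing m (stream x y) y * dens incY y + source m (stream x y) y)
    - (1 - 2 * dens incY y)
  hasDerivAt_left x y :=
    (((hasDerivAt_crossing_left m x y).sub (hasDerivAt_id x)).const_mul _).sub_const _
  hasDerivAt_right x y :=
    (((hasDerivAt_crossing_right m x y).sub_const _).const_mul _).sub
      ((hasDerivAt_id y).sub ((incr_incY.hasDerivAt_cdf y).const_mul _))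
  cont := by
    have := contDiff_step.continuous
    have := continuous_weight m
    unfold crossing stream
    fun_prop
  cont_left := by
    have := continuous_dcrossing m
    fun_prop
  cont_right := by
    have := continuous_dcrossing m
    have := continuous_source m
    fun_prop
  per_left y hy := by rw [crossing_left m hy, crossing_right m hy]; ring
  per_right x _ := by rw [crossing_bottom_top m x, cdf_zero, cdf_incY_one]; ring

lemma abs_potential_le (m : ℕ) {x y : ℝ} (hx : x ∈ Set.Icc (0 : ℝ) 1)
    (hy : y ∈ Set.Icc (0 : ℝ) 1) : |(potential m).φ x y| ≤ 2000000 := by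
  have h1 := crossing_nonneg m (stream x y) y
  have h2 := crossing_le m (stream x y) y
  have h3 := cdf_incY_mem hy
  obtain ⟨hx0, hx1⟩ := hx
  obtain ⟨hy0, hy1⟩ := hy
  simp only [potential]
  rw [abs_le]
  constructor <;> linarith

lemma abs_potential_left_le (m : ℕ) (x y : ℝ) :
    |(potential m).φx x y| ≤ 10 ^ 14 / scale (m + 1) := by
  have h1 := dens_incX_mul_dcrossing_le m x y
  have h2 := incr_incX.dens_nonneg x
  have h3 : 1 ≤ 1 / scale (m + 1) := (one_le_div (scale_pos _)).2 (scale_le_one _)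
  have h4 : |dcrossing m (stream x y) y * -dens incX x| ≤ 100000000 / scale (m + 1) := by
    rw [abs_mul, abs_neg, abs_of_nonneg h2, mul_comm]; exact h1
  have e1 : 100000000 / scale (m + 1) = 100000000 * (1 / scale (m + 1)) := by ring
  have e2 : 10 ^ 14 / scale (m + 1) = 10 ^ 14 * (1 / scale (m + 1)) := by ring
  rw [abs_le, e1] at h4
  simp only [potential]
  rw [e2, abs_le]
  constructor <;> linarith

lemma abs_potential_right_le (m : ℕ) (x y : ℝ) :
    |(potential m).φy x y| ≤ 10 ^ 14 / scale (m + 1) := by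
  have h1 := dens_incY_mul_dcrossing_le m x y
  have h2 := incr_incY.dens_nonneg y
  have h2' := incr_incY.dens_le y
  have h3 : 1 ≤ 1 / scale (m + 1) := (one_le_div (scale_pos _)).2 (scale_le_one _)
  have h4 : |dcrossing m (stream x y) y * dens incY y| ≤ 100000000 / scale (m + 1) := by
    rw [abs_mul, abs_of_nonneg h2, mul_comm]; exact h1
  have h5 := source_nonneg m (stream x y) y
  have h6 : source m (stream x y) y ≤ 3 * (1 / scale (m + 1)) := by
    refine (source_le m _ y).trans ?_
    rw [← mul_one_div]
    have := scale_pos (m + 1)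
    have := scale_succ_le m
    gcongr
    linarith
  have e1 : 100000000 / scale (m + 1) = 100000000 * (1 / scale (m + 1)) := by ring
  have e2 : 10 ^ 14 / scale (m + 1) = 10 ^ 14 * (1 / scale (m + 1)) := by ring
  rw [abs_le, e1] at h4
  simp only [potential]
  rw [e2, abs_le]
  constructor <;> linarith

lemma potential_flow_le (m : ℕ) (x y : ℝ) :
    dens incY y * (potential m).φx x y + dens incX x * (potential m).φy x y
      ≤ 600001 * (dens incX x * source m (stream x y) y) - (dens incY y + dens incX x) := by
  have h1 := incr_incX.dens_le x
  have h2 := incr_incY.dens_nonneg y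
  simp only [potential]
  nlinarith [mul_nonneg h2 (sub_nonneg.2 h1)]

/-- The unit square. -/
def unitSq : Set (ℝ × ℝ) := Set.Icc 0 1 ×ˢ Set.Icc 0 1

lemma isCompact_unitSq : IsCompact unitSq := isCompact_Icc.prod isCompact_Icc

lemma measurableSet_unitSq : MeasurableSet unitSq := isCompact_unitSq.measurableSet

lemma integrableOn_unitSq {F : ℝ × ℝ → ℝ} (hF : Continuous F) : IntegrableOn F unitSq :=
  hF.continuousOn.integrableOn_compact isCompact_unitSq

lemma setIntegral_prod_swap' {s t : Set ℝ} {F : ℝ × ℝ → ℝ}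
    (hF : IntegrableOn F (s ×ˢ t)) :
    ∫ p in s ×ˢ t, F p = ∫ y in t, ∫ x in s, F (x, y) := by
  rw [Measure.volume_eq_prod] at *
  unfold IntegrableOn at hF
  rw [← Measure.prod_restrict] at *
  exact integral_prod_symm F hF

lemma integral_deriv_left {c cx : ℝ → ℝ → ℝ}
    (hd : ∀ x y, HasDerivAt (fun x => c x y) (cx x y) x)
    (hc : Continuous fun p : ℝ × ℝ => cx p.1 p.2)
    (hp : ∀ y ∈ Set.Icc (0 : ℝ) 1, c 0 y = c 1 y) : ∫ p in unitSq, cx p.1 p.2 = 0 := by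
  have hi := integrableOn_unitSq hc
  unfold unitSq at *
  rw [setIntegral_prod_swap' hi]
  refine (setIntegral_congr_fun measurableSet_Icc fun y hy => ?_).trans (integral_zero _ _)
  change ∫ x in Set.Icc (0 : ℝ) 1, cx x y = 0
  rw [integral_Icc_eq_integral_Ioc, ← intervalIntegral.integral_of_le zero_le_one,
    intervalIntegral.integral_eq_sub_of_hasDerivAt (fun x _ => hd x y)
      ((hc.comp (by fun_prop : Continuous fun x : ℝ => (x, y))).intervalIntegrable 0 1),
    hp y hy, sub_self]

lemma integral_deriv_right {c cy : ℝ → ℝ → ℝ}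
    (hd : ∀ x y, HasDerivAt (fun y => c x y) (cy x y) y)
    (hc : Continuous fun p : ℝ × ℝ => cy p.1 p.2)
    (hp : ∀ x ∈ Set.Icc (0 : ℝ) 1, c x 0 = c x 1) : ∫ p in unitSq, cy p.1 p.2 = 0 := by
  have hi := integrableOn_unitSq hc
  unfold unitSq at *
  rw [Measure.volume_eq_prod] at *
  rw [setIntegral_prod _ hi]
  refine (setIntegral_congr_fun measurableSet_Icc fun x hx => ?_).trans (integral_zero _ _)
  change ∫ y in Set.Icc (0 : ℝ) 1, cy x y = 0
  rw [integral_Icc_eq_integral_Ioc, ← intervalIntegral.integral_of_le zero_le_one,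
    intervalIntegral.integral_eq_sub_of_hasDerivAt (fun y _ => hd x y)
      ((hc.comp (by fun_prop : Continuous fun y : ℝ => (x, y))).intervalIntegrable 0 1),
    hp x hx, sub_self]

lemma integral_eq_of_add {F G c d : ℝ × ℝ → ℝ} (hG : Continuous G)
    (hc : Continuous c) (hd : Continuous d) (ic : ∫ p in unitSq, c p = 0)
    (id : ∫ p in unitSq, d p = 0) (h : ∀ p ∈ unitSq, F p = G p + c p + d p) :
    ∫ p in unitSq, F p = ∫ p in unitSq, G p := by
  rw [setIntegral_congr_fun measurableSet_unitSq h,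
    integral_add (f := fun p => G p + c p) (integrableOn_unitSq (hG.add hc))
      (integrableOn_unitSq hd),
    integral_add (integrableOn_unitSq hG) (integrableOn_unitSq hc), ic, id, add_zero, add_zero]

/-- A solution of the advection–diffusion equation on the unit square, in coordinates. -/
structure Sol (κ Λ : ℝ) (init : ℝ → ℝ) where
  v : ℝ → ℝ → ℝ → ℝ
  vt : ℝ → ℝ → ℝ → ℝ
  vx : ℝ → ℝ → ℝ → ℝ
  vy : ℝ → ℝ → ℝ → ℝ
  vxx : ℝ → ℝ → ℝ → ℝ
  vyy : ℝ → ℝ → ℝ → ℝ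
  cont : ContinuousOn (fun p : ℝ × (ℝ × ℝ) => v p.1 p.2.1 p.2.2)
    (Set.Icc 0 1 ×ˢ (Set.univ : Set (ℝ × ℝ)))
  cont_time : ContinuousOn (fun p : ℝ × (ℝ × ℝ) => vt p.1 p.2.1 p.2.2)
    (Set.Ioc 0 1 ×ˢ (Set.univ : Set (ℝ × ℝ)))
  hasDerivAt_time : ∀ t ∈ Set.Ioc (0 : ℝ) 1, ∀ x y, HasDerivAt (fun t => v t x y) (vt t x y) t
  hasDerivAt_x : ∀ t ∈ Set.Ioc (0 : ℝ) 1, ∀ x y, HasDerivAt (fun x => v t x y) (vx t x y) x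
  hasDerivAt_y : ∀ t ∈ Set.Ioc (0 : ℝ) 1, ∀ x y, HasDerivAt (fun y => v t x y) (vy t x y) y
  hasDerivAt_xx : ∀ t ∈ Set.Ioc (0 : ℝ) 1, ∀ x y, HasDerivAt (fun x => vx t x y) (vxx t x y) x
  hasDerivAt_yy : ∀ t ∈ Set.Ioc (0 : ℝ) 1, ∀ x y, HasDerivAt (fun y => vy t x y) (vyy t x y) y
  cont_x : ∀ t ∈ Set.Ioc (0 : ℝ) 1, Continuous fun p : ℝ × ℝ => vx t p.1 p.2
  cont_y : ∀ t ∈ Set.Ioc (0 : ℝ) 1, Continuous fun p : ℝ × ℝ => vy t p.1 p.2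
  cont_xx : ∀ t ∈ Set.Ioc (0 : ℝ) 1, Continuous fun p : ℝ × ℝ => vxx t p.1 p.2
  cont_yy : ∀ t ∈ Set.Ioc (0 : ℝ) 1, Continuous fun p : ℝ × ℝ => vyy t p.1 p.2
  per_left : ∀ t ∈ Set.Ioc (0 : ℝ) 1, ∀ y, v t 0 y = v t 1 y ∧ vx t 0 y = vx t 1 y
  per_right : ∀ t ∈ Set.Ioc (0 : ℝ) 1, ∀ x, v t x 0 = v t x 1 ∧ vy t x 0 = vy t x 1
  eqn : ∀ t ∈ Set.Ioc (0 : ℝ) 1, ∀ x ∈ Set.Icc (0 : ℝ) 1, ∀ y ∈ Set.Icc (0 : ℝ) 1,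
    vt t x y + Λ * (dens incY y * vx t x y + dens incX x * vy t x y)
      = κ * (vxx t x y + vyy t x y)
  initial : ∀ x y, v 0 x y = init x

namespace Sol
variable {κ Λ : ℝ} {init : ℝ → ℝ} (S : Sol κ Λ init) {t : ℝ}

lemma cont_slice (ht : t ∈ Set.Icc (0 : ℝ) 1) : Continuous fun p : ℝ × ℝ => S.v t p.1 p.2 := by
  refine continuousOn_univ.1 (S.cont.comp (f := fun p : ℝ × ℝ => (t, p)) (by fun_prop) ?_)
  exact fun p _ => ⟨ht, trivial⟩

lemma cont_time_slice (ht : t ∈ Set.Ioc (0 : ℝ) 1) :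
    Continuous fun p : ℝ × ℝ => S.vt t p.1 p.2 := by
  refine continuousOn_univ.1 (S.cont_time.comp (f := fun p : ℝ × ℝ => (t, p)) (by fun_prop) ?_)
  exact fun p _ => ⟨ht, trivial⟩

/-- The weak formulation of the equation for the square of the solution. -/
lemma integral_test (ht : t ∈ Set.Ioc (0 : ℝ) 1) (T : TestFun) :
    ∫ p in unitSq, T.φ p.1 p.2 * (2 * S.v t p.1 p.2 * S.vt t p.1 p.2)
    = ∫ p in unitSq, (Λ * (S.v t p.1 p.2 ^ 2
        * (dens incY p.2 * T.φx p.1 p.2 + dens incX p.1 * T.φy p.1 p.2))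
      - 2 * κ * (T.φ p.1 p.2 * (S.vx t p.1 p.2 ^ 2 + S.vy t p.1 p.2 ^ 2))
      - 2 * κ * (S.v t p.1 p.2
        * (S.vx t p.1 p.2 * T.φx p.1 p.2 + S.vy t p.1 p.2 * T.φy p.1 p.2))) := by
  have cv := S.cont_slice (Set.Ioc_subset_Icc_self ht)
  have cvt := S.cont_time_slice ht
  have cx := S.cont_x t ht
  have cy := S.cont_y t ht
  have cxx := S.cont_xx t ht
  have cyy := S.cont_yy t ht
  have c1 := T.cont
  have c2 := T.cont_left
  have c3 := T.cont_right
  have hX := integral_deriv_left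
    (c := fun x y => 2 * κ * (T.φ x y * (S.v t x y * S.vx t x y))
      - Λ * dens incY y * (T.φ x y * S.v t x y ^ 2))
    (cx := fun x y => 2 * κ * (T.φx x y * (S.v t x y * S.vx t x y)
      + T.φ x y * (S.vx t x y * S.vx t x y + S.v t x y * S.vxx t x y))
      - Λ * dens incY y * (T.φx x y * S.v t x y ^ 2
        + T.φ x y * (2 * S.v t x y * S.vx t x y)))
    (fun x y => by
      have h0 := T.hasDerivAt_left x y
      have h1 := S.hasDerivAt_x t ht x y
      have h2 := S.hasDerivAt_xx t ht x y
      refine (((h0.mul (h1.mul h2)).const_mul (2 * κ)).sub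
        ((h0.mul (h1.pow 2)).const_mul (Λ * dens incY y))).congr_deriv ?_
      simp)
    (by fun_prop)
    (fun y hy => by rw [T.per_left y hy, (S.per_left t ht y).1, (S.per_left t ht y).2])
  have hY := integral_deriv_right
    (c := fun x y => 2 * κ * (T.φ x y * (S.v t x y * S.vy t x y))
      - Λ * dens incX x * (T.φ x y * S.v t x y ^ 2))
    (cy := fun x y => 2 * κ * (T.φy x y * (S.v t x y * S.vy t x y)
      + T.φ x y * (S.vy t x y * S.vy t x y + S.v t x y * S.vyy t x y))
      - Λ * dens incX x * (T.φy x y * S.v t x y ^ 2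
        + T.φ x y * (2 * S.v t x y * S.vy t x y)))
    (fun x y => by
      have h0 := T.hasDerivAt_right x y
      have h1 := S.hasDerivAt_y t ht x y
      have h2 := S.hasDerivAt_yy t ht x y
      refine (((h0.mul (h1.mul h2)).const_mul (2 * κ)).sub
        ((h0.mul (h1.pow 2)).const_mul (Λ * dens incX x))).congr_deriv ?_
      simp)
    (by fun_prop)
    (fun x hx => by rw [T.per_right x hx, (S.per_right t ht x).1, (S.per_right t ht x).2])
  refine integral_eq_of_add (by fun_prop) (by fun_prop) (by fun_prop) hX hY fun p hp => ?_
  have e := S.eqn t ht p.1 hp.1 p.2 hp.2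
  linear_combination (2 * T.φ p.1 p.2 * S.v t p.1 p.2) * e

end Sol

end

section

lemma integral_unitSq_mono {F G : ℝ × ℝ → ℝ} (hF : Continuous F) (hG : Continuous G)
    (h : ∀ p ∈ unitSq, F p ≤ G p) : ∫ p in unitSq, F p ≤ ∫ p in unitSq, G p :=
  setIntegral_mono_on (integrableOn_unitSq hF) (integrableOn_unitSq hG) measurableSet_unitSq h

lemma volume_unitSq : (volume : Measure (ℝ × ℝ)).real unitSq = 1 := by
  rw [unitSq, Measure.volume_eq_prod, measureReal_prod_prod]
  simp

section time
variable {W Wt : ℝ → ℝ × ℝ → ℝ}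

lemma continuousOn_integral_unitSq
    (hW : ContinuousOn (fun p : ℝ × (ℝ × ℝ) => W p.1 p.2) (Set.Icc 0 1 ×ˢ Set.univ)) :
    ContinuousOn (fun t => ∫ p in unitSq, W t p) (Set.Icc 0 1) := by
  obtain ⟨C, hC⟩ := (isCompact_Icc.prod isCompact_unitSq).exists_bound_of_continuousOn
    (hW.mono (Set.prod_mono_right (Set.subset_univ unitSq)))
  refine continuousOn_of_dominated (bound := fun _ => C) (fun t ht => ?_) (fun t ht => ?_)
    (integrableOn_unitSq continuous_const) (.of_forall fun p => ?_)
  · refine ContinuousOn.aestronglyMeasurable ?_ measurableSet_unitSq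
    exact hW.comp (f := fun p : ℝ × ℝ => (t, p)) (by fun_prop) fun p _ => ⟨ht, trivial⟩
  · exact (ae_restrict_mem measurableSet_unitSq).mono fun p hp => hC (t, p) ⟨ht, hp⟩
  · exact hW.comp (f := fun t : ℝ => (t, p)) (by fun_prop) fun t ht => ⟨ht, trivial⟩

lemma hasDerivAt_integral_unitSq
    (hW : ContinuousOn (fun p : ℝ × (ℝ × ℝ) => W p.1 p.2) (Set.Icc 0 1 ×ˢ Set.univ))
    (hWt : ContinuousOn (fun p : ℝ × (ℝ × ℝ) => Wt p.1 p.2) (Set.Ioc 0 1 ×ˢ Set.univ))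
    (hd : ∀ t ∈ Set.Ioc (0 : ℝ) 1, ∀ p, HasDerivAt (fun t => W t p) (Wt t p) t)
    {t : ℝ} (ht : t ∈ Set.Ioo (0 : ℝ) 1) :
    HasDerivAt (fun t => ∫ p in unitSq, W t p) (∫ p in unitSq, Wt t p) t := by
  have hsub : Set.Icc (t / 2) 1 ×ˢ unitSq ⊆ Set.Ioc 0 1 ×ˢ (Set.univ : Set (ℝ × ℝ)) :=
    Set.prod_mono (fun s hs => ⟨by linarith [ht.1, hs.1], hs.2⟩) (Set.subset_univ _)
  obtain ⟨C, hC⟩ := (isCompact_Icc.prod isCompact_unitSq).exists_bound_of_continuousOn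
    (hWt.mono hsub)
  have hmem : Set.Ioo (t / 2) 1 ∈ nhds t := Ioo_mem_nhds (by linarith [ht.1]) ht.2
  have hslice : ∀ s ∈ Set.Icc (0 : ℝ) 1, ContinuousOn (W s) unitSq := fun s hs =>
    hW.comp (f := fun p : ℝ × ℝ => (s, p)) (by fun_prop) fun p _ => ⟨hs, trivial⟩
  refine (hasDerivAt_integral_of_dominated_loc_of_deriv_le (bound := fun _ => C) hmem ?_
    ((hslice t ⟨ht.1.le, ht.2.le⟩).integrableOn_compact isCompact_unitSq) ?_ ?_
    (integrableOn_unitSq continuous_const) ?_).2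
  · filter_upwards [hmem] with s hs
    exact (hslice s ⟨by linarith [ht.1, hs.1], hs.2.le⟩).aestronglyMeasurable
      measurableSet_unitSq
  · refine ContinuousOn.aestronglyMeasurable ?_ measurableSet_unitSq
    exact hWt.comp (f := fun p : ℝ × ℝ => (t, p)) (by fun_prop)
      fun p _ => ⟨⟨ht.1, ht.2.le⟩, trivial⟩
  · exact (ae_restrict_mem measurableSet_unitSq).mono fun p hp s hs =>
      hC (s, p) ⟨⟨hs.1.le, hs.2.le⟩, hp⟩
  · exact .of_forall fun p s hs => hd s ⟨by linarith [ht.1, hs.1], hs.2.le⟩ p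

end time

/-- The constant test function. -/
def oneTest : TestFun where
  φ _ _ := 1
  φx _ _ := 0
  φy _ _ := 0
  hasDerivAt_left _ _ := hasDerivAt_const _ _
  hasDerivAt_right _ _ := hasDerivAt_const _ _
  cont := continuous_const
  cont_left := continuous_const
  cont_right := continuous_const
  per_left _ _ := rfl
  per_right _ _ := rfl

namespace Sol
variable {κ Λ : ℝ} {init : ℝ → ℝ} (S : Sol κ Λ init) {t : ℝ}

/-- The integral of the square of the solution against a test function. -/
def pairing (T : TestFun) (t : ℝ) : ℝ := ∫ p in unitSq, T.φ p.1 p.2 * S.v t p.1 p.2 ^ 2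

/-- The energy of the solution. -/
def energy (t : ℝ) : ℝ := ∫ p in unitSq, S.v t p.1 p.2 ^ 2

/-- The dissipation rate of the solution. -/
def dissip (t : ℝ) : ℝ := ∫ p in unitSq, (S.vx t p.1 p.2 ^ 2 + S.vy t p.1 p.2 ^ 2)

/-- The integral of `|v| (|∂ₓv| + |∂ᵧv|)`. -/
def mixed (t : ℝ) : ℝ :=
  ∫ p in unitSq, |S.v t p.1 p.2| * (|S.vx t p.1 p.2| + |S.vy t p.1 p.2|)

lemma continuousOn_pairing (T : TestFun) : ContinuousOn (S.pairing T) (Set.Icc 0 1) :=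
  continuousOn_integral_unitSq (W := fun t p => T.φ p.1 p.2 * S.v t p.1 p.2 ^ 2)
    ((T.cont.comp continuous_snd).continuousOn.mul (S.cont.pow 2))

lemma hasDerivAt_pairing (T : TestFun) (ht : t ∈ Set.Ioo (0 : ℝ) 1) :
    HasDerivAt (S.pairing T)
      (∫ p in unitSq, T.φ p.1 p.2 * (2 * S.v t p.1 p.2 * S.vt t p.1 p.2)) t := by
  have hv := S.cont.mono (Set.prod_mono_left (t := Set.univ)
    (Set.Ioc_subset_Icc_self (a := (0 : ℝ)) (b := 1)))
  refine hasDerivAt_integral_unitSq (W := fun t p => T.φ p.1 p.2 * S.v t p.1 p.2 ^ 2)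
    (Wt := fun t p => T.φ p.1 p.2 * (2 * S.v t p.1 p.2 * S.vt t p.1 p.2))
    ((T.cont.comp continuous_snd).continuousOn.mul (S.cont.pow 2))
    ((T.cont.comp continuous_snd).continuousOn.mul
      ((continuousOn_const.mul hv).mul S.cont_time)) (fun s hs p => ?_) ht
  refine (((S.hasDerivAt_time s hs p.1 p.2).pow 2).const_mul _).congr_deriv ?_
  simp

lemma energy_eq_pairing : S.energy = S.pairing oneTest := by
  funext t; simp [energy, pairing, oneTest]

lemma continuousOn_energy : ContinuousOn S.energy (Set.Icc 0 1) :=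
  S.energy_eq_pairing ▸ S.continuousOn_pairing _

lemma hasDerivAt_energy (ht : t ∈ Set.Ioo (0 : ℝ) 1) :
    HasDerivAt S.energy (-(2 * κ * S.dissip t)) t := by
  have h := S.hasDerivAt_pairing oneTest ht
  rw [S.integral_test ⟨ht.1, ht.2.le⟩, ← energy_eq_pairing] at h
  refine h.congr_deriv ?_
  simp [oneTest, dissip, integral_neg, integral_const_mul]

lemma dissip_nonneg (t : ℝ) : 0 ≤ S.dissip t :=
  integral_nonneg fun _ => by positivity

lemma energy_nonneg (t : ℝ) : 0 ≤ S.energy t := integral_nonneg fun _ => by positivity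

lemma antitoneOn_energy (hκ : 0 ≤ κ) : AntitoneOn S.energy (Set.Icc 0 1) := by
  refine antitoneOn_of_deriv_nonpos (convex_Icc 0 1) S.continuousOn_energy ?_ ?_ <;>
    rw [interior_Icc]
  · exact fun t ht => (S.hasDerivAt_energy ht).differentiableAt.differentiableWithinAt
  · intro t ht
    rw [(S.hasDerivAt_energy ht).deriv]
    have := S.dissip_nonneg t
    exact neg_nonpos.2 (by positivity)

/-- The energy balance. -/
lemma integral_dissip (hκ : 0 ≤ κ) :
    κ * ∫ t in Set.Icc (0 : ℝ) 1, S.dissip t = (S.energy 0 - S.energy 1) / 2 := by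
  have hd : ∀ t ∈ Set.Ioo (0 : ℝ) 1, HasDerivAt (fun t => -S.energy t) (2 * κ * S.dissip t) t :=
    fun t ht => (S.hasDerivAt_energy ht).neg.congr_deriv (neg_neg _)
  have hi := intervalIntegral.integrableOn_deriv_of_nonneg (a := 0) (b := 1)
    S.continuousOn_energy.neg hd fun t _ => by have := S.dissip_nonneg t; positivity
  have h := intervalIntegral.integral_eq_sub_of_hasDerivAt_of_le zero_le_one
    S.continuousOn_energy.neg hd
    ((intervalIntegrable_iff_integrableOn_Ioc_of_le zero_le_one).2 hi)
  rw [intervalIntegral.integral_const_mul, intervalIntegral.integral_of_le zero_le_one,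
    ← integral_Icc_eq_integral_Ioc] at h
  simp only [Pi.neg_apply] at h
  linarith

/-- The integral of the fourth power of the solution. -/
def quartic (t : ℝ) : ℝ := ∫ p in unitSq, S.v t p.1 p.2 ^ 4

lemma integral_quartic_deriv_nonpos (hκ : 0 ≤ κ) (ht : t ∈ Set.Ioc (0 : ℝ) 1) :
    ∫ p in unitSq, 4 * S.v t p.1 p.2 ^ 3 * S.vt t p.1 p.2 ≤ 0 := by
  have cv := S.cont_slice (Set.Ioc_subset_Icc_self ht)
  have cvt := S.cont_time_slice ht
  have cx := S.cont_x t ht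
  have cy := S.cont_y t ht
  have cxx := S.cont_xx t ht
  have cyy := S.cont_yy t ht
  have hX := integral_deriv_left
    (c := fun x y => 4 * κ * (S.v t x y ^ 3 * S.vx t x y) - Λ * dens incY y * S.v t x y ^ 4)
    (cx := fun x y => 4 * κ * (3 * S.v t x y ^ 2 * S.vx t x y * S.vx t x y
      + S.v t x y ^ 3 * S.vxx t x y) - Λ * dens incY y * (4 * S.v t x y ^ 3 * S.vx t x y))
    (fun x y => by
      have h1 := S.hasDerivAt_x t ht x y
      have h2 := S.hasDerivAt_xx t ht x y
      refine ((((h1.pow 3).mul h2).const_mul (4 * κ)).sub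
        ((h1.pow 4).const_mul (Λ * dens incY y))).congr_deriv ?_
      simp)
    (by fun_prop)
    (fun y _ => by rw [(S.per_left t ht y).1, (S.per_left t ht y).2])
  have hY := integral_deriv_right
    (c := fun x y => 4 * κ * (S.v t x y ^ 3 * S.vy t x y) - Λ * dens incX x * S.v t x y ^ 4)
    (cy := fun x y => 4 * κ * (3 * S.v t x y ^ 2 * S.vy t x y * S.vy t x y
      + S.v t x y ^ 3 * S.vyy t x y) - Λ * dens incX x * (4 * S.v t x y ^ 3 * S.vy t x y))
    (fun x y => by
      have h1 := S.hasDerivAt_y t ht x y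
      have h2 := S.hasDerivAt_yy t ht x y
      refine ((((h1.pow 3).mul h2).const_mul (4 * κ)).sub
        ((h1.pow 4).const_mul (Λ * dens incX x))).congr_deriv ?_
      simp)
    (by fun_prop)
    (fun x _ => by rw [(S.per_right t ht x).1, (S.per_right t ht x).2])
  rw [integral_eq_of_add (G := fun p => -(12 * κ * (S.v t p.1 p.2 ^ 2
    * (S.vx t p.1 p.2 ^ 2 + S.vy t p.1 p.2 ^ 2)))) (by fun_prop) (by fun_prop) (by fun_prop)
    hX hY fun p hp => by
      have e := S.eqn t ht p.1 hp.1 p.2 hp.2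
      linear_combination (4 * S.v t p.1 p.2 ^ 3) * e]
  rw [integral_neg]
  exact neg_nonpos.2 (integral_nonneg fun p => by positivity)

lemma quartic_le (hκ : 0 ≤ κ) (ht : t ∈ Set.Icc (0 : ℝ) 1) : S.quartic t ≤ S.quartic 0 := by
  have hv := S.cont.mono (Set.prod_mono_left (t := Set.univ)
    (Set.Ioc_subset_Icc_self (a := (0 : ℝ)) (b := 1)))
  have hd : ∀ t ∈ Set.Ioo (0 : ℝ) 1, HasDerivAt S.quartic
      (∫ p in unitSq, 4 * S.v t p.1 p.2 ^ 3 * S.vt t p.1 p.2) t := fun t ht => by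
    refine hasDerivAt_integral_unitSq (W := fun t p => S.v t p.1 p.2 ^ 4)
      (Wt := fun t p => 4 * S.v t p.1 p.2 ^ 3 * S.vt t p.1 p.2) (S.cont.pow 4)
      ((continuousOn_const.mul (hv.pow 3)).mul S.cont_time) (fun s hs p => ?_) ht
    refine ((S.hasDerivAt_time s hs p.1 p.2).pow 4).congr_deriv ?_
    simp
  have hc : ContinuousOn S.quartic (Set.Icc 0 1) :=
    continuousOn_integral_unitSq (W := fun t p => S.v t p.1 p.2 ^ 4) (S.cont.pow 4)
  have hanti : AntitoneOn S.quartic (Set.Icc 0 1) := by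
    refine antitoneOn_of_deriv_nonpos (convex_Icc 0 1) hc ?_ ?_ <;> rw [interior_Icc]
    · exact fun t ht => (hd t ht).differentiableAt.differentiableWithinAt
    · intro t ht
      rw [(hd t ht).deriv]
      exact S.integral_quartic_deriv_nonpos hκ ⟨ht.1, ht.2.le⟩
  exact hanti ⟨le_rfl, zero_le_one⟩ ht ht.1

lemma mul_mixed_le (ht : t ∈ Set.Ioc (0 : ℝ) 1) {s μ : ℝ} (hμ : 0 < μ) :
    s * S.mixed t ≤ μ * S.energy t + s ^ 2 * S.dissip t / μ := by
  have cv := S.cont_slice (Set.Ioc_subset_Icc_self ht)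
  have cx := S.cont_x t ht
  have cy := S.cont_y t ht
  have key : ∀ a b : ℝ, s * (|a| * |b|) ≤ μ / 2 * a ^ 2 + s ^ 2 / μ * b ^ 2 / 2 := fun a b => by
    have h : s ^ 2 / μ * b ^ 2 / 2 = (s * |b|) ^ 2 / (2 * μ) := by
      rw [mul_pow, sq_abs]; field_simp
    rw [h, ← sq_abs a]
    have : μ / 2 * |a| ^ 2 + (s * |b|) ^ 2 / (2 * μ) - s * (|a| * |b|)
        = (μ * |a| - s * |b|) ^ 2 / (2 * μ) := by field_simp; ring
    have : 0 ≤ (μ * |a| - s * |b|) ^ 2 / (2 * μ) := by positivity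
    linarith
  have h := integral_unitSq_mono
    (F := fun p => s * (|S.v t p.1 p.2| * (|S.vx t p.1 p.2| + |S.vy t p.1 p.2|)))
    (G := fun p => μ * S.v t p.1 p.2 ^ 2
      + s ^ 2 / μ * (S.vx t p.1 p.2 ^ 2 + S.vy t p.1 p.2 ^ 2)) (by fun_prop) (by fun_prop)
    fun p _ => by
      have h1 := key (S.v t p.1 p.2) (S.vx t p.1 p.2)
      have h2 := key (S.v t p.1 p.2) (S.vy t p.1 p.2)
      have h3 : 0 ≤ s ^ 2 / μ * S.vx t p.1 p.2 ^ 2 := by positivity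
      have h4 : 0 ≤ s ^ 2 / μ * S.vy t p.1 p.2 ^ 2 := by positivity
      simp only [mul_add]
      linarith
  rw [integral_const_mul, integral_add (integrableOn_unitSq (by fun_prop))
    (integrableOn_unitSq (by fun_prop)), integral_const_mul, integral_const_mul] at h
  rw [mul_div_right_comm]
  exact h

end Sol

end

section

/-- A `C¹` cutoff function supported in `[1/16,15/16]`. -/
def window (z : ℝ) : ℝ := step (16 * z - 1) * step (15 - 16 * z)

/-- The derivative of `window`. -/
def dwindow (z : ℝ) : ℝ :=
  bump (16 * z - 1) * 16 * step (15 - 16 * z) + step (16 * z - 1) * (bump (15 - 16 * z) * -16)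

lemma hasDerivAt_window (z : ℝ) : HasDerivAt window (dwindow z) z := by
  have h1 : HasDerivAt (fun z : ℝ => 16 * z - 1) 16 z := by
    simpa using ((hasDerivAt_id z).const_mul 16).sub_const 1
  have h2 : HasDerivAt (fun z : ℝ => 15 - 16 * z) (-16) z := by
    simpa using ((hasDerivAt_id z).const_mul 16).const_sub 15
  exact ((hasDerivAt_step _).comp z h1).mul ((hasDerivAt_step _).comp z h2)

lemma window_nonneg (z : ℝ) : 0 ≤ window z := mul_nonneg (step_nonneg _) (step_nonneg _)

lemma window_le_one (z : ℝ) : window z ≤ 1 :=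
  mul_le_one₀ (step_le_one _) (step_nonneg _) (step_le_one _)

lemma window_eq_one {z : ℝ} (h1 : 1 / 8 ≤ z) (h2 : z ≤ 7 / 8) : window z = 1 := by
  rw [window, step_of_ge (by linarith), step_of_ge (by linarith), mul_one]

lemma window_supp {z : ℝ} (h : window z ≠ 0 ∨ dwindow z ≠ 0) : 1 / 16 < z ∧ z < 15 / 16 := by
  constructor <;> by_contra! hz
  · have h1 : 16 * z - 1 ≤ 0 := by linarith
    simp [window, dwindow, step_of_le h1, bump_of_le h1] at h
  · have h1 : 15 - 16 * z ≤ 0 := by linarith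
    simp [window, dwindow, step_of_le h1, bump_of_le h1] at h

lemma abs_dwindow_le (z : ℝ) : |dwindow z| ≤ 48 := by
  have h1 := bump_nonneg (16 * z - 1)
  have h2 := bump_le (16 * z - 1)
  have h3 := bump_nonneg (15 - 16 * z)
  have h4 := bump_le (15 - 16 * z)
  have h5 := step_nonneg (16 * z - 1)
  have h6 := step_le_one (16 * z - 1)
  have h7 := step_nonneg (15 - 16 * z)
  have h8 := step_le_one (15 - 16 * z)
  have h9 : bump (16 * z - 1) * step (15 - 16 * z) ≤ 3 / 2 * 1 := by gcongr
  have h10 : step (16 * z - 1) * bump (15 - 16 * z) ≤ 1 * (3 / 2) := by gcongr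
  have h11 := mul_nonneg h1 h7
  have h12 := mul_nonneg h5 h3
  unfold dwindow
  rw [abs_le]
  constructor <;> linarith

lemma continuous_dwindow : Continuous dwindow := by
  have := continuous_bump
  have := contDiff_step.continuous
  unfold dwindow
  fun_prop

lemma hasDerivAt_window_cell (n k : ℕ) (x : ℝ) :
    HasDerivAt (fun x => window (x / scale n - k)) (dwindow (x / scale n - k) / scale n) x := by
  have h : HasDerivAt (fun x : ℝ => x / scale n - k) (1 / scale n) x :=
    ((hasDerivAt_id x).div_const _).sub_const _
  exact ((hasDerivAt_window _).comp x h).congr_deriv (by ring)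

lemma window_cell_supp {n k : ℕ} {x : ℝ}
    (h : window (x / scale n - k) ≠ 0 ∨ dwindow (x / scale n - k) ≠ 0) :
    k * scale n < x ∧ x < k * scale n + len n := by
  obtain ⟨h1, h2⟩ := window_supp h
  have ht := scale_pos n
  have h3 : (k : ℝ) < x / scale n := by linarith
  have h4 : x / scale n < k + 15 / 16 := by linarith
  rw [lt_div_iff₀ ht] at h3
  rw [div_lt_iff₀ ht] at h4
  refine ⟨h3, h4.trans_le ?_⟩
  have := ratio_le n
  unfold len
  nlinarith

lemma window_cell_unique {n k l : ℕ} {x : ℝ}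
    (h : window (x / scale n - k) ≠ 0 ∨ dwindow (x / scale n - k) ≠ 0)
    (h' : window (x / scale n - l) ≠ 0 ∨ dwindow (x / scale n - l) ≠ 0) : k = l := by
  have h1 := window_cell_supp h
  have h2 := window_cell_supp h'
  have := len_le_scale n
  exact cell_unique (scale_pos n) h1.1 (by linarith [h1.2]) h2.1 (by linarith [h2.2])

/-- A cutoff function supported inside the cells of generation `n`. -/
def cutoff (n : ℕ) (x : ℝ) : ℝ := ∑ k ∈ cells n, window (x / scale n - k)

/-- The derivative of `cutoff n`. -/
def dcutoff (n : ℕ) (x : ℝ) : ℝ := ∑ k ∈ cells n, dwindow (x / scale n - k) / scale n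

lemma hasDerivAt_cutoff (n : ℕ) (x : ℝ) : HasDerivAt (cutoff n) (dcutoff n x) x :=
  HasDerivAt.fun_sum fun k _ => hasDerivAt_window_cell n k x

@[fun_prop]
lemma continuous_cutoff (n : ℕ) : Continuous (cutoff n) :=
  continuous_iff_continuousAt.2 fun x => (hasDerivAt_cutoff n x).continuousAt

@[fun_prop]
lemma continuous_dcutoff (n : ℕ) : Continuous (dcutoff n) := by
  have := continuous_dwindow
  unfold dcutoff
  fun_prop

lemma cutoff_nonneg (n : ℕ) (x : ℝ) : 0 ≤ cutoff n x :=
  Finset.sum_nonneg fun _ _ => window_nonneg _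

lemma cutoff_le_one (n : ℕ) (x : ℝ) : cutoff n x ≤ 1 :=
  sum_le_of_unique zero_le_one (fun _ _ => window_le_one _)
    fun _ _ _ _ h h' => window_cell_unique (.inl h) (.inl h')

lemma abs_dcutoff_le (n : ℕ) (x : ℝ) : |dcutoff n x| ≤ 48 / scale n := by
  have ht := scale_pos n
  refine abs_sum_le_of_unique (by positivity) (fun k _ => ?_)
    fun k _ l _ h h' => window_cell_unique (.inr (div_ne_zero_iff.1 h).1)
      (.inr (div_ne_zero_iff.1 h').1)
  rw [abs_div, abs_of_pos ht]
  gcongr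
  exact abs_dwindow_le _

lemma window_cell_zero (n k : ℕ) : window ((0 : ℝ) / scale n - k) = 0 := by
  by_contra h
  have := (window_cell_supp (.inl h)).1
  have := scale_pos n
  exact absurd ‹(k : ℝ) * scale n < 0› (not_lt.2 (by positivity))

lemma window_cell_one {n k : ℕ} (hk : k ∈ cells n) : window ((1 : ℝ) / scale n - k) = 0 := by
  by_contra h
  have := (window_cell_supp (.inl h)).2
  have := cells_le_one hk
  have := len_le_scale n
  linarith

lemma cutoff_zero (n : ℕ) : cutoff n 0 = 0 := Finset.sum_eq_zero fun k _ => window_cell_zero n k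

lemma cutoff_one (n : ℕ) : cutoff n 1 = 0 := Finset.sum_eq_zero fun _ hk => window_cell_one hk

lemma mem_kept_of_cutoff_ne_zero {n : ℕ} {x : ℝ} (h : cutoff n x ≠ 0) : x ∈ kept (n + 1) := by
  obtain ⟨k, hk, hne⟩ := Finset.exists_ne_zero_of_sum_ne_zero h
  have := window_cell_supp (.inl hne)
  exact mem_kept_succ_of hk this.1.le this.2.le

/-- A primitive of `dens A * cutoff n` up to `primErr A n`. -/
def prim (A : ℕ → ℝ) (n : ℕ) (y : ℝ) : ℝ :=
  ∑ k ∈ cells n, (cdf A y - cdf A (k * scale n)) * window (y / scale n - k)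

/-- The error in the derivative of `prim A n`. -/
def primErr (A : ℕ → ℝ) (n : ℕ) (y : ℝ) : ℝ :=
  ∑ k ∈ cells n, (cdf A y - cdf A (k * scale n)) * (dwindow (y / scale n - k) / scale n)

section prim
variable {A : ℕ → ℝ}

lemma Incr.hasDerivAt_prim (hA : Incr A) (n : ℕ) (y : ℝ) :
    HasDerivAt (prim A n) (dens A y * cutoff n y + primErr A n y) y := by
  refine (HasDerivAt.fun_sum fun k _ => ((hA.hasDerivAt_cdf y).sub_const _).mul
    (hasDerivAt_window_cell n k y)).congr_deriv ?_
  rw [Finset.sum_add_distrib, cutoff, Finset.mul_sum, primErr]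

lemma Incr.continuous_prim (hA : Incr A) (n : ℕ) : Continuous (prim A n) :=
  continuous_iff_continuousAt.2 fun x => (hA.hasDerivAt_prim n x).continuousAt

lemma Incr.continuous_primErr (hA : Incr A) (n : ℕ) : Continuous (primErr A n) := by
  have := continuous_dwindow
  have := hA.contDiff_cdf.continuous
  unfold primErr
  fun_prop

lemma prim_zero (n : ℕ) : prim A n 0 = 0 :=
  Finset.sum_eq_zero fun k _ => by rw [window_cell_zero, mul_zero]

lemma prim_one (n : ℕ) : prim A n 1 = 0 :=
  Finset.sum_eq_zero fun k hk => by rw [window_cell_one hk, mul_zero]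

lemma Incr.abs_cdf_sub_le (hA : Incr A) {n k : ℕ} (hk : k ∈ cells n) {y : ℝ}
    (h1 : k * scale n ≤ y) (h2 : y ≤ k * scale n + len n) :
    |cdf A y - cdf A (k * scale n)| ≤ num n * A (n + 1) := by
  have h3 := hA.monotone_cdf h1
  have h4 := hA.monotone_cdf h2
  rw [hA.cdf_len hk] at h4
  rw [abs_of_nonneg (by linarith)]
  linarith

lemma Incr.abs_prim_le (hA : Incr A) (n : ℕ) (y : ℝ) : |prim A n y| ≤ num n * A (n + 1) := by
  have h0 : 0 ≤ num n * A (n + 1) := mul_nonneg (Nat.cast_nonneg _) (hA.pos _).le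
  refine abs_sum_le_of_unique h0 (fun k hk => ?_) fun k _ l _ h h' =>
    window_cell_unique (.inl (right_ne_zero_of_mul h)) (.inl (right_ne_zero_of_mul h'))
  by_cases hw : window (y / scale n - k) = 0
  · rw [hw, mul_zero, abs_zero]; exact h0
  · have hs := window_cell_supp (.inl hw)
    rw [abs_mul, abs_of_nonneg (window_nonneg _)]
    exact (mul_le_of_le_one_right (abs_nonneg _) (window_le_one _)).trans
      (hA.abs_cdf_sub_le hk hs.1.le hs.2.le)

lemma Incr.abs_primErr_le (hA : Incr A) (n : ℕ) (y : ℝ) :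
    |primErr A n y| ≤ num n * A (n + 1) * (48 / scale n) := by
  have ht := scale_pos n
  have h0 : 0 ≤ num n * A (n + 1) := mul_nonneg (Nat.cast_nonneg _) (hA.pos _).le
  refine abs_sum_le_of_unique (by positivity) (fun k hk => ?_) fun k _ l _ h h' =>
    window_cell_unique (.inr (div_ne_zero_iff.1 (right_ne_zero_of_mul h)).1)
      (.inr (div_ne_zero_iff.1 (right_ne_zero_of_mul h')).1)
  by_cases hw : dwindow (y / scale n - k) = 0
  · rw [hw, zero_div, mul_zero, abs_zero]; positivity
  · have hs := window_cell_supp (.inr hw)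
    rw [abs_mul, abs_div, abs_of_pos ht]
    exact mul_le_mul (hA.abs_cdf_sub_le hk hs.1.le hs.2.le)
      (by gcongr; exact abs_dwindow_le _) (by positivity) h0

end prim

lemma rise_bounds (n : ℕ) : num n * incX (n + 1) ≤ 2 * scale n ^ 2
    ∧ num n * incY (n + 1) ≤ 2 * scale n ^ 2 := by
  rw [num_mul_incX, num_mul_incY]
  refine ⟨riseX_le n, (riseY_le n).trans ?_⟩
  have := scale_succ_le n
  have := scale_pos n
  have := scale_pos (n + 1)
  nlinarith

/-- The product cutoff as a test function. -/
def frozen (n : ℕ) : TestFun where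
  φ x y := cutoff n x * cutoff n y
  φx x y := dcutoff n x * cutoff n y
  φy x y := cutoff n x * dcutoff n y
  hasDerivAt_left x y := (hasDerivAt_cutoff n x).mul_const _
  hasDerivAt_right x y := (hasDerivAt_cutoff n y).const_mul _
  cont := by fun_prop
  cont_left := by fun_prop
  cont_right := by fun_prop
  per_left y _ := by rw [cutoff_zero, cutoff_one]
  per_right x _ := by rw [cutoff_zero, cutoff_one]

lemma two_mul_mul_le {a b c s M : ℝ} (h : |c| ≤ M) (hs : s = 1 ∨ s = -1) :
    s * (2 * a * b * c) ≤ 2 * M * (|a| * |b|) := by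
  have h1 : |s| = 1 := by rcases hs with rfl | rfl <;> simp
  calc s * (2 * a * b * c) ≤ |s * (2 * a * b * c)| := le_abs_self _
    _ = |c| * (2 * (|a| * |b|)) := by
      rw [abs_mul, abs_mul, abs_mul, abs_mul, h1, abs_two]; ring
    _ ≤ M * (2 * (|a| * |b|)) := by gcongr
    _ = _ := by ring

namespace Sol
variable {κ Λ : ℝ} {init : ℝ → ℝ} (S : Sol κ Λ init) {t : ℝ}

lemma continuous_mixed (ht : t ∈ Set.Ioc (0 : ℝ) 1) : Continuous fun p : ℝ × ℝ =>
    |S.v t p.1 p.2| * (|S.vx t p.1 p.2| + |S.vy t p.1 p.2|) := by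
  have cv := S.cont_slice (Set.Ioc_subset_Icc_self ht)
  have cx := S.cont_x t ht
  have cy := S.cont_y t ht
  fun_prop

lemma integral_le_mixed (ht : t ∈ Set.Ioc (0 : ℝ) 1) {F : ℝ × ℝ → ℝ} (hF : Continuous F) {M : ℝ}
    (h : ∀ p ∈ unitSq,
      F p ≤ M * (|S.v t p.1 p.2| * (|S.vx t p.1 p.2| + |S.vy t p.1 p.2|))) :
    ∫ p in unitSq, F p ≤ M * S.mixed t := by
  rw [mixed, ← integral_const_mul]
  exact integral_unitSq_mono hF (continuous_const.mul (S.continuous_mixed ht)) h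

lemma frozen_left_le (ht : t ∈ Set.Ioc (0 : ℝ) 1) (n : ℕ) :
    ∫ p in unitSq, S.v t p.1 p.2 ^ 2 * (dens incY p.2 * (dcutoff n p.1 * cutoff n p.2))
      ≤ 192 * scale n * S.mixed t := by
  have cv := S.cont_slice (Set.Ioc_subset_Icc_self ht)
  have cx := S.cont_x t ht
  have cy := S.cont_y t ht
  have c1 := incr_incY.continuous_prim n
  have c2 := incr_incY.continuous_primErr n
  have hp := scale_pos n
  have hY := integral_deriv_right
    (c := fun x y => S.v t x y ^ 2 * (dcutoff n x * prim incY n y))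
    (cy := fun x y => 2 * S.v t x y * S.vy t x y * (dcutoff n x * prim incY n y)
      + S.v t x y ^ 2 * (dcutoff n x * (dens incY y * cutoff n y + primErr incY n y)))
    (fun x y => by
      refine (((S.hasDerivAt_y t ht x y).pow 2).mul
        ((incr_incY.hasDerivAt_prim n y).const_mul (dcutoff n x))).congr_deriv ?_
      simp)
    (by fun_prop) (fun x _ => by rw [prim_zero, prim_one]; ring)
  have hX := integral_deriv_left
    (c := fun x y => -(S.v t x y ^ 2 * (cutoff n x * primErr incY n y)))
    (cx := fun x y => -(2 * S.v t x y * S.vx t x y * (cutoff n x * primErr incY n y)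
      + S.v t x y ^ 2 * (dcutoff n x * primErr incY n y)))
    (fun x y => by
      refine (((S.hasDerivAt_x t ht x y).pow 2).mul
        ((hasDerivAt_cutoff n x).mul_const (primErr incY n y))).neg.congr_deriv ?_
      simp)
    (by fun_prop) (fun x _ => by rw [cutoff_zero, cutoff_one]; ring)
  rw [integral_eq_of_add (G := fun p =>
    -1 * (2 * S.v t p.1 p.2 * S.vy t p.1 p.2 * (dcutoff n p.1 * prim incY n p.2))
    + 1 * (2 * S.v t p.1 p.2 * S.vx t p.1 p.2 * (cutoff n p.1 * primErr incY n p.2)))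
    (by fun_prop) (by fun_prop) (by fun_prop) hX hY fun p _ => by ring]
  refine S.integral_le_mixed ht (by fun_prop) fun p _ => ?_
  have hr := (rise_bounds n).2
  have b1 : |dcutoff n p.1 * prim incY n p.2| ≤ 96 * scale n := by
    rw [abs_mul]
    calc _ ≤ 48 / scale n * (2 * scale n ^ 2) := mul_le_mul (abs_dcutoff_le n _)
          ((incr_incY.abs_prim_le n _).trans hr) (abs_nonneg _) (by positivity)
      _ = _ := by field_simp; ring
  have b2 : |cutoff n p.1 * primErr incY n p.2| ≤ 96 * scale n := by
    rw [abs_mul, abs_of_nonneg (cutoff_nonneg n _)]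
    calc _ ≤ 1 * (2 * scale n ^ 2 * (48 / scale n)) := mul_le_mul (cutoff_le_one n _)
          ((incr_incY.abs_primErr_le n _).trans (by gcongr)) (abs_nonneg _) zero_le_one
      _ = _ := by field_simp; ring
  have h1 := two_mul_mul_le (a := S.v t p.1 p.2) (b := S.vy t p.1 p.2) b1 (.inr rfl)
  have h2 := two_mul_mul_le (a := S.v t p.1 p.2) (b := S.vx t p.1 p.2) b2 (.inl rfl)
  linarith

lemma frozen_right_le (ht : t ∈ Set.Ioc (0 : ℝ) 1) (n : ℕ) :
    ∫ p in unitSq, S.v t p.1 p.2 ^ 2 * (dens incX p.1 * (cutoff n p.1 * dcutoff n p.2))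
      ≤ 192 * scale n * S.mixed t := by
  have cv := S.cont_slice (Set.Ioc_subset_Icc_self ht)
  have cx := S.cont_x t ht
  have cy := S.cont_y t ht
  have c1 := incr_incX.continuous_prim n
  have c2 := incr_incX.continuous_primErr n
  have hp := scale_pos n
  have hX := integral_deriv_left
    (c := fun x y => S.v t x y ^ 2 * (prim incX n x * dcutoff n y))
    (cx := fun x y => 2 * S.v t x y * S.vx t x y * (prim incX n x * dcutoff n y)
      + S.v t x y ^ 2 * ((dens incX x * cutoff n x + primErr incX n x) * dcutoff n y))
    (fun x y => by
      refine (((S.hasDerivAt_x t ht x y).pow 2).mul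
        ((incr_incX.hasDerivAt_prim n x).mul_const (dcutoff n y))).congr_deriv ?_
      simp)
    (by fun_prop) (fun x _ => by rw [prim_zero, prim_one]; ring)
  have hY := integral_deriv_right
    (c := fun x y => -(S.v t x y ^ 2 * (primErr incX n x * cutoff n y)))
    (cy := fun x y => -(2 * S.v t x y * S.vy t x y * (primErr incX n x * cutoff n y)
      + S.v t x y ^ 2 * (primErr incX n x * dcutoff n y)))
    (fun x y => by
      refine (((S.hasDerivAt_y t ht x y).pow 2).mul
        ((hasDerivAt_cutoff n y).const_mul (primErr incX n x))).neg.congr_deriv ?_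
      simp)
    (by fun_prop) (fun x _ => by rw [cutoff_zero, cutoff_one]; ring)
  rw [integral_eq_of_add (G := fun p =>
    -1 * (2 * S.v t p.1 p.2 * S.vx t p.1 p.2 * (prim incX n p.1 * dcutoff n p.2))
    + 1 * (2 * S.v t p.1 p.2 * S.vy t p.1 p.2 * (primErr incX n p.1 * cutoff n p.2)))
    (by fun_prop) (by fun_prop) (by fun_prop) hX hY fun p _ => by ring]
  refine S.integral_le_mixed ht (by fun_prop) fun p _ => ?_
  have hr := (rise_bounds n).1
  have b1 : |prim incX n p.1 * dcutoff n p.2| ≤ 96 * scale n := by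
    rw [abs_mul]
    calc _ ≤ 2 * scale n ^ 2 * (48 / scale n) := mul_le_mul
          ((incr_incX.abs_prim_le n _).trans hr) (abs_dcutoff_le n _) (abs_nonneg _)
          (by positivity)
      _ = _ := by field_simp; ring
  have b2 : |primErr incX n p.1 * cutoff n p.2| ≤ 96 * scale n := by
    rw [abs_mul, abs_of_nonneg (cutoff_nonneg n p.2)]
    calc _ ≤ 2 * scale n ^ 2 * (48 / scale n) * 1 := mul_le_mul
          ((incr_incX.abs_primErr_le n _).trans (by gcongr)) (cutoff_le_one n _)
          (cutoff_nonneg n _) (by positivity)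
      _ = _ := by field_simp; ring
  have h1 := two_mul_mul_le (a := S.v t p.1 p.2) (b := S.vx t p.1 p.2) b1 (.inr rfl)
  have h2 := two_mul_mul_le (a := S.v t p.1 p.2) (b := S.vy t p.1 p.2) b2 (.inl rfl)
  linarith

end Sol

end

section

namespace Sol
variable {κ Λ : ℝ} {init : ℝ → ℝ} (S : Sol κ Λ init) {t : ℝ}

lemma mixed_nonneg (t : ℝ) : 0 ≤ S.mixed t := integral_nonneg fun _ => by positivity

/-- Integration in time of a differential inequality for a pairing. -/
lemma pairing_le_of_deriv_le (T : TestFun) {a b : ℝ}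
    (h : ∀ t ∈ Set.Ioo (0 : ℝ) 1,
      ∫ p in unitSq, T.φ p.1 p.2 * (2 * S.v t p.1 p.2 * S.vt t p.1 p.2)
        ≤ b + a * (2 * κ * S.dissip t)) (ht : t ∈ Set.Icc (0 : ℝ) 1) :
    S.pairing T t ≤ S.pairing T 0 + b * t + a * (S.energy 0 - S.energy t) := by
  have hd : ∀ s ∈ Set.Ioo (0 : ℝ) 1, HasDerivAt
      (fun s => S.pairing T s + a * S.energy s - b * s)
      ((∫ p in unitSq, T.φ p.1 p.2 * (2 * S.v s p.1 p.2 * S.vt s p.1 p.2))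
        + a * (-(2 * κ * S.dissip s)) - b * 1) s := fun s hs =>
    ((S.hasDerivAt_pairing T hs).add ((S.hasDerivAt_energy hs).const_mul a)).sub
      ((hasDerivAt_id s).const_mul b)
  have hanti : AntitoneOn (fun s => S.pairing T s + a * S.energy s - b * s)
      (Set.Icc (0 : ℝ) 1) := by
    refine antitoneOn_of_deriv_nonpos (convex_Icc 0 1) (((S.continuousOn_pairing T).add
      (continuousOn_const.mul S.continuousOn_energy)).sub (by fun_prop)) ?_ ?_ <;>
      rw [interior_Icc]
    · exact fun s hs => (hd s hs).differentiableAt.differentiableWithinAt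
    · intro s hs
      rw [(hd s hs).deriv]
      linarith [h s hs]
  have := hanti ⟨le_rfl, zero_le_one⟩ ht ht.1
  simp only [mul_zero, sub_zero] at this
  linarith

lemma frozen_initial (n : ℕ) (hinit : ∀ x ∈ kept 1, init x = 0) : S.pairing (frozen n) 0 = 0 := by
  refine setIntegral_eq_zero_of_forall_eq_zero fun p _ => ?_
  simp only [S.initial, frozen]
  by_cases h : cutoff n p.1 = 0
  · rw [h]; ring
  · rw [hinit _ (kept_antitone (Nat.le_add_left 1 n) (mem_kept_of_cutoff_ne_zero h))]; ring

lemma frozen_deriv_le (n : ℕ) (hκ : κ = scale n ^ 2) (hΛ : 0 ≤ Λ) (ht : t ∈ Set.Ioc (0 : ℝ) 1) :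
    ∫ p in unitSq, (frozen n).φ p.1 p.2 * (2 * S.v t p.1 p.2 * S.vt t p.1 p.2)
      ≤ (384 * Λ + 96) * (scale n * S.mixed t) := by
  have cv := S.cont_slice (Set.Ioc_subset_Icc_self ht)
  have cx := S.cont_x t ht
  have cy := S.cont_y t ht
  have hp := scale_pos n
  rw [S.integral_test ht]
  have h1 := S.frozen_left_le ht n
  have h2 := S.frozen_right_le ht n
  have h3 := S.integral_le_mixed (M := 96 * scale n) ht (F := fun p =>
    -(2 * κ * (S.v t p.1 p.2 * (S.vx t p.1 p.2 * (dcutoff n p.1 * cutoff n p.2)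
      + S.vy t p.1 p.2 * (cutoff n p.1 * dcutoff n p.2))))) (by fun_prop) fun p _ => by
    have b1 : |dcutoff n p.1 * cutoff n p.2| ≤ 48 / scale n := by
      rw [abs_mul, abs_of_nonneg (cutoff_nonneg n _)]
      exact (mul_le_of_le_one_right (abs_nonneg _) (cutoff_le_one n _)).trans (abs_dcutoff_le n _)
    have b2 : |cutoff n p.1 * dcutoff n p.2| ≤ 48 / scale n := by
      rw [abs_mul, abs_of_nonneg (cutoff_nonneg n _)]
      exact (mul_le_of_le_one_left (abs_nonneg _) (cutoff_le_one n _)).trans (abs_dcutoff_le n _)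
    have e1 := two_mul_mul_le (a := S.v t p.1 p.2) (b := S.vx t p.1 p.2) b1 (.inr rfl)
    have e2 := two_mul_mul_le (a := S.v t p.1 p.2) (b := S.vy t p.1 p.2) b2 (.inr rfl)
    have e3 : κ * (2 * (48 / scale n)) = 96 * scale n := by rw [hκ]; field_simp; ring
    rw [← e3]
    have e4 := mul_le_mul_of_nonneg_left (add_le_add e1 e2) (by positivity : 0 ≤ scale n ^ 2)
    rw [← hκ] at e4
    linarith
  have h4 : ∫ p in unitSq, (-(2 * κ) * ((frozen n).φ p.1 p.2 *
      (S.vx t p.1 p.2 ^ 2 + S.vy t p.1 p.2 ^ 2))) ≤ 0 := by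
    rw [integral_const_mul]
    have hκ0 : 0 ≤ κ := hκ ▸ sq_nonneg _
    have : 0 ≤ ∫ p in unitSq, ((frozen n).φ p.1 p.2 *
      (S.vx t p.1 p.2 ^ 2 + S.vy t p.1 p.2 ^ 2)) := integral_nonneg fun p =>
        mul_nonneg (mul_nonneg (cutoff_nonneg n _) (cutoff_nonneg n _)) (by positivity)
    nlinarith
  have hsplit : ∫ p in unitSq, (Λ * (S.v t p.1 p.2 ^ 2 * (dens incY p.2 * (frozen n).φx p.1 p.2
        + dens incX p.1 * (frozen n).φy p.1 p.2))
      - 2 * κ * ((frozen n).φ p.1 p.2 * (S.vx t p.1 p.2 ^ 2 + S.vy t p.1 p.2 ^ 2))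
      - 2 * κ * (S.v t p.1 p.2 * (S.vx t p.1 p.2 * (frozen n).φx p.1 p.2
        + S.vy t p.1 p.2 * (frozen n).φy p.1 p.2)))
      = Λ * (∫ p in unitSq, S.v t p.1 p.2 ^ 2 * (dens incY p.2 * (dcutoff n p.1 * cutoff n p.2)))
      + Λ * (∫ p in unitSq, S.v t p.1 p.2 ^ 2 * (dens incX p.1 * (cutoff n p.1 * dcutoff n p.2)))
      + (∫ p in unitSq, (-(2 * κ) * ((frozen n).φ p.1 p.2 *
        (S.vx t p.1 p.2 ^ 2 + S.vy t p.1 p.2 ^ 2))))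
      + ∫ p in unitSq, -(2 * κ * (S.v t p.1 p.2 * (S.vx t p.1 p.2 * (dcutoff n p.1 * cutoff n p.2)
      + S.vy t p.1 p.2 * (cutoff n p.1 * dcutoff n p.2)))) := by
    have hc := (frozen n).cont
    rw [← integral_const_mul, ← integral_const_mul, ← integral_add, ← integral_add,
      ← integral_add]
    · refine integral_congr_ae (.of_forall fun p => ?_)
      simp only [frozen]
      ring
    all_goals exact integrableOn_unitSq (by fun_prop)
  rw [hsplit]
  have := mul_le_mul_of_nonneg_left (add_le_add h1 h2) hΛ
  linarith

/-- Little energy reaches the scale `n` cells while little energy is dissipated. -/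
lemma frozen_le (n : ℕ) (hκ : κ = scale n ^ 2) (hΛ : 0 ≤ Λ) (hinit : ∀ x ∈ kept 1, init x = 0)
    {μ : ℝ} (hμ : 0 < μ) (ht : t ∈ Set.Icc (0 : ℝ) 1) :
    S.pairing (frozen n) t ≤ (384 * Λ + 96) * (μ * S.energy 0
      + (S.energy 0 - S.energy 1) / (2 * μ)) := by
  have hκ0 : 0 ≤ κ := hκ ▸ sq_nonneg _
  have hE := S.antitoneOn_energy hκ0
  have h := S.pairing_le_of_deriv_le (frozen n) (b := (384 * Λ + 96) * (μ * S.energy 0))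
    (a := (384 * Λ + 96) / (2 * μ)) (fun s hs => by
      have h1 := S.frozen_deriv_le n hκ hΛ ⟨hs.1, hs.2.le⟩
      have h2 := S.mul_mixed_le ⟨hs.1, hs.2.le⟩ (s := scale n) hμ
      have h3 := hE ⟨le_rfl, zero_le_one⟩ ⟨hs.1.le, hs.2.le⟩ hs.1.le
      have h4 : scale n * S.mixed s ≤ μ * S.energy 0 + κ * S.dissip s / μ := by
        rw [← hκ] at h2; exact h2.trans (by gcongr)
      refine h1.trans ((mul_le_mul_of_nonneg_left h4 (by positivity)).trans_eq ?_)
      field_simp) ht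
  rw [S.frozen_initial n hinit, zero_add] at h
  have h1 := hE ht ⟨zero_le_one, le_rfl⟩ ht.2
  have h0 := S.energy_nonneg 0
  have h5 : (384 * Λ + 96) * (μ * S.energy 0) * t ≤ (384 * Λ + 96) * (μ * S.energy 0) :=
    mul_le_of_le_one_right (by positivity) ht.2
  have h6 : (384 * Λ + 96) / (2 * μ) * (S.energy 0 - S.energy t)
      ≤ (384 * Λ + 96) / (2 * μ) * (S.energy 0 - S.energy 1) := by gcongr
  refine h.trans ((add_le_add h5 h6).trans_eq ?_)
  ring

end Sol

end

lemma setIntegral_biUnion_le (F : Finset ℕ) {s : ℕ → Set ℝ} {f : ℝ → ℝ} (hf : Continuous f)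
    (hf0 : ∀ x, 0 ≤ f x) (hs : ∀ k, IsCompact (s k)) :
    ∫ x in ⋃ k ∈ F, s k, f x ≤ ∑ k ∈ F, ∫ x in s k, f x := by
  induction F using Finset.induction_on with
  | empty => simp
  | insert k F hk ih =>
    have h1 : IntegrableOn f (s k) := hf.continuousOn.integrableOn_compact (hs k)
    have h2 : IntegrableOn f (⋃ k ∈ F, s k) :=
      hf.continuousOn.integrableOn_compact (F.isCompact_biUnion fun k _ => hs k)
    rw [Finset.set_biUnion_insert, Finset.sum_insert hk]
    refine (integral_mono_measure (Measure.restrict_union_le _ _) (.of_forall hf0)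
      (Integrable.add_measure h1 h2)).trans ?_
    rw [integral_add_measure h1 h2]
    linarith

lemma kept_eq_biUnion (n : ℕ) :
    kept n = ⋃ k ∈ cells n, Set.Icc (k * scale n) ((k + 1) * scale n) := by
  ext y; simp only [kept, Set.mem_ofPred_eq, Set.mem_iUnion, Set.mem_Icc, exists_prop]

lemma isCompact_kept (n : ℕ) : IsCompact (kept n) := by
  rw [kept_eq_biUnion]
  exact (cells n).isCompact_biUnion fun _ _ => isCompact_Icc

lemma abs_sub_le_integral_abs_deriv {φ φ' : ℝ → ℝ} (hd : ∀ x, HasDerivAt φ (φ' x) x)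
    (hφ' : Continuous φ') {a b x y : ℝ} (hx : x ∈ Set.Icc a b) (hy : y ∈ Set.Icc a b) :
    φ x - φ y ≤ ∫ z in Set.Ioc a b, |φ' z| := by
  rw [← intervalIntegral.integral_eq_sub_of_hasDerivAt (fun z _ => hd z)
    (hφ'.intervalIntegrable _ _)]
  refine (le_abs_self _).trans ((intervalIntegral.norm_integral_le_integral_norm_uIoc (f := φ')).trans ?_)
  refine setIntegral_mono_set ((hφ'.abs.continuousOn.integrableOn_Icc).mono_set
    Set.Ioc_subset_Icc_self) (.of_forall fun _ => abs_nonneg _) (LE.le.eventuallyLE ?_)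
  rw [Set.uIoc]
  exact Set.Ioc_subset_Ioc (le_min hy.1 hx.1) (max_le hy.2 hx.2)

lemma continuous_window_cell (n k : ℕ) : Continuous fun y : ℝ => window (y / scale n - k) :=
  continuous_iff_continuousAt.2 fun x => (hasDerivAt_window_cell n k x).continuousAt

lemma sup_cell_le {n k : ℕ} (hk : k ∈ cells n) {φ φ' : ℝ → ℝ} (hφ0 : ∀ x, 0 ≤ φ x)
    (hd : ∀ x, HasDerivAt φ (φ' x) x) (hφ' : Continuous φ') {x : ℝ}
    (hx : x ∈ Set.Icc (k * scale n) ((k + 1) * scale n)) :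
    φ x ≤ 2 / scale n * (∫ y in Set.Icc (0 : ℝ) 1, window (y / scale n - k) * φ y)
      + ∫ z in Set.Ioc (k * scale n) ((k + 1) * scale n), |φ' z| := by
  have ht := scale_pos n
  have hc : Continuous φ := continuous_iff_continuousAt.2 fun x => (hd x).continuousAt
  have hw := continuous_window_cell n k
  set I := ∫ z in Set.Ioc (k * scale n) ((k + 1) * scale n), |φ' z| with hI
  set J := Set.Icc (k * scale n + scale n / 8) (k * scale n + 5 * scale n / 8) with hJ
  have hkt : 0 ≤ k * scale n := by positivity
  have hJI : J ⊆ Set.Icc 0 1 := Set.Icc_subset_Icc (by linarith) (by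
    have := cells_le_one hk
    linarith)
  have h1 : ∫ y in J, (φ x - I) ≤ ∫ y in J, window (y / scale n - k) * φ y := by
    refine setIntegral_mono_on (continuous_const.continuousOn.integrableOn_Icc)
      ((hw.mul hc).continuousOn.integrableOn_Icc) measurableSet_Icc fun y hy => ?_
    have e : k * scale n / scale n = k := by field_simp
    rw [window_eq_one, one_mul]
    · have := abs_sub_le_integral_abs_deriv hd hφ' hx
        (y := y) ⟨by linarith [hy.1], by linarith [hy.2]⟩
      linarith
    · have := (div_le_div_iff_of_pos_right ht).2 hy.1
      rw [add_div, e] at this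
      have e' : scale n / 8 / scale n = 1 / 8 := by field_simp
      linarith
    · have := (div_le_div_iff_of_pos_right ht).2 hy.2
      rw [add_div, e] at this
      have e' : 5 * scale n / 8 / scale n = 5 / 8 := by field_simp
      linarith
  have h2 : ∫ y in J, window (y / scale n - k) * φ y
      ≤ ∫ y in Set.Icc (0 : ℝ) 1, window (y / scale n - k) * φ y :=
    setIntegral_mono_set ((hw.mul hc).continuousOn.integrableOn_Icc)
      (.of_forall fun y => mul_nonneg (window_nonneg _) (hφ0 y))
      (LE.le.eventuallyLE hJI)
  rw [setIntegral_const, hJ, Real.volume_real_Icc_of_le (by linarith), smul_eq_mul] at h1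
  have h3 := h1.trans h2
  have h4 : (2 / scale n) * ((k * scale n + 5 * scale n / 8 - (k * scale n + scale n / 8))
      * (φ x - I)) = φ x - I := by field_simp; ring
  have h5 := mul_le_mul_of_nonneg_left h3 (by positivity : 0 ≤ 2 / scale n)
  rw [h4] at h5
  linarith

/-- Integrals over the kept set are controlled by averages over the windows and the variation. -/
lemma setIntegral_kept_le (n : ℕ) {w φ φ' : ℝ → ℝ} {a : ℝ} (hw : Continuous w)
    (hw0 : ∀ y, 0 ≤ w y)
    (ha : ∀ k ∈ cells n, ∫ y in Set.Icc (k * scale n) ((k + 1) * scale n), w y ≤ a)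
    (ha0 : 0 ≤ a) (hφ0 : ∀ x, 0 ≤ φ x) (hd : ∀ x, HasDerivAt φ (φ' x) x)
    (hφ' : Continuous φ') :
    ∫ y in kept n, w y * φ y
      ≤ ∫ y in Set.Icc (0 : ℝ) 1, a * (2 / scale n * (cutoff n y * φ y) + |φ' y|) := by
  have ht := scale_pos n
  have hc : Continuous φ := continuous_iff_continuousAt.2 fun x => (hd x).continuousAt
  rw [kept_eq_biUnion]
  refine (setIntegral_biUnion_le _ (hw.mul hc) (fun y => mul_nonneg (hw0 y) (hφ0 y))
    fun _ => isCompact_Icc).trans ?_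
  have hcell : ∀ k ∈ cells n, ∫ y in Set.Icc (k * scale n) ((k + 1) * scale n), w y * φ y
      ≤ a * (2 / scale n * (∫ y in Set.Icc (0 : ℝ) 1, window (y / scale n - k) * φ y)
        + ∫ z in Set.Ioc (k * scale n) ((k + 1) * scale n), |φ' z|) := fun k hk => by
    set M := 2 / scale n * (∫ y in Set.Icc (0 : ℝ) 1, window (y / scale n - k) * φ y)
        + ∫ z in Set.Ioc (k * scale n) ((k + 1) * scale n), |φ' z| with hM
    have hM0 : 0 ≤ M := add_nonneg (mul_nonneg (by positivity) (integral_nonneg fun y =>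
      mul_nonneg (window_nonneg _) (hφ0 y))) (integral_nonneg fun _ => abs_nonneg _)
    calc _ ≤ ∫ y in Set.Icc (k * scale n) ((k + 1) * scale n), w y * M :=
          setIntegral_mono_on (hw.mul hc).continuousOn.integrableOn_Icc
            (hw.mul continuous_const).continuousOn.integrableOn_Icc measurableSet_Icc
            fun y hy => mul_le_mul_of_nonneg_left (sup_cell_le hk hφ0 hd hφ' hy) (hw0 y)
      _ = (∫ y in Set.Icc (k * scale n) ((k + 1) * scale n), w y) * M := integral_mul_const _ _
      _ ≤ a * M := mul_le_mul_of_nonneg_right (ha k hk) hM0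
  refine (Finset.sum_le_sum hcell).trans ?_
  rw [← Finset.mul_sum, Finset.sum_add_distrib, ← Finset.mul_sum, ← integral_finsetSum,
    ← integral_biUnion_finset, integral_const_mul, integral_add, integral_const_mul]
  · simp only [cutoff, Finset.sum_mul]
    refine mul_le_mul_of_nonneg_left (add_le_add le_rfl ?_) ha0
    refine setIntegral_mono_set hφ'.abs.continuousOn.integrableOn_Icc
      (.of_forall fun _ => abs_nonneg _) (LE.le.eventuallyLE ?_)
    refine Set.iUnion₂_subset fun k hk => Set.Ioc_subset_Icc_self.trans
      (Set.Icc_subset_Icc (by positivity) (cells_le_one hk))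
  · exact ((continuous_cutoff n).mul hc |>.const_mul _).continuousOn.integrableOn_Icc
  · exact hφ'.abs.continuousOn.integrableOn_Icc
  · exact fun k _ => measurableSet_Ioc
  · intro k _ l _ hkl
    refine Set.disjoint_left.2 fun z hz hz' => hkl ?_
    by_contra hne
    rcases Nat.lt_or_gt_of_ne hne with h | h
    · have : ((k : ℝ) + 1) * scale n ≤ l * scale n := by gcongr; exact_mod_cast h
      linarith [hz.2, hz'.1]
    · have : ((l : ℝ) + 1) * scale n ≤ k * scale n := by gcongr; exact_mod_cast h
      linarith [hz.1, hz'.2]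
  · exact fun k _ => hφ'.abs.continuousOn.integrableOn_Icc.mono_set Set.Ioc_subset_Icc_self
  · exact fun k _ => ((continuous_window_cell n k).mul hc).continuousOn.integrableOn_Icc

section

section prod
variable {F H : ℝ × ℝ → ℝ} {A A' B : Set ℝ}

lemma integrable_prod_of_isCompact (hF : Continuous F) (hA : IsCompact A) (hB : IsCompact B) :
    Integrable F ((volume.restrict A).prod (volume.restrict B)) := by
  rw [Measure.prod_restrict, ← Measure.volume_eq_prod]
  exact hF.continuousOn.integrableOn_compact (hA.prod hB)

lemma setIntegral_prod_le_left (hF : Continuous F) (hH : Continuous H) (hA : IsCompact A)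
    (hA' : IsCompact A') (hB : IsCompact B)
    (h : ∀ y ∈ B, ∫ x in A, F (x, y) ≤ ∫ x in A', H (x, y)) :
    ∫ p in A ×ˢ B, F p ≤ ∫ p in A' ×ˢ B, H p := by
  rw [setIntegral_prod_swap' (hF.continuousOn.integrableOn_compact (hA.prod hB)),
    setIntegral_prod_swap' (hH.continuousOn.integrableOn_compact (hA'.prod hB))]
  exact setIntegral_mono_on (integrable_prod_of_isCompact hF hA hB).integral_prod_right
    (integrable_prod_of_isCompact hH hA' hB).integral_prod_right hB.measurableSet h

lemma setIntegral_prod_le_right (hF : Continuous F) (hH : Continuous H) (hA : IsCompact A)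
    (hA' : IsCompact A') (hB : IsCompact B)
    (h : ∀ x ∈ B, ∫ y in A, F (x, y) ≤ ∫ y in A', H (x, y)) :
    ∫ p in B ×ˢ A, F p ≤ ∫ p in B ×ˢ A', H p := by
  have e1 := hF.continuousOn.integrableOn_compact (μ := volume) (hB.prod hA)
  have e2 := hH.continuousOn.integrableOn_compact (μ := volume) (hB.prod hA')
  rw [Measure.volume_eq_prod] at e1 e2 ⊢
  rw [setIntegral_prod _ e1, setIntegral_prod _ e2]
  exact setIntegral_mono_on (integrable_prod_of_isCompact hF hB hA).integral_prod_left
    (integrable_prod_of_isCompact hH hB hA').integral_prod_left hB.measurableSet h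

end prod

namespace Sol
variable {κ Λ : ℝ} {init : ℝ → ℝ} (S : Sol κ Λ init) {t : ℝ}

/-- The kept cells carry little weighted energy. -/
lemma setIntegral_kept_sq_le (ht : t ∈ Set.Ioc (0 : ℝ) 1) (n : ℕ) {W : ℝ → ℝ} {a : ℝ}
    (hW : Continuous W) (hW0 : ∀ y, 0 ≤ W y)
    (ha : ∀ k ∈ cells n, ∫ y in Set.Icc (k * scale n) ((k + 1) * scale n), W y ≤ a)
    (ha0 : 0 ≤ a) :
    ∫ p in kept n ×ˢ kept n, W p.1 * S.v t p.1 p.2 ^ 2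
      ≤ a * (4 / scale n * S.pairing (frozen n) t + 4 * S.mixed t) := by
  have hp := scale_pos n
  have cv := S.cont_slice (Set.Ioc_subset_Icc_self ht)
  have cx := S.cont_x t ht
  have cy := S.cont_y t ht
  have hK := isCompact_kept n
  have hI : IsCompact (Set.Icc (0 : ℝ) 1) := isCompact_Icc
  have c1 : Continuous fun p : ℝ × ℝ => cutoff n p.1 * S.v t p.1 p.2 ^ 2 := by fun_prop
  have c2 : Continuous fun p : ℝ × ℝ => |2 * S.v t p.1 p.2 * S.vx t p.1 p.2| := by fun_prop
  have c3 : Continuous fun p : ℝ × ℝ =>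
    cutoff n p.2 * (cutoff n p.1 * S.v t p.1 p.2 ^ 2) := by fun_prop
  have c4 : Continuous fun p : ℝ × ℝ =>
    |cutoff n p.1 * (2 * S.v t p.1 p.2 * S.vy t p.1 p.2)| := by fun_prop
  have h1 := setIntegral_prod_le_left (A := kept n) (A' := Set.Icc 0 1) (B := kept n)
    (F := fun p => W p.1 * S.v t p.1 p.2 ^ 2)
    (H := fun p => a * (2 / scale n * (cutoff n p.1 * S.v t p.1 p.2 ^ 2)
      + |2 * S.v t p.1 p.2 * S.vx t p.1 p.2|)) (by fun_prop)
    (((c1.const_mul _).add c2).const_mul _) hK hI hK fun y _ =>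
      setIntegral_kept_le n hW hW0 ha ha0 (φ := fun x => S.v t x y ^ 2) (fun x => sq_nonneg _)
        (fun x => ((S.hasDerivAt_x t ht x y).pow 2).congr_deriv (by simp)) (by fun_prop)
  have h2 := setIntegral_prod_le_right (A := kept n) (A' := Set.Icc 0 1) (B := Set.Icc 0 1)
    (F := fun p => 1 * (cutoff n p.1 * S.v t p.1 p.2 ^ 2))
    (H := fun p => scale n * (2 / scale n * (cutoff n p.2 * (cutoff n p.1 * S.v t p.1 p.2 ^ 2))
      + |cutoff n p.1 * (2 * S.v t p.1 p.2 * S.vy t p.1 p.2)|)) (by fun_prop)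
    (((c3.const_mul _).add c4).const_mul _) hK hI hI fun x _ =>
      setIntegral_kept_le n (w := fun _ => 1) continuous_const (fun _ => zero_le_one)
        (fun k _ => by
          rw [setIntegral_const, Real.volume_real_Icc_of_le (by nlinarith), smul_eq_mul]
          linarith)
        hp.le (φ := fun y => cutoff n x * S.v t x y ^ 2)
        (fun y => mul_nonneg (cutoff_nonneg n x) (sq_nonneg _))
        (fun y => (((S.hasDerivAt_y t ht x y).pow 2).const_mul _).congr_deriv (by simp))
        (by fun_prop)
  have i1 := c1.continuousOn.integrableOn_compact (μ := volume) (hI.prod hK)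
  have i2 := c2.continuousOn.integrableOn_compact (μ := volume) (hI.prod hK)
  rw [integral_const_mul, integral_add (i1.const_mul _) i2, integral_const_mul] at h1
  have hu : Set.Icc (0 : ℝ) 1 ×ˢ Set.Icc (0 : ℝ) 1 = unitSq := rfl
  simp only [one_mul, hu] at h2
  rw [integral_const_mul, integral_add ((integrableOn_unitSq c3).const_mul _)
    (integrableOn_unitSq c4), integral_const_mul] at h2
  have h3 : ∫ p in unitSq,
      cutoff n p.2 * (cutoff n p.1 * S.v t p.1 p.2 ^ 2) = S.pairing (frozen n) t :=
    integral_congr_ae (.of_forall fun p => by simp only [frozen]; ring)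
  have h4 : ∫ p in Set.Icc (0 : ℝ) 1 ×ˢ kept n, |2 * S.v t p.1 p.2 * S.vx t p.1 p.2|
      ≤ ∫ p in unitSq, |2 * S.v t p.1 p.2 * S.vx t p.1 p.2| :=
    setIntegral_mono_set (integrableOn_unitSq c2) (.of_forall fun _ => abs_nonneg _)
      (LE.le.eventuallyLE (Set.prod_mono_right (kept_subset_Icc n)))
  have h5 := S.integral_le_mixed (M := 4) ht (F := fun p =>
    2 * |cutoff n p.1 * (2 * S.v t p.1 p.2 * S.vy t p.1 p.2)|
      + |2 * S.v t p.1 p.2 * S.vx t p.1 p.2|) (by fun_prop) fun p _ => by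
    rw [abs_mul, abs_of_nonneg (cutoff_nonneg n _), abs_mul, abs_mul, abs_mul, abs_mul, abs_two]
    have e1 := mul_le_of_le_one_left (b := 2 * |S.v t p.1 p.2| * |S.vy t p.1 p.2|)
      (by positivity) (cutoff_le_one n p.1)
    have e2 : 0 ≤ |S.v t p.1 p.2| * |S.vx t p.1 p.2| := by positivity
    linarith
  rw [integral_add ((integrableOn_unitSq c4).const_mul _) (integrableOn_unitSq c2),
    integral_const_mul] at h5
  refine h1.trans (mul_le_mul_of_nonneg_left ?_ ha0)
  have h6 := mul_le_mul_of_nonneg_left h2 (by positivity : 0 ≤ 2 / scale n)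
  rw [h3] at h6
  have e : ∀ P Q : ℝ, 2 / scale n * (scale n * (2 / scale n * P + Q))
    = 4 / scale n * P + 2 * Q := fun P Q => by field_simp; ring
  rw [e] at h6
  linarith

end Sol

end

section

/-- The points of slow motion outside the kept cells of some scale. -/
def slow (δ : ℝ) : Set (ℝ × ℝ) :=
  {p ∈ unitSq | dens incY p.2 + dens incX p.1 ≤ δ} \ ⋂ n, kept n ×ˢ kept n

lemma measurableSet_slow (δ : ℝ) : MeasurableSet (slow δ) := by
  have hc : Continuous fun p : ℝ × ℝ => dens incY p.2 + dens incX p.1 := by fun_prop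
  exact (measurableSet_unitSq.inter (measurableSet_le hc.measurable measurable_const)).diff
    (.iInter fun n => ((isCompact_kept n).prod (isCompact_kept n)).measurableSet)

lemma slow_subset (δ : ℝ) : slow δ ⊆ unitSq := fun _ hp => hp.1.1

lemma volume_slow_ne_top (δ : ℝ) : (volume : Measure (ℝ × ℝ)) (slow δ) ≠ ⊤ :=
  ((measure_mono (slow_subset δ)).trans_lt isCompact_unitSq.measure_lt_top).ne

lemma volume_slow_zero : (volume : Measure (ℝ × ℝ)) (slow 0) = 0 := by
  set G : Set ℝ := Set.range fun ij : ℕ × ℕ => (ij.2 : ℝ) * scale ij.1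
  have hG : volume G = 0 := (Set.countable_range _).measure_zero _
  have h1 : (volume : Measure (ℝ × ℝ)) (G ×ˢ Set.univ ∪ Set.univ ×ˢ G) = 0 := by
    rw [measure_union_null_iff, Measure.volume_eq_prod, Measure.prod_prod, Measure.prod_prod, hG]
    simp
  refine measure_mono_null (fun p hp => ?_) h1
  by_contra hn
  simp only [Set.mem_union, Set.mem_prod, Set.mem_univ, and_true, true_and, not_or] at hn
  have a1 := incr_incX.dens_nonneg p.1
  have a2 := incr_incY.dens_nonneg p.2
  have a3 := hp.1.2
  refine hp.2 (Set.mem_iInter.2 fun n => ⟨?_, ?_⟩)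
  · exact incr_incX.mem_kept_of_dens_eq_zero hp.1.1.1 (by linarith)
      (fun i j h => hn.1 ⟨(i, j), h.symm⟩) n
  · exact incr_incY.mem_kept_of_dens_eq_zero hp.1.1.2 (by linarith)
      (fun i j h => hn.2 ⟨(i, j), h.symm⟩) n

lemma exists_volume_slow_le {ε : ℝ} (hε : 0 < ε) :
    ∃ δ, 0 < δ ∧ δ ≤ 1 ∧ (volume : Measure (ℝ × ℝ)).real (slow δ) ≤ ε := by
  have hanti : Antitone fun j : ℕ => slow (1 / ((j : ℝ) + 1)) := fun i j hij p hp =>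
    ⟨⟨hp.1.1, hp.1.2.trans (Nat.one_div_le_one_div hij)⟩, hp.2⟩
  have h := tendsto_measure_iInter_atTop (μ := (volume : Measure (ℝ × ℝ)))
    (fun j : ℕ => (measurableSet_slow (1 / ((j : ℝ) + 1))).nullMeasurableSet) hanti
    ⟨0, volume_slow_ne_top _⟩
  have h0 : (volume : Measure (ℝ × ℝ)) (⋂ j : ℕ, slow (1 / ((j : ℝ) + 1))) = 0 := by
    refine measure_mono_null (fun p hp => ?_) volume_slow_zero
    rw [Set.mem_iInter] at hp
    exact ⟨⟨(hp 0).1.1, ge_of_tendsto' tendsto_one_div_add_atTop_nhds_zero_nat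
      fun j => (hp j).1.2⟩, (hp 0).2⟩
  rw [h0] at h
  obtain ⟨j, hj⟩ := (h.eventually (ge_mem_nhds (ENNReal.ofReal_pos.2 hε))).exists
  exact ⟨1 / ((j : ℝ) + 1), Nat.one_div_pos_of_nat,
    (div_le_one (by positivity)).2 (by linarith [(Nat.cast_nonneg j : (0 : ℝ) ≤ j)]),
    ENNReal.toReal_le_of_le_ofReal hε.le hj⟩

namespace Sol
variable {κ Λ : ℝ} {init : ℝ → ℝ} (S : Sol κ Λ init) {t : ℝ}

lemma setIntegral_slow_le (ht : t ∈ Set.Icc (0 : ℝ) 1) (δ : ℝ) {η : ℝ} (hη : 0 < η) :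
    ∫ p in slow δ, S.v t p.1 p.2 ^ 2
      ≤ η * S.quartic t + (volume : Measure (ℝ × ℝ)).real (slow δ) / (4 * η) := by
  have cv := S.cont_slice ht
  have i4 : IntegrableOn (fun p : ℝ × ℝ => S.v t p.1 p.2 ^ 4) (slow δ) :=
    (integrableOn_unitSq (by fun_prop)).mono_set (slow_subset δ)
  have i2 : IntegrableOn (fun p : ℝ × ℝ => S.v t p.1 p.2 ^ 2) (slow δ) :=
    (integrableOn_unitSq (by fun_prop)).mono_set (slow_subset δ)
  have i0 : IntegrableOn (fun _ : ℝ × ℝ => 1 / (4 * η)) (slow δ) :=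
    (integrableOn_unitSq (by fun_prop)).mono_set (slow_subset δ)
  have h1 : ∫ p in slow δ, S.v t p.1 p.2 ^ 2
      ≤ ∫ p in slow δ, (η * S.v t p.1 p.2 ^ 4 + 1 / (4 * η)) := by
    refine setIntegral_mono i2 ((i4.const_mul η).add i0) fun p => ?_
    have : η * S.v t p.1 p.2 ^ 4 + 1 / (4 * η) - S.v t p.1 p.2 ^ 2
        = (2 * η * S.v t p.1 p.2 ^ 2 - 1) ^ 2 / (4 * η) := by field_simp; ring
    have : 0 ≤ (2 * η * S.v t p.1 p.2 ^ 2 - 1) ^ 2 / (4 * η) := by positivity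
    change S.v t p.1 p.2 ^ 2 ≤ _
    linarith
  have h2 : ∫ p in slow δ, S.v t p.1 p.2 ^ 4 ≤ S.quartic t :=
    setIntegral_mono_set (integrableOn_unitSq (by fun_prop)) (.of_forall fun p => by positivity)
      (LE.le.eventuallyLE (slow_subset δ))
  rw [integral_add (i4.const_mul η) i0, integral_const_mul, setIntegral_const, smul_eq_mul,
    mul_one_div] at h1
  linarith [mul_le_mul_of_nonneg_left h2 hη.le]

/-- Most of the energy sits where the flow is not slow. -/
lemma energy_le_flow (ht : t ∈ Set.Icc (0 : ℝ) 1) (n : ℕ) {δ : ℝ} (hδ : 0 ≤ δ) :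
    δ * S.energy t ≤ (∫ p in unitSq, (dens incY p.2 + dens incX p.1) * S.v t p.1 p.2 ^ 2)
      + δ * (∫ p in kept n ×ˢ kept n, S.v t p.1 p.2 ^ 2)
      + δ * ∫ p in slow δ, S.v t p.1 p.2 ^ 2 := by
  have cv := S.cont_slice ht
  have mK := ((isCompact_kept n).prod (isCompact_kept n)).measurableSet
  have hK : kept n ×ˢ kept n ⊆ unitSq := Set.prod_mono (kept_subset_Icc n) (kept_subset_Icc n)
  have i2 : IntegrableOn (fun p : ℝ × ℝ => S.v t p.1 p.2 ^ 2) unitSq :=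
    integrableOn_unitSq (by fun_prop)
  have i3 : IntegrableOn (fun p : ℝ × ℝ => (dens incY p.2 + dens incX p.1) * S.v t p.1 p.2 ^ 2)
    unitSq := integrableOn_unitSq (by fun_prop)
  have e1 : ∫ p in kept n ×ˢ kept n, S.v t p.1 p.2 ^ 2
      = ∫ p in unitSq, (kept n ×ˢ kept n).indicator (fun p => S.v t p.1 p.2 ^ 2) p := by
    rw [setIntegral_indicator mK, Set.inter_eq_right.2 hK]
  have e2 : ∫ p in slow δ, S.v t p.1 p.2 ^ 2
      = ∫ p in unitSq, (slow δ).indicator (fun p => S.v t p.1 p.2 ^ 2) p := by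
    rw [setIntegral_indicator (measurableSet_slow δ), Set.inter_eq_right.2 (slow_subset δ)]
  have i4 : IntegrableOn (fun p : ℝ × ℝ => δ * (kept n ×ˢ kept n).indicator
    (fun p => S.v t p.1 p.2 ^ 2) p) unitSq := (i2.indicator mK).const_mul δ
  have i5 : IntegrableOn (fun p : ℝ × ℝ => δ * (slow δ).indicator
    (fun p => S.v t p.1 p.2 ^ 2) p) unitSq := (i2.indicator (measurableSet_slow δ)).const_mul δ
  have i6 : IntegrableOn (fun p : ℝ × ℝ => (dens incY p.2 + dens incX p.1) * S.v t p.1 p.2 ^ 2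
    + δ * (kept n ×ˢ kept n).indicator (fun p => S.v t p.1 p.2 ^ 2) p) unitSq := i3.add i4
  rw [e1, e2, energy, ← integral_const_mul, ← integral_const_mul, ← integral_const_mul,
    ← integral_add i3 i4, ← integral_add i6 i5]
  refine setIntegral_mono_on (i2.const_mul δ) (i6.add i5) measurableSet_unitSq fun p hp => ?_
  have hv : 0 ≤ S.v t p.1 p.2 ^ 2 := sq_nonneg _
  have a1 := incr_incX.dens_nonneg p.1
  have a2 := incr_incY.dens_nonneg p.2
  have n0 : 0 ≤ (dens incY p.2 + dens incX p.1) * S.v t p.1 p.2 ^ 2 := by positivity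
  have n1 : 0 ≤ δ * (kept n ×ˢ kept n).indicator (fun p => S.v t p.1 p.2 ^ 2) p :=
    mul_nonneg hδ (Set.indicator_nonneg (fun _ _ => sq_nonneg _) _)
  have n2 : 0 ≤ δ * (slow δ).indicator (fun p => S.v t p.1 p.2 ^ 2) p :=
    mul_nonneg hδ (Set.indicator_nonneg (fun _ _ => sq_nonneg _) _)
  by_cases h1 : p ∈ kept n ×ˢ kept n
  · rw [Set.indicator_of_mem h1]
    linarith
  by_cases h2 : p ∈ slow δ
  · rw [Set.indicator_of_mem h2]
    linarith
  have h3 : δ ≤ dens incY p.2 + dens incX p.1 := by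
    by_contra! hlt
    exact h2 ⟨⟨hp, hlt.le⟩, fun h => h1 (Set.mem_iInter.1 h n)⟩
  linarith [mul_le_mul_of_nonneg_right h3 hv]

lemma setIntegral_dens_cell {n k : ℕ} (hk : k ∈ cells n) :
    ∫ y in Set.Icc (k * scale n) ((k + 1) * scale n), dens incX y = incX n := by
  have hp := scale_pos n
  rw [integral_Icc_eq_integral_Ioc, ← intervalIntegral.integral_of_le (by nlinarith),
    ← incr_incX.cdf_sub, incr_incX.cdf_cell hk]
  ring

lemma setIntegral_kept_le (ht : t ∈ Set.Ioc (0 : ℝ) 1) (n : ℕ) :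
    ∫ p in kept n ×ˢ kept n, S.v t p.1 p.2 ^ 2
      ≤ 4 * S.pairing (frozen n) t + 4 * (scale n * S.mixed t) := by
  have hp := scale_pos n
  have h := S.setIntegral_kept_sq_le ht n (W := fun _ => 1) (a := scale n) continuous_const
    (fun _ => zero_le_one) (fun k _ => by
      rw [setIntegral_const, Real.volume_real_Icc_of_le (by nlinarith), smul_eq_mul]
      linarith) hp.le
  simp only [one_mul] at h
  refine h.trans_eq ?_
  field_simp

lemma integral_source_le (ht : t ∈ Set.Ioc (0 : ℝ) 1) (m : ℕ) :
    ∫ p in unitSq, dens incX p.1 * source m (stream p.1 p.2) p.2 * S.v t p.1 p.2 ^ 2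
      ≤ 36 * S.pairing (frozen (m + 1)) t + 36 * (scale (m + 1) * S.mixed t) := by
  have hp := scale_pos m
  have hp' := scale_pos (m + 1)
  have cv := S.cont_slice (Set.Ioc_subset_Icc_self ht)
  have cs := continuous_source m
  have mK := ((isCompact_kept (m + 1)).prod (isCompact_kept (m + 1))).measurableSet
  have hK : kept (m + 1) ×ˢ kept (m + 1) ⊆ unitSq :=
    Set.prod_mono (kept_subset_Icc _) (kept_subset_Icc _)
  have h := S.setIntegral_kept_sq_le ht (m + 1) (W := dens incX) (a := incX (m + 1))
    continuous_dens_incX incr_incX.dens_nonneg (fun k hk => (setIntegral_dens_cell hk).le)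
    (incr_incX.pos _).le
  have hX := incr_incX.le (m + 1)
  rw [Nat.add_sub_cancel] at hX
  have i2 : IntegrableOn (fun p : ℝ × ℝ => 3 / scale m * (dens incX p.1 * S.v t p.1 p.2 ^ 2))
    unitSq := integrableOn_unitSq (by fun_prop)
  have hpos : 0 ≤ 4 / scale (m + 1) * S.pairing (frozen (m + 1)) t + 4 * S.mixed t :=
    add_nonneg (mul_nonneg (by positivity) (integral_nonneg fun p =>
      mul_nonneg (mul_nonneg (cutoff_nonneg _ _) (cutoff_nonneg _ _)) (sq_nonneg _)))
      (mul_nonneg (by norm_num) (S.mixed_nonneg t))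
  calc _ ≤ ∫ p in unitSq, (kept (m + 1) ×ˢ kept (m + 1)).indicator
        (fun p => 3 / scale m * (dens incX p.1 * S.v t p.1 p.2 ^ 2)) p := by
        refine setIntegral_mono_on (integrableOn_unitSq (by fun_prop)) (i2.indicator mK)
          measurableSet_unitSq fun p _ => ?_
        by_cases h1 : p ∈ kept (m + 1) ×ˢ kept (m + 1)
        · rw [Set.indicator_of_mem h1]
          have := mul_le_mul_of_nonneg_left (source_le m (stream p.1 p.2) p.2)
            (mul_nonneg (incr_incX.dens_nonneg p.1) (sq_nonneg (S.v t p.1 p.2)))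
          linarith
        · rw [Set.indicator_of_notMem h1, source_eq_zero h1, mul_zero, zero_mul]
    _ = 3 / scale m * ∫ p in kept (m + 1) ×ˢ kept (m + 1), dens incX p.1 * S.v t p.1 p.2 ^ 2 := by
        rw [setIntegral_indicator mK, Set.inter_eq_right.2 hK, integral_const_mul]
    _ ≤ 3 / scale m * ((3 * scale m * scale (m + 1))
        * (4 / scale (m + 1) * S.pairing (frozen (m + 1)) t + 4 * S.mixed t)) := by
        gcongr
        exact h.trans (by gcongr)
    _ = _ := by field_simp; ring

end Sol

end

section

namespace Sol
variable {κ Λ : ℝ} {init : ℝ → ℝ} (S : Sol κ Λ init) {t : ℝ}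

lemma potential_deriv_le (m : ℕ) (hκ : κ = scale (m + 1) ^ 2) (hΛ : 0 ≤ Λ)
    (ht : t ∈ Set.Ioc (0 : ℝ) 1) :
    ∫ p in unitSq, (potential m).φ p.1 p.2 * (2 * S.v t p.1 p.2 * S.vt t p.1 p.2)
      ≤ Λ * (600001 * (∫ p in unitSq,
          dens incX p.1 * source m (stream p.1 p.2) p.2 * S.v t p.1 p.2 ^ 2)
        - ∫ p in unitSq, (dens incY p.2 + dens incX p.1) * S.v t p.1 p.2 ^ 2)
      + 2000000 * (2 * κ * S.dissip t) + 2 * 10 ^ 14 * (scale (m + 1) * S.mixed t) := by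
  have cv := S.cont_slice (Set.Ioc_subset_Icc_self ht)
  have cx := S.cont_x t ht
  have cy := S.cont_y t ht
  have c1 := (potential m).cont
  have c2 := (potential m).cont_left
  have c3 := (potential m).cont_right
  have cs := continuous_source m
  have hp := scale_pos (m + 1)
  have hκ0 : 0 ≤ κ := hκ ▸ sq_nonneg _
  rw [S.integral_test ht]
  have e : 2 * κ * (10 ^ 14 / scale (m + 1)) = 2 * 10 ^ 14 * scale (m + 1) := by
    rw [hκ]; field_simp
  have h := integral_unitSq_mono (F := fun p =>
      Λ * (S.v t p.1 p.2 ^ 2 * (dens incY p.2 * (potential m).φx p.1 p.2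
        + dens incX p.1 * (potential m).φy p.1 p.2))
      - 2 * κ * ((potential m).φ p.1 p.2 * (S.vx t p.1 p.2 ^ 2 + S.vy t p.1 p.2 ^ 2))
      - 2 * κ * (S.v t p.1 p.2 * (S.vx t p.1 p.2 * (potential m).φx p.1 p.2
        + S.vy t p.1 p.2 * (potential m).φy p.1 p.2)))
    (G := fun p => (Λ * (600001 * (dens incX p.1 * source m (stream p.1 p.2) p.2
          * S.v t p.1 p.2 ^ 2) - (dens incY p.2 + dens incX p.1) * S.v t p.1 p.2 ^ 2)
        + 2000000 * (2 * κ) * (S.vx t p.1 p.2 ^ 2 + S.vy t p.1 p.2 ^ 2))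
        + 2 * 10 ^ 14 * scale (m + 1)
          * (|S.v t p.1 p.2| * (|S.vx t p.1 p.2| + |S.vy t p.1 p.2|)))
    (by fun_prop) (by fun_prop) fun p hp' => by
    have h1 := mul_le_mul_of_nonneg_left (potential_flow_le m p.1 p.2)
      (mul_nonneg hΛ (sq_nonneg (S.v t p.1 p.2)))
    have h2 := mul_le_mul_of_nonneg_left (neg_le.1 (abs_le.1 (abs_potential_le m hp'.1 hp'.2)).1)
      (mul_nonneg (mul_nonneg zero_le_two hκ0)
        (by positivity : 0 ≤ S.vx t p.1 p.2 ^ 2 + S.vy t p.1 p.2 ^ 2))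
    have h3 := two_mul_mul_le (a := S.v t p.1 p.2) (b := S.vx t p.1 p.2)
      (abs_potential_left_le m p.1 p.2) (.inr rfl)
    have h4 := two_mul_mul_le (a := S.v t p.1 p.2) (b := S.vy t p.1 p.2)
      (abs_potential_right_le m p.1 p.2) (.inr rfl)
    have h5 := mul_le_mul_of_nonneg_left (add_le_add h3 h4) hκ0
    rw [← e]
    linarith
  refine h.trans_eq ?_
  rw [dissip, mixed, integral_add, integral_add, integral_const_mul, integral_const_mul,
    integral_const_mul, integral_sub, integral_const_mul]
  · ring
  all_goals exact integrableOn_unitSq (by fun_prop)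

lemma abs_potential_pairing_le (m : ℕ) (ht : t ∈ Set.Icc (0 : ℝ) 1) :
    |S.pairing (potential m) t| ≤ 2000000 * S.energy t := by
  have cv := S.cont_slice ht
  have c1 := (potential m).cont
  refine (norm_integral_le_integral_norm (μ := volume.restrict unitSq)
    fun p : ℝ × ℝ => (potential m).φ p.1 p.2 * S.v t p.1 p.2 ^ 2).trans ?_
  rw [energy, ← integral_const_mul]
  refine integral_unitSq_mono (by fun_prop) (by fun_prop) fun p hp => ?_
  rw [Real.norm_eq_abs, abs_mul, abs_of_nonneg (sq_nonneg (S.v t p.1 p.2))]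
  exact mul_le_mul_of_nonneg_right (abs_potential_le m hp.1 hp.2) (sq_nonneg _)

/-- The energy budget: motion along the flow is paid for by dissipation. -/
lemma budget (m : ℕ) (hκ : κ = scale (m + 1) ^ 2) (hΛ : 0 ≤ Λ)
    (hinit : ∀ x ∈ kept 1, init x = 0) (hE : S.energy 0 ≤ 1) (hQ : S.quartic 0 ≤ 1)
    (hE0 : 0 < S.energy 0) {δ μ : ℝ} (hδ : 0 < δ) (hδ1 : δ ≤ 1) (hμ : 0 < μ)
    (hslow : (volume : Measure (ℝ × ℝ)).real (slow δ) ≤ S.energy 0 ^ 2 / 16) :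
    Λ * δ * (3 / 4 * S.energy 0) - 4000000 ≤
      (3 * 10 ^ 7 * Λ * (384 * Λ + 96) + (3 * 10 ^ 7 * Λ + 2 * 10 ^ 14)) * μ
      + (S.energy 0 - S.energy 1) / 2 *
        ((3 * 10 ^ 7 * Λ * (384 * Λ + 96) + (3 * 10 ^ 7 * Λ + 2 * 10 ^ 14)) / μ
          + 2 * Λ + 4000000) := by
  have hκ0 : 0 ≤ κ := hκ ▸ sq_nonneg _
  have hanti := S.antitoneOn_energy hκ0
  set D := (S.energy 0 - S.energy 1) / 2 with hD
  have h01 := hanti ⟨le_rfl, zero_le_one⟩ ⟨zero_le_one, le_rfl⟩ zero_le_one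
  have hD0 : 0 ≤ D := by linarith
  have hderiv : ∀ t ∈ Set.Ioo (0 : ℝ) 1,
      ∫ p in unitSq, (potential m).φ p.1 p.2 * (2 * S.v t p.1 p.2 * S.vt t p.1 p.2)
        ≤ (3 * 10 ^ 7 * Λ * ((384 * Λ + 96) * (μ + D / μ)) + (3 * 10 ^ 7 * Λ + 2 * 10 ^ 14) * μ
          - Λ * δ * (3 / 4 * S.energy 0 - 2 * D))
          + (2000000 + (3 * 10 ^ 7 * Λ + 2 * 10 ^ 14) / (2 * μ)) * (2 * κ * S.dissip t) := by
    intro t ht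
    have ht1 : t ∈ Set.Ioc (0 : ℝ) 1 := ⟨ht.1, ht.2.le⟩
    have ht2 : t ∈ Set.Icc (0 : ℝ) 1 := ⟨ht.1.le, ht.2.le⟩
    have h1 := S.potential_deriv_le m hκ hΛ ht1
    have h2 := S.integral_source_le ht1 m
    have h3 := S.energy_le_flow ht2 (m + 1) hδ.le
    have h4 := S.setIntegral_kept_le ht1 (m + 1)
    have h5 := S.setIntegral_slow_le ht2 δ (η := S.energy 0 / 8) (by positivity)
    have h6 := S.frozen_le (m + 1) hκ hΛ hinit hμ ht2
    have h7 := S.mul_mixed_le ht1 (s := scale (m + 1)) hμ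
    rw [← hκ] at h7
    have h8 : S.energy t ≤ S.energy 0 := hanti ⟨le_rfl, zero_le_one⟩ ht2 ht.1.le
    have h9 : S.energy 1 ≤ S.energy t := hanti ht2 ⟨zero_le_one, le_rfl⟩ ht.2.le
    have h10 := S.quartic_le hκ0 ht2
    have h11 : ∫ p in slow δ, S.v t p.1 p.2 ^ 2 ≤ S.energy 0 / 4 := by
      have e : S.energy 0 ^ 2 / 16 / (4 * (S.energy 0 / 8)) = S.energy 0 / 8 := by
        field_simp; norm_num
      have := (div_le_div_iff_of_pos_right (by positivity : 0 < 4 * (S.energy 0 / 8))).2 hslow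
      have := mul_le_mul_of_nonneg_left (h10.trans hQ) (by positivity : 0 ≤ S.energy 0 / 8)
      linarith
    set X := S.pairing (frozen (m + 1)) t
    set Y := scale (m + 1) * S.mixed t with hY
    have hY0 : 0 ≤ Y := mul_nonneg (scale_pos _).le (S.mixed_nonneg t)
    have hX0 : 0 ≤ X := integral_nonneg fun p =>
      mul_nonneg (mul_nonneg (cutoff_nonneg _ _) (cutoff_nonneg _ _)) (sq_nonneg _)
    have hX : X ≤ (384 * Λ + 96) * (μ + D / μ) := by
      refine h6.trans (mul_le_mul_of_nonneg_left (add_le_add ?_ ?_) (by positivity))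
      · exact mul_le_of_le_one_right hμ.le hE
      · rw [hD, div_div]
    have hY1 : Y ≤ μ + κ * S.dissip t / μ :=
      h7.trans (add_le_add (mul_le_of_le_one_right hμ.le (h8.trans hE)) le_rfl)
    have hflow : δ * (3 / 4 * S.energy 0 - 2 * D) - 4 * X - 4 * Y
        ≤ ∫ p in unitSq, (dens incY p.2 + dens incX p.1) * S.v t p.1 p.2 ^ 2 := by
      have a1 := mul_le_mul_of_nonneg_left h4 hδ.le
      have a2 := mul_le_mul_of_nonneg_left h11 hδ.le
      have a3 : δ * (4 * X + 4 * Y) ≤ 1 * (4 * X + 4 * Y) := by gcongr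
      have a4 : δ * (S.energy 0 - 2 * D) ≤ δ * S.energy t := by gcongr; linarith
      linarith
    have b1 : Λ * (600001 * (∫ p in unitSq,
          dens incX p.1 * source m (stream p.1 p.2) p.2 * S.v t p.1 p.2 ^ 2)
        - ∫ p in unitSq, (dens incY p.2 + dens incX p.1) * S.v t p.1 p.2 ^ 2)
        ≤ Λ * (3 * 10 ^ 7 * X + 3 * 10 ^ 7 * Y - δ * (3 / 4 * S.energy 0 - 2 * D)) := by
      refine mul_le_mul_of_nonneg_left ?_ hΛ
      linarith
    have b2 := mul_le_mul_of_nonneg_left hX (by positivity : 0 ≤ 3 * 10 ^ 7 * Λ)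
    have b3 := mul_le_mul_of_nonneg_left hY1
      (by positivity : 0 ≤ 3 * 10 ^ 7 * Λ + 2 * 10 ^ 14)
    have b4 : (3 * 10 ^ 7 * Λ + 2 * 10 ^ 14) / (2 * μ) * (2 * κ * S.dissip t)
      = (3 * 10 ^ 7 * Λ + 2 * 10 ^ 14) * (κ * S.dissip t / μ) := by field_simp
    linarith
  have h := S.pairing_le_of_deriv_le (potential m) hderiv ⟨zero_le_one, le_rfl⟩
  have p0 := S.abs_potential_pairing_le m ⟨le_rfl, zero_le_one⟩
  have p1 := S.abs_potential_pairing_le m ⟨zero_le_one, le_rfl⟩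
  have e1 : S.energy 0 - S.energy 1 = 2 * D := by rw [hD]; ring
  rw [e1] at h
  have q0 := (abs_le.1 p0).2
  have q1 := (abs_le.1 p1).1
  have e2 : (2000000 + (3 * 10 ^ 7 * Λ + 2 * 10 ^ 14) / (2 * μ)) * (2 * D)
    = 4000000 * D + (3 * 10 ^ 7 * Λ + 2 * 10 ^ 14) * (D / μ) := by field_simp; ring
  have e3 : D * ((3 * 10 ^ 7 * Λ * (384 * Λ + 96) + (3 * 10 ^ 7 * Λ + 2 * 10 ^ 14)) / μ
      + 2 * Λ + 4000000) = (3 * 10 ^ 7 * Λ * (384 * Λ + 96)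
      + (3 * 10 ^ 7 * Λ + 2 * 10 ^ 14)) * (D / μ) + 2 * Λ * D + 4000000 * D := by
    field_simp
  have e4 : δ * (Λ * D) ≤ 1 * (Λ * D) := by gcongr
  rw [e3]
  rw [e2] at h
  linarith

end Sol

/-- Uniform lower bound for the dissipation along a sequence of vanishing diffusivities. -/
theorem exists_dissipation_lower_bound {init : ℝ → ℝ} (hc : Continuous init)
    (h0 : ∀ x, 0 ≤ init x) (h1 : ∀ x, init x ≤ 1) (hinit : ∀ x ∈ kept 1, init x = 0)
    (hpos : 0 < ∫ p in unitSq, init p.1 ^ 2) :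
    ∃ Λ c : ℝ, 0 < c ∧ ∀ (m : ℕ) (S : Sol (scale (m + 1) ^ 2) Λ init),
      c ≤ scale (m + 1) ^ 2 * ∫ t in Set.Icc (0 : ℝ) 1, S.dissip t := by
  set E := ∫ p in unitSq, init p.1 ^ 2 with hE
  obtain ⟨δ, hδ, hδ1, hslow⟩ := exists_volume_slow_le (by positivity : 0 < E ^ 2 / 16)
  set Λ := 4000002 / (δ * (3 / 4 * E)) with hΛ
  have hΛ0 : 0 < Λ := by positivity
  set P := 3 * 10 ^ 7 * Λ * (384 * Λ + 96) + (3 * 10 ^ 7 * Λ + 2 * 10 ^ 14) with hP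
  have hP0 : 0 < P := by positivity
  have hle : ∀ k : ℕ, ∫ p in unitSq, init p.1 ^ k ≤ 1 := fun k => by
    have := integral_unitSq_mono (F := fun p => init p.1 ^ k) (G := fun _ => 1)
      (by fun_prop) continuous_const fun p _ => pow_le_one₀ (h0 _) (h1 _)
    rwa [setIntegral_const, volume_unitSq, one_smul] at this
  refine ⟨Λ, 1 / (P * P + 2 * Λ + 4000000), by positivity, fun m S => ?_⟩
  have eE : S.energy 0 = E := integral_congr_ae (.of_forall fun p => by simp only [S.initial])
  have eQ : S.quartic 0 = ∫ p in unitSq, init p.1 ^ 4 :=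
    integral_congr_ae (.of_forall fun p => by simp only [S.initial])
  have h := S.budget m rfl hΛ0.le hinit (eE ▸ hle 2) (eQ ▸ hle 4) (eE ▸ hpos) hδ hδ1
    (by positivity : 0 < 1 / P) (eE ▸ hslow)
  rw [← hP, mul_one_div_cancel hP0.ne', div_div_eq_mul_div, div_one] at h
  have e : Λ * δ * (3 / 4 * S.energy 0) = 4000002 := by
    rw [eE, hΛ]; field_simp
  rw [e] at h
  rw [S.integral_dissip (sq_nonneg _), div_le_iff₀ (by positivity)]
  linarith

end

/-- A smooth periodic profile concentrated in the first gap. -/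
def profile (x : ℝ) : ℝ :=
  Real.smoothTransition (Real.cos (2 * Real.pi * (511 / 512 - x)) - Real.cos (2 * Real.pi / 512))

lemma contDiff_profile : ContDiff ℝ (⊤ : ℕ∞) profile := by
  unfold profile
  exact Real.smoothTransition.contDiff.comp (by fun_prop)

lemma profile_add_int (x : ℝ) (k : ℤ) : profile (x + k) = profile x := by
  unfold profile
  rw [show 2 * Real.pi * (511 / 512 - (x + k)) = 2 * Real.pi * (511 / 512 - x) - k * (2 * Real.pi)
    by ring, Real.cos_sub_int_mul_two_pi]

lemma profile_eq_zero {x : ℝ} (h0 : 0 ≤ x) (h1 : x ≤ 255 / 256) : profile x = 0 := by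
  have hpi := Real.pi_pos
  refine Real.smoothTransition.zero_of_nonpos (sub_nonpos.2 ?_)
  rcases le_total (511 / 512 - x) (1 / 2) with h | h
  · exact Real.cos_le_cos_of_nonneg_of_le_pi (by positivity) (by nlinarith) (by nlinarith)
  · rw [← Real.cos_two_pi_sub]
    exact Real.cos_le_cos_of_nonneg_of_le_pi (by positivity) (by nlinarith) (by nlinarith)

lemma profile_eq_zero_of_mem_kept {x : ℝ} (hx : x ∈ kept 1) : profile x = 0 := by
  obtain ⟨k, hk, h1, h2⟩ := exists_of_mem_kept_succ hx
  have hk0 : k = 0 := by simpa [cells] using hk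
  subst hk0
  simp only [len, scale_zero, ratio] at *
  exact profile_eq_zero (by simpa using h1) (by norm_num at h2; linarith)

lemma integral_profile_sq_pos : 0 < ∫ p in unitSq, profile p.1 ^ 2 := by
  have hc : Continuous profile := contDiff_profile.continuous
  rw [setIntegral_pos_iff_support_of_nonneg_ae (.of_forall fun _ => sq_nonneg _)
    (integrableOn_unitSq (by fun_prop))]
  have ho : IsOpen (Function.support (fun p : ℝ × ℝ => profile p.1 ^ 2)
      ∩ Set.Ioo 0 1 ×ˢ Set.Ioo 0 1) :=
    (Continuous.isOpen_support (by fun_prop)).inter (isOpen_Ioo.prod isOpen_Ioo)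
  refine (ho.measure_pos volume ⟨(511 / 512, 1 / 2), ?_, by norm_num⟩).trans_le (measure_mono ?_)
  · have hpi := Real.pi_pos
    refine pow_ne_zero 2 (Real.smoothTransition.pos_of_pos (sub_pos.2 ?_)).ne'
    exact Real.cos_lt_cos_of_nonneg_of_le_pi (by norm_num) (by linarith)
      (by norm_num; positivity)
  · exact Set.inter_subset_inter_right _
      (Set.prod_mono Set.Ioo_subset_Icc_self Set.Ioo_subset_Icc_self)

/-- The point with given coordinates. -/
def point (x y : ℝ) : E2 := x • EuclideanSpace.single 0 1 + y • EuclideanSpace.single 1 1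

@[simp] lemma point_apply_zero (x y : ℝ) : point x y 0 = x := by simp [point]

@[simp] lemma point_apply_one (x y : ℝ) : point x y 1 = y := by simp [point]

lemma point_eta (p : E2) : point (p 0) (p 1) = p := by
  ext i; fin_cases i <;> simp

@[fun_prop]
lemma continuous_point : Continuous fun p : ℝ × ℝ => point p.1 p.2 := by
  unfold point; fun_prop

lemma hasDerivAt_point_left (x y : ℝ) :
    HasDerivAt (fun x => point x y) (EuclideanSpace.single 0 1) x := by
  simpa [point] using ((hasDerivAt_id x).smul_const (EuclideanSpace.single (0 : Fin 2) (1 : ℝ))).add_const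
    (y • EuclideanSpace.single (1 : Fin 2) (1 : ℝ))

lemma hasDerivAt_point_right (x y : ℝ) :
    HasDerivAt (fun y => point x y) (EuclideanSpace.single 1 1) y := by
  simpa [point] using ((hasDerivAt_id y).smul_const (EuclideanSpace.single (1 : Fin 2) (1 : ℝ))).const_add
    (x • EuclideanSpace.single (0 : Fin 2) (1 : ℝ))

lemma norm_point_le (x y : ℝ) : ‖point x y‖ ≤ |x| + |y| := by
  refine (norm_add_le _ _).trans ?_
  simp [norm_smul]

lemma setIntegral_cube (F : E2 → ℝ) :
    ∫ x in cube, F x = ∫ p in unitSq, F (point p.1 p.2) := by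
  have he := (volume_preserving_finTwoArrow ℝ).comp
    (EuclideanSpace.volume_preserving_symm_measurableEquiv_toLp (Fin 2))
  have hm := (MeasurableEquiv.finTwoArrow (α := ℝ)).measurableEmbedding.comp
    (MeasurableEquiv.toLp 2 (Fin 2 → ℝ)).symm.measurableEmbedding
  rw [← he.setIntegral_preimage_emb hm]
  have hs : cube = (MeasurableEquiv.finTwoArrow ∘ (MeasurableEquiv.toLp 2 (Fin 2 → ℝ)).symm)
      ⁻¹' unitSq := by
    ext p
    simp [cube, unitSq, Fin.forall_fin_two]
    tauto
  rw [← hs]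
  congr 1
  funext p
  simpa using congrArg F (point_eta p).symm

lemma norm_sq_clm (L : E2 →L[ℝ] ℝ) :
    ‖L‖ ^ 2 = L (EuclideanSpace.single 0 1) ^ 2 + L (EuclideanSpace.single 1 1) ^ 2 := by
  obtain ⟨v, rfl⟩ := (InnerProductSpace.toDual ℝ E2).surjective L
  rw [LinearIsometryEquiv.norm_map, EuclideanSpace.real_norm_sq_eq]
  simp [Fin.sum_univ_two, EuclideanSpace.inner_single_right]

lemma Per.point_left {F : Type*} [AddCommGroup F] {f : E2 → F} (h : Per f) (y : ℝ) :
    f (point 0 y) = f (point 1 y) := by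
  rw [← h (point 0 y) ![1, 0]]
  congr 1
  ext i; fin_cases i <;> simp

lemma Per.point_right {F : Type*} [AddCommGroup F] {f : E2 → F} (h : Per f) (x : ℝ) :
    f (point x 0) = f (point x 1) := by
  rw [← h (point x 0) ![0, 1]]
  congr 1
  ext i; fin_cases i <;> simp

lemma Per.fderiv_apply {f : E2 → ℝ} (h : Per f) (e : E2) : Per fun x => fderiv ℝ f x e := by
  intro x k
  have : (fun z => f (z + (WithLp.equiv 2 (Fin 2 → ℝ)).symm (fun i => (k i : ℝ)))) = f :=
    funext fun z => h z k
  simp only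
  rw [← fderiv_comp_add_right, this]

/-- The velocity field. -/
def velocity (Λ : ℝ) (p : E2) : E2 := Λ • point (perDens incY (p 1)) (perDens incX (p 0))

lemma clm_velocity (L : E2 →L[ℝ] ℝ) (Λ : ℝ) (p : E2) :
    L (velocity Λ p) = Λ * (perDens incY (p 1) * L (EuclideanSpace.single 0 1)
      + perDens incX (p 0) * L (EuclideanSpace.single 1 1)) := by
  simp [velocity, point, mul_add]

lemma per_velocity (Λ : ℝ) : Per (velocity Λ) := by
  intro x k
  simp [velocity, perDens_add_int]

lemma Incr.abs_perDens_le {A : ℕ → ℝ} (hA : Incr A) (y : ℝ) : |perDens A y| ≤ 300000 := by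
  unfold perDens
  rw [abs_of_nonneg (hA.dens_nonneg _)]
  exact hA.dens_le _

lemma norm_velocity_le (Λ : ℝ) (p : E2) : ‖velocity Λ p‖ ≤ |Λ| * 600000 := by
  rw [velocity, norm_smul, Real.norm_eq_abs]
  gcongr
  have h1 := norm_point_le (perDens incY (p 1)) (perDens incX (p 0))
  have h2 := incr_incY.abs_perDens_le (p 1)
  have h3 := incr_incX.abs_perDens_le (p 0)
  linarith

lemma velocity_holder (Λ : ℝ) {α : ℝ} (h0 : 0 < α) (h1 : α < 1) :
    ∃ C, ∀ p q : E2, ‖velocity Λ p - velocity Λ q‖ ≤ C * ‖p - q‖ ^ α := by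
  obtain ⟨M, hM, hX⟩ := incr_incX.perDens_holder h0 h1
  obtain ⟨N, hN, hY⟩ := incr_incY.perDens_holder h0 h1
  refine ⟨|Λ| * (N + M), fun p q => ?_⟩
  have e : velocity Λ p - velocity Λ q = Λ • point (perDens incY (p 1) - perDens incY (q 1))
      (perDens incX (p 0) - perDens incX (q 0)) := by
    ext i; fin_cases i <;> simp [velocity, mul_sub]
  have hi : ∀ i, |p i - q i| ^ α ≤ ‖p - q‖ ^ α := fun i =>
    Real.rpow_le_rpow (abs_nonneg _) (by simpa using PiLp.norm_apply_le (p - q) i) h0.le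
  rw [e, norm_smul, Real.norm_eq_abs, mul_assoc]
  gcongr
  refine (norm_point_le _ _).trans ?_
  rw [add_mul]
  exact add_le_add ((hY _ _).trans (mul_le_mul_of_nonneg_left (hi 1) hN))
    ((hX _ _).trans (mul_le_mul_of_nonneg_left (hi 0) hM))

lemma hasDerivAt_left {f : E2 → ℝ} (hf : Differentiable ℝ f) (x y : ℝ) :
    HasDerivAt (fun x => f (point x y)) (fderiv ℝ f (point x y) (EuclideanSpace.single 0 1)) x :=
  (hf _).hasFDerivAt.comp_hasDerivAt x (hasDerivAt_point_left x y)

lemma hasDerivAt_right {f : E2 → ℝ} (hf : Differentiable ℝ f) (x y : ℝ) :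
    HasDerivAt (fun y => f (point x y)) (fderiv ℝ f (point x y) (EuclideanSpace.single 1 1)) y :=
  (hf _).hasFDerivAt.comp_hasDerivAt y (hasDerivAt_point_right x y)

lemma integral_fderiv_velocity (Λ : ℝ) {φ : E2 → ℝ} (hφ : ContDiff ℝ (⊤ : ℕ∞) φ) (hp : Per φ) :
    ∫ x in cube, fderiv ℝ φ x (velocity Λ x) = 0 := by
  have hd : Differentiable ℝ φ := hφ.differentiable (by simp)
  have hc : Continuous (fderiv ℝ φ) := hφ.continuous_fderiv (by simp)
  have hl := integral_deriv_left (c := fun x y => dens incY y * φ (point x y))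
    (fun x y => (hasDerivAt_left hd x y).const_mul (dens incY y))
    (by fun_prop) (fun y _ => by rw [Per.point_left hp])
  have hr := integral_deriv_right (c := fun x y => dens incX x * φ (point x y))
    (fun x y => (hasDerivAt_right hd x y).const_mul (dens incX x))
    (by fun_prop) (fun x _ => by rw [Per.point_right hp])
  rw [setIntegral_cube]
  have e : ∀ p ∈ unitSq, fderiv ℝ φ (point p.1 p.2) (velocity Λ (point p.1 p.2))
      = Λ * (dens incY p.2 * fderiv ℝ φ (point p.1 p.2) (EuclideanSpace.single 0 1)
        + dens incX p.1 * fderiv ℝ φ (point p.1 p.2) (EuclideanSpace.single 1 1)) := by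
    intro p hp'
    rw [clm_velocity, point_apply_zero, point_apply_one, perDens_of_mem hp'.1,
      perDens_of_mem hp'.2]
  rw [setIntegral_congr_fun measurableSet_unitSq e, integral_const_mul,
    integral_add (integrableOn_unitSq (by fun_prop)) (integrableOn_unitSq (by fun_prop)), hl, hr]
  simp

/-- A classical solution, written in coordinates. -/
def solOfClassical {κ Λ : ℝ} {init : ℝ → ℝ} {θ : ℝ → E2 → ℝ}
    (h : IsClassicalSolution 1 κ (velocity Λ) (fun p => init (p 0)) θ) : Sol κ Λ init :=
  have hC1 : ∀ t ∈ Set.Ioc (0 : ℝ) 1, ∀ e, ContDiff ℝ 1 fun z => fderiv ℝ (θ t) z e :=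
    fun t ht e => ((h.2.2.2.2.2.1 t ht).fderiv_right (by norm_num)).clm_apply contDiff_const
  have hD : ∀ t ∈ Set.Ioc (0 : ℝ) 1, Differentiable ℝ (θ t) :=
    fun t ht => (h.2.2.2.2.2.1 t ht).differentiable (by norm_num)
  { v := fun t x y => θ t (point x y)
    vt := fun t x y => deriv (fun s => θ s (point x y)) t
    vx := fun t x y => fderiv ℝ (θ t) (point x y) (EuclideanSpace.single 0 1)
    vy := fun t x y => fderiv ℝ (θ t) (point x y) (EuclideanSpace.single 1 1)
    vxx := fun t x y => fderiv ℝ (fun z => fderiv ℝ (θ t) z (EuclideanSpace.single 0 1))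
      (point x y) (EuclideanSpace.single 0 1)
    vyy := fun t x y => fderiv ℝ (fun z => fderiv ℝ (θ t) z (EuclideanSpace.single 1 1))
      (point x y) (EuclideanSpace.single 1 1)
    cont := h.2.2.1.comp (f := fun p : ℝ × (ℝ × ℝ) => (p.1, point p.2.1 p.2.2))
      (by fun_prop) fun p hp => ⟨hp.1, trivial⟩
    cont_time := h.2.2.2.2.1.comp (f := fun p : ℝ × (ℝ × ℝ) => (p.1, point p.2.1 p.2.2))
      (by fun_prop) fun p hp => ⟨hp.1, trivial⟩
    hasDerivAt_time := fun t ht x y => (h.2.2.2.1 (point x y) t ht).hasDerivAt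
    hasDerivAt_x := fun t ht => hasDerivAt_left (hD t ht)
    hasDerivAt_y := fun t ht => hasDerivAt_right (hD t ht)
    hasDerivAt_xx := fun t ht => hasDerivAt_left ((hC1 t ht _).differentiable one_ne_zero)
    hasDerivAt_yy := fun t ht => hasDerivAt_right ((hC1 t ht _).differentiable one_ne_zero)
    cont_x := fun t ht => (hC1 t ht _).continuous.comp continuous_point
    cont_y := fun t ht => (hC1 t ht _).continuous.comp continuous_point
    cont_xx := fun t ht => (((hC1 t ht _).continuous_fderiv one_ne_zero).clm_apply
      continuous_const).comp continuous_point
    cont_yy := fun t ht => (((hC1 t ht _).continuous_fderiv one_ne_zero).clm_apply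
      continuous_const).comp continuous_point
    per_left := fun t _ y => ⟨Per.point_left (h.2.1 t) y,
      Per.point_left (Per.fderiv_apply (h.2.1 t) _) y⟩
    per_right := fun t _ x => ⟨Per.point_right (h.2.1 t) x,
      Per.point_right (Per.fderiv_apply (h.2.1 t) _) x⟩
    eqn := fun t ht x hx y hy => by
      have := h.2.2.2.2.2.2.1 t ht (point x y)
      rwa [clm_velocity, point_apply_zero, point_apply_one, perDens_of_mem hx,
        perDens_of_mem hy, lap, Fin.sum_univ_two] at this
    initial := fun x y => by simp [h.2.2.2.2.2.2.2] }

lemma integral_dissip_solOfClassical {κ Λ : ℝ} {init : ℝ → ℝ} {θ : ℝ → E2 → ℝ}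
    (h : IsClassicalSolution 1 κ (velocity Λ) (fun p => init (p 0)) θ) (t : ℝ) :
    (solOfClassical h).dissip t = ∫ x in cube, ‖fderiv ℝ (θ t) x‖ ^ 2 := by
  simp only [setIntegral_cube, norm_sq_clm]
  rfl

end AnomalousDissipation

open AnomalousDissipation

/-- **Anomalous dissipation for a 2D autonomous `C^α` velocity field.**
There exist a bounded `ℤ²`-periodic `α`-Hölder divergence-free (in the distributional sense)
velocity field `u : ℝ² → ℝ²`, a smooth `ℤ²`-periodic initial datum `θin`, a constant `c > 0`
and diffusivities `κ q ∈ (0,1)` with `κ q → 0`, such that every classical solution of the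
advection–diffusion equation with velocity `u`, diffusivity `κ q` and initial datum `θin`
dissipates at least `c` of energy on `[0,1]`. -/
theorem anomalous_dissipation_autonomous_Calpha
    (α : ℝ) (hα : α ∈ Set.Ioo (0:ℝ) 1) :
    ∃ (u : E2 → E2) (θin : E2 → ℝ) (c : ℝ) (κ : ℕ → ℝ),
      (∃ C, ∀ x, ‖u x‖ ≤ C) ∧
      Per u ∧
      (∃ C, ∀ x y : E2, ‖u x - u y‖ ≤ C * ‖x - y‖ ^ α) ∧
      (∀ φ : E2 → ℝ, ContDiff ℝ (⊤ : ℕ∞) φ → Per φ →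
        (∫ x in cube, fderiv ℝ φ x (u x)) = 0) ∧
      ContDiff ℝ (⊤ : ℕ∞) θin ∧ Per θin ∧
      0 < c ∧
      (∀ q, κ q ∈ Set.Ioo (0:ℝ) 1) ∧
      Filter.Tendsto κ Filter.atTop (nhds 0) ∧
      (∀ q, ∀ θ : ℝ → E2 → ℝ, IsClassicalSolution 1 (κ q) u θin θ →
        c ≤ κ q * ∫ s in Set.Icc (0:ℝ) 1, ∫ x in cube, ‖fderiv ℝ (θ s) x‖ ^ 2) := by
  obtain ⟨Λ, c, hc, h⟩ := exists_dissipation_lower_bound contDiff_profile.continuous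
    (fun _ => Real.smoothTransition.nonneg _) (fun _ => Real.smoothTransition.le_one _)
    (fun _ => profile_eq_zero_of_mem_kept) integral_profile_sq_pos
  have hs : ∀ q, scale (q + 1) ≤ (1 / 256) ^ (q + 1) := fun q => scale_le_pow _
  have hlt : ∀ q, scale (q + 1) < 1 := fun q =>
    (hs q).trans_lt (pow_lt_one₀ (by norm_num) (by norm_num) q.succ_ne_zero)
  have hlim : Filter.Tendsto (fun q => scale (q + 1)) Filter.atTop (nhds 0) :=
    squeeze_zero (fun q => (scale_pos _).le) hs
      ((tendsto_pow_atTop_nhds_zero_of_lt_one (by norm_num) (by norm_num)).comp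
        (Filter.tendsto_add_atTop_nat 1))
  refine ⟨velocity Λ, fun p => profile (p 0), c, fun q => scale (q + 1) ^ 2,
    ⟨_, norm_velocity_le Λ⟩, per_velocity Λ, velocity_holder Λ hα.1 hα.2,
    fun φ => integral_fderiv_velocity Λ, contDiff_profile.comp (by fun_prop), fun x k => ?_, hc,
    fun q => ⟨by have := scale_pos (q + 1); positivity,
      pow_lt_one₀ (scale_pos _).le (hlt q) two_ne_zero⟩,
    by simpa using hlim.pow 2, fun q θ hθ => ?_⟩
  · simp [profile_add_int]
  · simpa only [integral_dissip_solOfClassical] using h q (solOfClassical hθ)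

end
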